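/- Let m be a positive integer and let α = [a_0, a_1, a_2, …] be an irrational continued fraction whose partial quotients a_k are all positive integers. If α is m-palindromic, then either (1) α is transcendental, or (2) α is a quadratic irrational such that α/m is reduced. -/

import Mathlib

/-- Value of a finite continued fraction `[a₀, a₁, …, a_i] = a₀ + 1/(a₁ + 1/(⋯ + 1/a_i))`. -/
noncomputable def cfVal : List ℕ → ℝ
  | [] => 0
  | [a] => (a : ℝ)
  | a :: b :: rest => (a : ℝ) + 1 / cfVal (b :: rest)

/-- `A` is an `m`-palindrome: `[A] = m·[Ã]`, where `Ã` is the reversal of `A`. -/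
def IsMPal (m : ℕ) (A : List ℕ) : Prop := cfVal A = (m : ℝ) * cfVal A.reverse

/-- The prefix `(a₀, …, a_i)` of an infinite sequence of partial quotients. -/
def cfPrefix (a : ℕ → ℕ) (i : ℕ) : List ℕ := (List.range (i + 1)).map a

/-- Continuant numerators, index-shifted: `contP a (k+1) = p_k`, `contP a 0 = p₋₁ = 1`. -/
def contP (a : ℕ → ℕ) : ℕ → ℤ
  | 0 => 1
  | 1 => (a 0 : ℤ)
  | (k+2) => (a (k+1) : ℤ) * contP a (k+1) + contP a k

/-- Continuant denominators, index-shifted: `contQ a (k+1) = q_k`, `contQ a 0 = q₋₁ = 0`. -/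
def contQ (a : ℕ → ℕ) : ℕ → ℤ
  | 0 => 0
  | 1 => 1
  | (k+2) => (a (k+1) : ℤ) * contQ a (k+1) + contQ a k

/-- Concatenation of `k` copies of the finite sequence `A`. -/
def listPow (A : List ℕ) (k : ℕ) : List ℕ := (List.replicate k A).flatten

/-- `x` is a quadratic irrational. -/
def IsQuadraticIrrational (x : ℝ) : Prop :=
  Irrational x ∧ ∃ a b c : ℤ, a ≠ 0 ∧ (a : ℝ) * x ^ 2 + (b : ℝ) * x + (c : ℝ) = 0

/-- `x` is a reduced quadratic irrational: `x > 1` and its algebraic (Galois) conjugate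
lies strictly between `-1` and `0`. -/
def IsReducedQuadIrr (x : ℝ) : Prop :=
  Irrational x ∧ 1 < x ∧
    ∃ a b c : ℤ, a ≠ 0 ∧ (a : ℝ) * x ^ 2 + (b : ℝ) * x + (c : ℝ) = 0 ∧
      ∀ y : ℝ, y ≠ x → (a : ℝ) * y ^ 2 + (b : ℝ) * y + (c : ℝ) = 0 → -1 < y ∧ y < 0

/-- `x` and `y` are equivalent: `x = (a + b·y)/(c + d·y)` for integers with `ad - bc = ±1`. -/
def RealEquiv (x y : ℝ) : Prop :=
  ∃ a b c d : ℤ, (a * d - b * c = 1 ∨ a * d - b * c = -1) ∧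
    ((c : ℝ) + (d : ℝ) * y ≠ 0) ∧ x = ((a : ℝ) + (b : ℝ) * y) / ((c : ℝ) + (d : ℝ) * y)

theorem exists_generalized_wronskian_ne_zero {K A ι η : Type*} [Field K] [CommRing A] [IsDomain A]
    [Algebra K A] (D : ι → A →ₗ[K] A) (ord : ι → ℕ) (δ : η → Derivation K A A) (i₀ : ι)
    (hi₀ : D i₀ = LinearMap.id) (hord : ord i₀ = 0)
    (hstep : ∀ h i, ∃ i', ord i' ≤ ord i + 1 ∧ ∃ c : K, ∀ f, δ h (D i f) = c • D i' f)
    (hconst : ∀ f g, g ≠ 0 → (∀ h, g * δ h f = f * δ h g) → ∃ c : K, f = c • g)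
    (k : ℕ) (φ : Fin k → A) (hφ : LinearIndependent K φ) :
    ∃ I : Fin k → ι, (∀ j, ord (I j) < k) ∧
      (Matrix.of fun i j => D (I i) (φ j)).det ≠ 0 := by
  induction k with
  | zero => exact ⟨Fin.elim0, fun j => j.elim0, by simp⟩
  | succ k ih =>
    obtain ⟨I, hI, hdet⟩ := ih (fun j => φ j.succ) (hφ.comp _ (Fin.succ_injective _))
    by_contra! hcon
    set N : Fin (k + 1) → A := fun j =>
      (-1) ^ (j : ℕ) * (Matrix.of fun a b => D (I a) (φ (j.succAbove b))).det with hN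
    have hN0 : N 0 ≠ 0 := by simpa [hN] using hdet
    have hker : ∀ i, ord i < k + 1 → ∑ j, N j * D i (φ j) = 0 := by
      intro i hi
      have h := hcon (Fin.cons i I) (by
        intro j
        refine Fin.cases ?_ (fun j => ?_) j
        · simpa using hi
        · simpa using (hI j).trans (Nat.lt_succ_self k))
      rw [Matrix.det_succ_row_zero] at h
      rw [← h]
      refine Finset.sum_congr rfl fun j _ => ?_
      simp only [hN, Matrix.of_apply, Fin.cons_zero]
      rw [mul_right_comm]
      congr 1
    have hprop : ∀ h j, N 0 * δ h (N j) = N j * δ h (N 0) := by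
      intro h
      have hd : ∀ a, ∑ j, δ h (N j) * D (I a) (φ j) = 0 := by
        intro a
        have h1 := congrArg (δ h) (hker (I a) ((hI a).trans (Nat.lt_succ_self k)))
        obtain ⟨i', hi', c, hc⟩ := hstep h (I a)
        have h2 : ∑ j, N j * δ h (D (I a) (φ j)) = 0 := by
          simp_rw [hc, mul_smul_comm, ← Finset.smul_sum]
          rw [hker i' (by have := hI a; omega), smul_zero]
        simp only [map_sum, Derivation.leibniz, map_zero, smul_eq_mul, Finset.sum_add_distrib] at h1
        rw [h2, zero_add] at h1
        rw [← h1]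
        exact Finset.sum_congr rfl fun j _ => mul_comm _ _
      have hv : (Matrix.of fun i j => D (I i) (φ (Fin.succ j))).mulVec
          (fun j => N 0 * δ h (N j.succ) - N j.succ * δ h (N 0)) = 0 := by
        funext a
        have e1 := hker (I a) ((hI a).trans (Nat.lt_succ_self k))
        have e2 := hd a
        rw [Fin.sum_univ_succ] at e1 e2
        simp only [Matrix.mulVec, dotProduct, Matrix.of_apply, Pi.zero_apply]
        have : ∑ x : Fin k, D (I a) (φ x.succ) * (N 0 * δ h (N x.succ) - N x.succ * δ h (N 0))
            = N 0 * (∑ x : Fin k, δ h (N x.succ) * D (I a) (φ x.succ))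
              - δ h (N 0) * ∑ x : Fin k, N x.succ * D (I a) (φ x.succ) := by
          rw [Finset.mul_sum, Finset.mul_sum, ← Finset.sum_sub_distrib]
          exact Finset.sum_congr rfl fun x _ => by ring
        rw [this]
        linear_combination N 0 * e2 - δ h (N 0) * e1
      have hz := Matrix.eq_zero_of_mulVec_eq_zero hdet hv
      intro j
      refine Fin.cases rfl (fun j => ?_) j
      exact sub_eq_zero.mp (congrFun hz j)
    choose c hc using fun j => hconst (N j) (N 0) hN0 (fun h => hprop h j)
    have h0 := hker i₀ (by omega)
    rw [hi₀] at h0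
    have h1 : N 0 * ∑ j, c j • φ j = 0 := by
      rw [Finset.mul_sum, ← h0]
      refine Finset.sum_congr rfl fun j _ => ?_
      conv_rhs => rw [hc j]
      simp
    have h2 := Fintype.linearIndependent_iff.mp hφ c ((mul_eq_zero.mp h1).resolve_left hN0) 0
    have h3 := hc 0
    rw [h2, zero_smul] at h3
    exact hN0 h3

theorem Polynomial.eq_smul_of_mul_derivative_eq {K : Type*} [Field K] [CharZero K]
    (f g : Polynomial K) (hg : g ≠ 0)
    (h : g * Polynomial.derivative f = f * Polynomial.derivative g) : ∃ c : K, f = c • g := by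
  have key : ∀ f' : Polynomial K, f' ≠ 0 →
      g * Polynomial.derivative f' = f' * Polynomial.derivative g → f'.natDegree = g.natDegree := by
    intro f' hf' h'
    have h1 : g * (Polynomial.X * Polynomial.derivative f')
        = f' * (Polynomial.X * Polynomial.derivative g) := by linear_combination Polynomial.X * h'
    have hx : ∀ p : Polynomial K, (Polynomial.X * Polynomial.derivative p).natDegree ≤ p.natDegree
        ∧ (Polynomial.X * Polynomial.derivative p).coeff p.natDegree
          = p.leadingCoeff * p.natDegree := by
      intro p
      have hc : ∀ n, (Polynomial.X * Polynomial.derivative p).coeff n = p.coeff n * n := by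
        intro n
        cases n with
        | zero => simp
        | succ n => rw [Polynomial.coeff_X_mul, Polynomial.coeff_derivative]; push_cast; rfl
      refine ⟨Polynomial.natDegree_le_iff_coeff_eq_zero.mpr fun n hn => ?_, hc _⟩
      rw [hc, Polynomial.coeff_eq_zero_of_natDegree_lt hn, zero_mul]
    have h2 := congrArg (fun p => Polynomial.coeff p (g.natDegree + f'.natDegree)) h1
    rw [Polynomial.coeff_mul_add_eq_of_natDegree_le le_rfl (hx f').1, (hx f').2,
      add_comm, Polynomial.coeff_mul_add_eq_of_natDegree_le le_rfl (hx g).1, (hx g).2] at h2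
    have h3 : (g.leadingCoeff * f'.leadingCoeff) * (f'.natDegree : K)
        = (g.leadingCoeff * f'.leadingCoeff) * (g.natDegree : K) := by
      simp only [Polynomial.leadingCoeff] at h2 ⊢
      linear_combination h2
    have h4 := mul_left_cancel₀ (mul_ne_zero (Polynomial.leadingCoeff_ne_zero.mpr hg)
      (Polynomial.leadingCoeff_ne_zero.mpr hf')) h3
    exact_mod_cast h4
  refine ⟨f.coeff g.natDegree / g.leadingCoeff, ?_⟩
  set c := f.coeff g.natDegree / g.leadingCoeff with hc
  by_contra hne
  have hne' : f - c • g ≠ 0 := sub_ne_zero.mpr hne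
  have hd := key (f - c • g) hne' (by
    simp only [map_sub, Polynomial.smul_eq_C_mul, Polynomial.derivative_C_mul]
    linear_combination h)
  have : (f - c • g).leadingCoeff = 0 := by
    rw [Polynomial.leadingCoeff, hd, Polynomial.coeff_sub, Polynomial.coeff_smul, hc, smul_eq_mul,
      ← Polynomial.leadingCoeff,
      div_mul_cancel₀ _ (Polynomial.leadingCoeff_ne_zero.mpr hg), sub_self]
  exact hne' (Polynomial.leadingCoeff_eq_zero.mp this)

theorem MvPolynomial.eq_smul_of_mul_pderiv_eq {K σ : Type*} [Field K] [CharZero K] [LinearOrder σ]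
    [WellFoundedGT σ] (f g : MvPolynomial σ K) (hg : g ≠ 0)
    (h : ∀ i, g * pderiv i f = f * pderiv i g) : ∃ c : K, f = c • g := by
  let m : MonomialOrder σ := MonomialOrder.lex
  have key : ∀ f' : MvPolynomial σ K, f' ≠ 0 →
      (∀ i, g * pderiv i f' = f' * pderiv i g) → m.degree f' = m.degree g := by
    intro f' hf' h'
    ext i
    have h1 : g * (X i * pderiv i f') = f' * (X i * pderiv i g) := by
      linear_combination X i * h' i
    have hc : ∀ (p : MvPolynomial σ K) n, coeff n (X i * pderiv i p) = coeff n p * n i := by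
      intro p n
      rw [mul_comm, coeff_mul_X']
      split_ifs with hi
      · rw [coeff_pderiv]
        have hle : Finsupp.single i 1 ≤ n := by
          rw [Finsupp.single_le_iff]
          exact Nat.one_le_iff_ne_zero.mpr (Finsupp.mem_support_iff.mp hi)
        rw [tsub_add_cancel_of_le hle]
        congr 1
        have := Finsupp.single_le_iff.mp hle
        simp only [Finsupp.coe_tsub, Pi.sub_apply, Finsupp.single_eq_same]
        push_cast [this]
        ring
      · rw [Finsupp.notMem_support_iff.mp hi]; simp
    have hx : ∀ p : MvPolynomial σ K, m.toSyn (m.degree (X i * pderiv i p)) ≤ m.toSyn (m.degree p) := by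
      intro p
      rw [MonomialOrder.degree_le_iff]
      intro b hb
      apply m.le_degree
      rw [mem_support_iff] at hb ⊢
      rw [hc] at hb
      exact left_ne_zero_of_mul hb
    have h2 := congrArg (fun p => coeff (m.degree g + m.degree f') p) h1
    rw [m.coeff_mul_of_add_of_degree_le le_rfl (hx f'), hc, add_comm,
      m.coeff_mul_of_add_of_degree_le le_rfl (hx g), hc] at h2
    have hg' : coeff (m.degree g) g ≠ 0 := by rwa [m.coeff_degree_ne_zero_iff]
    have hf'' : coeff (m.degree f') f' ≠ 0 := by rwa [m.coeff_degree_ne_zero_iff]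
    have h3 : (coeff (m.degree g) g * coeff (m.degree f') f') * (m.degree f' i : K)
        = (coeff (m.degree g) g * coeff (m.degree f') f') * (m.degree g i : K) := by
      linear_combination h2
    exact_mod_cast mul_left_cancel₀ (mul_ne_zero hg' hf'') h3
  have hg' : coeff (m.degree g) g ≠ 0 := by rwa [m.coeff_degree_ne_zero_iff]
  refine ⟨coeff (m.degree g) f / coeff (m.degree g) g, ?_⟩
  set c := coeff (m.degree g) f / coeff (m.degree g) g with hc
  by_contra hne
  have hne' : f - c • g ≠ 0 := sub_ne_zero.mpr hne
  have hd := key (f - c • g) hne' (by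
    intro i
    simp only [map_sub, smul_eq_C_mul, pderiv_C_mul]
    linear_combination h i)
  have : coeff (m.degree (f - c • g)) (f - c • g) = 0 := by
    rw [hd, coeff_sub, coeff_smul, hc, smul_eq_mul, div_mul_cancel₀ _ hg', sub_self]
  exact hne' (m.coeff_degree_eq_zero_iff.mp this)

namespace MvPolynomial

section Hasse

variable {σ R S : Type*} [Fintype σ] [CommRing R] [CommRing S]

/-- The Hasse (divided) derivative of multi-index `I`. -/
noncomputable def hasse (I : σ →₀ ℕ) : MvPolynomial σ R →ₗ[R] MvPolynomial σ R :=
  (basisMonomials σ R).constr R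
    (fun s => monomial (s - I) ((∏ h, (s h).choose (I h) : ℕ) : R))

theorem coeff_hasse (I t : σ →₀ ℕ) (f : MvPolynomial σ R) :
    coeff t (hasse I f) = coeff (t + I) f * ((∏ h, (t h + I h).choose (I h) : ℕ) : R) := by
  classical
  have : (lcoeff R t).comp (hasse I) =
      ((∏ h, (t h + I h).choose (I h) : ℕ) : R) • lcoeff (σ := σ) R (t + I) := by
    refine (basisMonomials σ R).ext fun s => ?_
    rw [LinearMap.comp_apply, LinearMap.smul_apply, hasse, Module.Basis.constr_basis]
    simp only [lcoeff_apply, coe_basisMonomials, coeff_monomial, smul_eq_mul]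
    by_cases hs : I ≤ s
    · have : s - I = t ↔ s = t + I := tsub_eq_iff_eq_add_of_le hs
      by_cases h : s = t + I
      · subst h
        simp
      · rw [if_neg h, if_neg (this.not.mpr h), mul_zero]
    · have h1 : ∏ h, (s h).choose (I h) = 0 := by
        obtain ⟨h, hh⟩ := not_forall.mp hs
        exact Finset.prod_eq_zero (Finset.mem_univ h) (Nat.choose_eq_zero_of_lt (not_le.mp hh))
      have h2 : s ≠ t + I := by rintro rfl; exact hs le_add_self
      rw [if_neg h2, h1]
      simp
  have h := LinearMap.congr_fun this f
  simp only [LinearMap.comp_apply, lcoeff_apply, LinearMap.smul_apply, smul_eq_mul] at h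
  rw [h, mul_comm]

theorem hasse_zero : hasse (0 : σ →₀ ℕ) = (LinearMap.id : MvPolynomial σ R →ₗ[R] _) := by
  ext1 s
  ext t
  simp [coeff_hasse]

theorem map_hasse (φ : R →+* S) (I : σ →₀ ℕ) (f : MvPolynomial σ R) :
    map φ (hasse I f) = hasse I (map φ f) := by
  ext t
  rw [coeff_map, coeff_hasse, coeff_hasse, coeff_map, map_mul, map_natCast]

theorem pderiv_hasse (i : σ) (I : σ →₀ ℕ) (f : MvPolynomial σ R) :
    pderiv i (hasse I f) = ((I i : R) + 1) • hasse (I + Finsupp.single i 1) f := by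
  classical
  ext t
  rw [coeff_pderiv, coeff_hasse, coeff_smul, coeff_hasse, add_right_comm t, ← add_assoc t I,
    smul_eq_mul]
  have key : (∏ h, ((t + (Finsupp.single i 1 : σ →₀ ℕ)) h + I h).choose (I h)) * (t i + 1)
      = (I i + 1) * ∏ h, (t h + (I + (Finsupp.single i 1 : σ →₀ ℕ)) h).choose ((I + (Finsupp.single i 1 : σ →₀ ℕ)) h) := by
    rw [← Finset.mul_prod_erase _ _ (Finset.mem_univ i),
      ← Finset.mul_prod_erase (a := i) Finset.univ
        (fun h => (t h + (I + (Finsupp.single i 1 : σ →₀ ℕ)) h).choose ((I + (Finsupp.single i 1 : σ →₀ ℕ)) h))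
        (Finset.mem_univ i)]
    have h1 : ∏ h ∈ Finset.univ.erase i, ((t + (Finsupp.single i 1 : σ →₀ ℕ)) h + I h).choose (I h)
        = ∏ h ∈ Finset.univ.erase i,
          (t h + (I + (Finsupp.single i 1 : σ →₀ ℕ)) h).choose ((I + (Finsupp.single i 1 : σ →₀ ℕ)) h) := by
      refine Finset.prod_congr rfl fun h hh => ?_
      have : Finsupp.single i 1 h = 0 := Finsupp.single_eq_of_ne (Finset.ne_of_mem_erase hh)
      simp [this]
    rw [h1]
    simp only [Finsupp.coe_add, Pi.add_apply, Finsupp.single_eq_same]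
    have h2 := Nat.choose_succ_right_eq (t i + 1 + I i) (I i)
    have h3 : t i + 1 + I i - I i = t i + 1 := by omega
    rw [h3] at h2
    have h4 : t i + (I i + 1) = t i + 1 + I i := by omega
    rw [h4]
    linear_combination (∏ h ∈ Finset.univ.erase i,
          (t h + (I h + Finsupp.single i 1 h)).choose (I h + Finsupp.single i 1 h)) * h2.symm
  have key' := congrArg (Nat.cast : ℕ → R) key
  push_cast at key' ⊢
  linear_combination (coeff (t + I + Finsupp.single i 1) f) * key'

/-- The substitution `X ↦ X + ζ`. -/
noncomputable def translate (ζ : σ → R) : MvPolynomial σ R →ₐ[R] MvPolynomial σ R :=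
  aeval fun h => X h + C (ζ h)

theorem pderiv_translate {σ R : Type*} [CommRing R] (ζ : σ → R) (i : σ) (f : MvPolynomial σ R) :
    pderiv i (translate ζ f) = translate ζ (pderiv i f) := by
  classical
  induction f using MvPolynomial.induction_on with
  | C a => simp [translate]
  | add p q hp hq => simp [hp, hq]
  | mul_X p n hp =>
    rw [map_mul, pderiv_mul, hp, pderiv_mul, map_add, map_mul, map_mul]
    congr 2
    simp only [translate, aeval_X, map_add, pderiv_C, add_zero, pderiv_X]
    by_cases h : n = i
    · subst h; simp
    · simp [h]

theorem translate_hasse {K : Type*} [Field K] [CharZero K] (ζ : σ → K) (I : σ →₀ ℕ)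
    (f : MvPolynomial σ K) : translate ζ (hasse I f) = hasse I (translate ζ f) := by
  classical
  obtain ⟨n, hn⟩ : ∃ n, ∑ h, I h = n := ⟨_, rfl⟩
  induction n generalizing I with
  | zero =>
    have : I = 0 := by
      ext h
      exact Finset.sum_eq_zero_iff.mp hn h (Finset.mem_univ h)
    simp [this, hasse_zero]
  | succ n ih =>
    obtain ⟨i, -, hi⟩ : ∃ i ∈ Finset.univ, I i ≠ 0 := by
      by_contra! h
      rw [Finset.sum_eq_zero h] at hn
      omega
    have hle : Finsupp.single i 1 ≤ I := Finsupp.single_le_iff.mpr (Nat.one_le_iff_ne_zero.mpr hi)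
    obtain ⟨J, rfl⟩ : ∃ J, I = J + Finsupp.single i 1 := ⟨I - Finsupp.single i 1, by
      rw [tsub_add_cancel_of_le hle]⟩
    have hJ : ∑ h, J h = n := by
      simp only [Finsupp.coe_add, Pi.add_apply, Finset.sum_add_distrib] at hn
      have : ∑ x, (Finsupp.single i 1 : σ →₀ ℕ) x = 1 := by simp [Finsupp.single_apply]
      omega
    have h1 := congrArg (pderiv i) (ih J hJ)
    rw [pderiv_translate, pderiv_hasse, pderiv_hasse, map_smul] at h1
    exact smul_right_injective _ (Nat.cast_add_one_ne_zero (J i)) h1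

theorem eval_hasse {K : Type*} [Field K] [CharZero K] (ζ : σ → K) (I : σ →₀ ℕ)
    (f : MvPolynomial σ K) : eval ζ (hasse I f) = coeff I (translate ζ f) := by
  have h1 : ∀ g : MvPolynomial σ K, eval ζ g = coeff 0 (translate ζ g) := by
    intro g
    have : (constantCoeff : MvPolynomial σ K →+* K).comp (translate ζ : _ →ₐ[K] _).toRingHom
        = eval ζ := by
      ext <;> simp [translate]
    rw [← this]
    rfl
  rw [h1, translate_hasse, coeff_hasse]
  simp

theorem eval_hasse_eq_sum (ζ : σ → R) (I : σ →₀ ℕ) (f : MvPolynomial σ R) :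
    eval ζ (hasse I f)
      = ∑ s ∈ f.support, coeff s f * ∏ h, (((s h).choose (I h) : R) * ζ h ^ (s h - I h)) := by
  classical
  conv_lhs => rw [f.as_sum, map_sum, map_sum]
  refine Finset.sum_congr rfl fun s _ => ?_
  have : monomial s (coeff s f) = coeff s f • (basisMonomials σ R) s := by
    rw [coe_basisMonomials, smul_monomial, smul_eq_mul, mul_one]
  rw [this, map_smul, hasse, Module.Basis.constr_basis, smul_eval, eval_monomial,
    Finset.prod_mul_distrib, Finsupp.prod_fintype _ _ (fun _ => pow_zero _)]
  push_cast
  rfl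

end Hasse

section Len

variable {σ R : Type*} [NormedCommRing R]

/-- The sum of the norms of the coefficients. -/
noncomputable def len (f : MvPolynomial σ R) : ℝ := ∑ s ∈ f.support, ‖coeff s f‖

theorem len_eq_sum {f : MvPolynomial σ R} {S : Finset (σ →₀ ℕ)} (h : f.support ⊆ S) :
    len f = ∑ s ∈ S, ‖coeff s f‖ := by
  refine Finset.sum_subset h fun s _ hs => ?_
  rw [notMem_support_iff.mp hs, norm_zero]

theorem len_nonneg (f : MvPolynomial σ R) : 0 ≤ len f :=
  Finset.sum_nonneg fun _ _ => norm_nonneg _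

theorem norm_coeff_le_len (s : σ →₀ ℕ) (f : MvPolynomial σ R) : ‖coeff s f‖ ≤ len f := by
  by_cases h : s ∈ f.support
  · exact Finset.single_le_sum (f := fun s => ‖coeff s f‖) (fun _ _ => norm_nonneg _) h
  · rw [notMem_support_iff.mp h, norm_zero]
    exact len_nonneg f

@[simp] theorem len_zero : len (0 : MvPolynomial σ R) = 0 := by simp [len]

theorem len_add_le (f g : MvPolynomial σ R) : len (f + g) ≤ len f + len g := by
  classical
  rw [len_eq_sum (support_add (p := f) (q := g)),
    len_eq_sum (Finset.subset_union_left (s₁ := f.support) (s₂ := g.support)),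
    len_eq_sum (Finset.subset_union_right (s₁ := f.support) (s₂ := g.support)),
    ← Finset.sum_add_distrib]
  exact Finset.sum_le_sum fun s _ => by rw [coeff_add]; exact norm_add_le _ _

theorem len_sum_le {ι : Type*} (S : Finset ι) (f : ι → MvPolynomial σ R) :
    len (∑ i ∈ S, f i) ≤ ∑ i ∈ S, len (f i) := by
  classical
  induction S using Finset.induction_on with
  | empty => simp
  | insert a S ha ih =>
    rw [Finset.sum_insert ha, Finset.sum_insert ha]
    exact (len_add_le _ _).trans (by gcongr)

theorem len_monomial (s : σ →₀ ℕ) (a : R) : len (monomial s a) = ‖a‖ := by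
  classical
  rw [len_eq_sum (support_monomial_subset (s := s) (a := a))]
  simp

theorem len_C (a : R) : len (C a : MvPolynomial σ R) = ‖a‖ := len_monomial 0 a

theorem len_mul_le (f g : MvPolynomial σ R) : len (f * g) ≤ len f * len g := by
  have : f * g = ∑ s ∈ f.support, ∑ t ∈ g.support, monomial (s + t) (coeff s f * coeff t g) := by
    conv_lhs => rw [f.as_sum, g.as_sum, Finset.sum_mul_sum]
    simp [monomial_mul]
  rw [this, show len f * len g = ∑ s ∈ f.support, ∑ t ∈ g.support, ‖coeff s f‖ * ‖coeff t g‖ from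
    Finset.sum_mul_sum _ _ _ _]
  refine (len_sum_le _ _).trans (Finset.sum_le_sum fun s _ => ?_)
  refine (len_sum_le _ _).trans (Finset.sum_le_sum fun t _ => ?_)
  rw [len_monomial]
  exact norm_mul_le _ _

variable [NormOneClass R]

theorem len_one : len (1 : MvPolynomial σ R) = 1 := by
  rw [← C_1, len_C, norm_one]

theorem len_prod_le {ι : Type*} (S : Finset ι) (f : ι → MvPolynomial σ R) :
    len (∏ i ∈ S, f i) ≤ ∏ i ∈ S, len (f i) := by
  classical
  induction S using Finset.induction_on with
  | empty => simp [len_one]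
  | insert a S ha ih =>
    rw [Finset.prod_insert ha, Finset.prod_insert ha]
    exact (len_mul_le _ _).trans (mul_le_mul_of_nonneg_left ih (len_nonneg _))

theorem len_pow_le (f : MvPolynomial σ R) (n : ℕ) : len (f ^ n) ≤ len f ^ n := by
  simpa using len_prod_le (Finset.range n) (fun _ => f)

theorem len_hasse_le [Fintype σ] (I : σ →₀ ℕ) (f : MvPolynomial σ R) (r : σ → ℕ)
    (hr : ∀ h, f.degreeOf h ≤ r h) : len (hasse I f) ≤ 2 ^ (∑ h, r h) * len f := by
  classical
  conv_lhs => rw [f.as_sum, map_sum]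
  refine (len_sum_le _ _).trans ?_
  rw [len, Finset.mul_sum]
  refine Finset.sum_le_sum fun s hs => ?_
  have : monomial s (coeff s f) = coeff s f • (basisMonomials σ R) s := by
    rw [coe_basisMonomials, smul_monomial, smul_eq_mul, mul_one]
  rw [this, map_smul, hasse, Module.Basis.constr_basis, smul_monomial, len_monomial, smul_eq_mul,
    mul_comm]
  refine (norm_mul_le _ _).trans (mul_le_mul_of_nonneg_right ?_ (norm_nonneg _))
  refine (Nat.norm_cast_le _).trans ?_
  rw [norm_one, mul_one, ← Finset.prod_pow_eq_pow_sum]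
  push_cast
  refine Finset.prod_le_prod (fun _ _ => by positivity) fun h _ => ?_
  calc (((s h).choose (I h) : ℕ) : ℝ) ≤ ((2 ^ s h : ℕ) : ℝ) := by
        exact_mod_cast Nat.choose_le_two_pow _ _
    _ ≤ 2 ^ r h := by
        push_cast
        exact pow_le_pow_right₀ (by norm_num)
          ((monomial_le_degreeOf h hs).trans (hr h))

end Len

end MvPolynomial

namespace MvPolynomial

section HeadTail

variable {K : Type*} [Field K] {n : ℕ}

/-- The product of a polynomial in the variable `0` and a polynomial in the other variables. -/
noncomputable def headTail (ψ : Polynomial K) (φ : MvPolynomial (Fin n) K) :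
    MvPolynomial (Fin (n + 1)) K :=
  Polynomial.aeval (X 0) ψ * rename Fin.succ φ

theorem coeff_headTail (e : ℕ) (s : Fin n →₀ ℕ) (ψ : Polynomial K) (φ : MvPolynomial (Fin n) K) :
    coeff (Finsupp.cons e s) (headTail ψ φ) = ψ.coeff e * coeff s φ := by
  have h1 : finSuccEquiv K n (Polynomial.aeval (X 0) ψ) = Polynomial.map C ψ := by
    have : (finSuccEquiv K n).toAlgHom.comp (Polynomial.aeval (X 0))
        = Polynomial.mapAlgHom (Algebra.ofId K (MvPolynomial (Fin n) K)) := by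
      ext1
      simp [finSuccEquiv_X_zero]
    exact DFunLike.congr_fun this ψ
  have h2 : finSuccEquiv K n (rename Fin.succ φ) = Polynomial.C φ := by
    have : (finSuccEquiv K n).toAlgHom.comp (rename Fin.succ)
        = (Polynomial.CAlgHom).comp (AlgHom.id K (MvPolynomial (Fin n) K)) := by
      ext1 i
      simp [finSuccEquiv_X_succ, Polynomial.CAlgHom]
    exact DFunLike.congr_fun this φ
  rw [← finSuccEquiv_coeff_coeff, headTail, map_mul, h1, h2, Polynomial.coeff_mul_C,
    Polynomial.coeff_map, coeff_C_mul]

theorem ext_cons {R : Type*} [CommSemiring R] {f g : MvPolynomial (Fin (n + 1)) R}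
    (h : ∀ e s, coeff (Finsupp.cons e s) f = coeff (Finsupp.cons e s) g) : f = g := by
  ext t
  rw [← Finsupp.cons_tail t]
  exact h _ _

theorem hasse_headTail (o : ℕ) (Δ : Fin n →₀ ℕ) (ψ : Polynomial K) (φ : MvPolynomial (Fin n) K) :
    hasse (Finsupp.cons o Δ) (headTail ψ φ)
      = headTail (Polynomial.hasseDeriv o ψ) (hasse Δ φ) := by
  refine ext_cons fun e s => ?_
  have h : (Finsupp.cons e s + Finsupp.cons o Δ : Fin (n + 1) →₀ ℕ)
      = Finsupp.cons (e + o) (s + Δ) := by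
    ext i
    refine Fin.cases ?_ (fun i => ?_) i <;> simp
  rw [coeff_hasse, h, coeff_headTail, coeff_headTail, coeff_hasse, Polynomial.hasseDeriv_coeff,
    Fin.prod_univ_succ]
  simp only [Finsupp.cons_zero, Finsupp.cons_succ]
  push_cast
  ring

theorem translate_headTail (ζ : Fin (n + 1) → K) (ψ : Polynomial K) (φ : MvPolynomial (Fin n) K) :
    translate ζ (headTail ψ φ)
      = headTail (Polynomial.taylor (ζ 0) ψ) (translate (fun i => ζ i.succ) φ) := by
  rw [headTail, headTail, map_mul]
  congr 1
  · have : (translate ζ).comp (Polynomial.aeval (X 0))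
        = (Polynomial.aeval (X 0)).comp (Polynomial.taylorAlgHom (ζ 0)) := by
      ext1
      simp [translate, algebraMap_eq]
    exact DFunLike.congr_fun this ψ
  · have : (translate ζ).comp (rename Fin.succ)
        = (rename Fin.succ).comp (translate fun i => ζ i.succ) := by
      ext1 i
      simp [translate]
    exact DFunLike.congr_fun this φ

theorem headTail_sum_mul {ι : Type*} (S : Finset ι) (ψ : ι → Polynomial K)
    (φ : ι → MvPolynomial (Fin n) K) (e : ℕ) (s : Fin n →₀ ℕ) :
    coeff (Finsupp.cons e s) (∑ l ∈ S, headTail (ψ l) (φ l))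
      = ∑ l ∈ S, (ψ l).coeff e * coeff s (φ l) := by
  rw [coeff_sum]
  exact Finset.sum_congr rfl fun l _ => coeff_headTail _ _ _ _

theorem exists_eq_sum_headTail (f : MvPolynomial (Fin (n + 1)) K) (hf : f ≠ 0) :
    ∃ k : ℕ, 0 < k ∧ k ≤ degreeOf 0 f + 1 ∧ ∃ (φ : Fin k → MvPolynomial (Fin n) K)
      (ψ : Fin k → Polynomial K), LinearIndependent K φ ∧ LinearIndependent K ψ ∧
      f = ∑ l, headTail (ψ l) (φ l) := by
  set F := finSuccEquiv K n f with hF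
  have hF0 : F ≠ 0 := by simpa [hF] using hf
  set d := degreeOf 0 f with hd
  have hdeg : F.natDegree = d := natDegree_finSuccEquiv f
  let g : Fin (d + 1) → MvPolynomial (Fin n) K := fun e => F.coeff e
  set V := Submodule.span K (Set.range g) with hV
  have : FiniteDimensional K V := FiniteDimensional.span_of_finite K (Set.finite_range g)
  have hmem : ∀ e, F.coeff e ∈ V := by
    intro e
    by_cases he : e < d + 1
    · exact Submodule.subset_span ⟨⟨e, he⟩, rfl⟩
    · rw [Polynomial.coeff_eq_zero_of_natDegree_lt (by omega)]
      exact V.zero_mem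
  let b := Module.finBasis K V
  let ψ : Fin (Module.finrank K V) → Polynomial K := fun l =>
    ∑ e ∈ Finset.range (d + 1), Polynomial.monomial e (b.repr ⟨F.coeff e, hmem e⟩ l)
  have hψ : ∀ l e, (ψ l).coeff e = b.repr ⟨F.coeff e, hmem e⟩ l := by
    intro l e
    simp only [ψ, Polynomial.finsetSum_coeff, Polynomial.coeff_monomial, Finset.sum_ite_eq',
      Finset.mem_range]
    split_ifs with h
    · rfl
    · have : (⟨F.coeff e, hmem e⟩ : V) = 0 := by
        ext1
        have h' : F.natDegree < e := by omega
        exact Polynomial.coeff_eq_zero_of_natDegree_lt h'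
      rw [this]; simp
  refine ⟨Module.finrank K V, ?_, ?_, fun l => (b l : MvPolynomial (Fin n) K), ψ, ?_, ?_, ?_⟩
  · rw [Module.finrank_pos_iff_exists_ne_zero]
    refine ⟨⟨F.coeff d, hmem d⟩, ?_⟩
    rw [Ne, Submodule.mk_eq_zero, ← hdeg]
    exact Polynomial.leadingCoeff_ne_zero.mpr hF0
  · simpa [Set.finrank] using finrank_range_le_card (R := K) g
  · exact b.linearIndependent.map' V.subtype V.ker_subtype
  · rw [Fintype.linearIndependent_iff]
    intro c hc l
    let L : V →ₗ[K] K := b.constr K c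
    have hL : ∀ e, L ⟨F.coeff e, hmem e⟩ = 0 := by
      intro e
      have := congrArg (fun p => Polynomial.coeff p e) hc
      simp only [Polynomial.finsetSum_coeff, Polynomial.coeff_smul, hψ, smul_eq_mul,
        Polynomial.coeff_zero] at this
      rw [Module.Basis.constr_apply_fintype, ← this]
      exact Finset.sum_congr rfl fun i _ => by rw [smul_eq_mul, mul_comm]; rfl
    have hL0 : ∀ v (hv : v ∈ V), L ⟨v, hv⟩ = 0 := by
      intro v hv
      induction hv using Submodule.span_induction with
      | mem x hx => obtain ⟨e, rfl⟩ := hx; exact hL e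
      | zero => exact map_zero L
      | add x y hx hy h1 h2 =>
        have := map_add L ⟨x, hx⟩ ⟨y, hy⟩
        rw [h1, h2, add_zero] at this
        exact this
      | smul a x hx h1 =>
        have := map_smul L a ⟨x, hx⟩
        rw [h1, smul_zero] at this
        exact this
    have := hL0 (b l) (b l).2
    simpa [L, Module.Basis.constr_basis] using this
  · refine ext_cons fun e s => ?_
    rw [headTail_sum_mul, ← finSuccEquiv_coeff_coeff]
    have h1 := congrArg (Subtype.val) (b.sum_repr ⟨F.coeff e, hmem e⟩)
    have h2 : ∑ l, b.repr ⟨F.coeff e, hmem e⟩ l • (b l : MvPolynomial (Fin n) K) = F.coeff e := by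
      rw [AddSubmonoidClass.coe_finsetSum] at h1
      exact h1
    rw [← hF, ← h2, coeff_sum]
    refine Finset.sum_congr rfl fun l _ => ?_
    rw [hψ, coeff_smul, smul_eq_mul]

theorem det_hasse_sum_headTail {k : ℕ} (ψ : Fin k → Polynomial K)
    (φ : Fin k → MvPolynomial (Fin n) K) (o : Fin k → ℕ) (Δ : Fin k → Fin n →₀ ℕ) :
    (Matrix.of fun i j => hasse (Finsupp.cons (o j) (Δ i)) (∑ l, headTail (ψ l) (φ l))).det
      = headTail (Matrix.of fun i j => Polynomial.hasseDeriv (o i) (ψ j)).det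
        (Matrix.of fun i j => hasse (Δ i) (φ j)).det := by
  have h : (Matrix.of fun i j => hasse (Finsupp.cons (o j) (Δ i)) (∑ l, headTail (ψ l) (φ l)))
      = (rename Fin.succ).toRingHom.mapMatrix (Matrix.of fun i j => hasse (Δ i) (φ j)) *
        ((Polynomial.aeval (X 0 : MvPolynomial (Fin (n + 1)) K)).toRingHom.mapMatrix
          (Matrix.of fun i j => Polynomial.hasseDeriv (o i) (ψ j))).transpose := by
    ext1 i j
    simp only [Matrix.of_apply, Matrix.mul_apply, map_sum, hasse_headTail, Matrix.transpose_apply,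
      RingHom.mapMatrix_apply, Matrix.map_apply]
    exact Finset.sum_congr rfl fun l _ => mul_comm _ _
  rw [h, Matrix.det_mul, Matrix.det_transpose, ← RingHom.map_det, ← RingHom.map_det, mul_comm]
  rfl

end HeadTail

end MvPolynomial

theorem Polynomial.exists_wronskian_ne_zero {K : Type*} [Field K] [CharZero K] {k : ℕ}
    (ψ : Fin k → Polynomial K) (hψ : LinearIndependent K ψ) :
    ∃ o : Fin k → ℕ, Function.Injective o ∧ (∀ j, o j < k) ∧
      (Matrix.of fun i j => Polynomial.hasseDeriv (o i) (ψ j)).det ≠ 0 := by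
  obtain ⟨o, ho, hdet⟩ := exists_generalized_wronskian_ne_zero (K := K) (A := Polynomial K)
    (fun o : ℕ => Polynomial.hasseDeriv o) id (fun _ : Unit => Polynomial.derivative') 0
    (LinearMap.ext Polynomial.hasseDeriv_zero') rfl (fun _ i => ⟨i + 1, le_rfl, (i + 1 : K), fun f => by
      ext t
      simp only [Polynomial.derivative'_apply, Polynomial.coeff_derivative,
        Polynomial.hasseDeriv_coeff, Polynomial.coeff_smul, smul_eq_mul]
      have h2 := Nat.choose_succ_right_eq (t + 1 + i) i
      rw [show t + 1 + i - i = t + 1 by omega] at h2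
      have h3 : t + (i + 1) = t + 1 + i := by omega
      rw [h3]
      have h4 := congrArg (Nat.cast : ℕ → K) h2
      push_cast at h4
      linear_combination (-f.coeff (t + 1 + i)) * h4⟩)
    (fun f g hg h => Polynomial.eq_smul_of_mul_derivative_eq f g hg (h ())) k ψ hψ
  refine ⟨o, fun i j hij => ?_, ho, hdet⟩
  by_contra hne
  refine hdet (Matrix.det_zero_of_row_eq hne ?_)
  ext1 l
  simp [hij]

theorem MvPolynomial.exists_wronskian_ne_zero {K : Type*} [Field K] [CharZero K] {n k : ℕ}
    (φ : Fin k → MvPolynomial (Fin n) K) (hφ : LinearIndependent K φ) :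
    ∃ Δ : Fin k → Fin n →₀ ℕ, (∀ j, ∑ h, Δ j h < k) ∧
      (Matrix.of fun i j => hasse (Δ i) (φ j)).det ≠ 0 :=
  exists_generalized_wronskian_ne_zero (K := K) (A := MvPolynomial (Fin n) K)
    (fun Δ : Fin n →₀ ℕ => hasse Δ) (fun Δ => ∑ h, Δ h) (fun h => pderiv h) 0
    hasse_zero (by simp) (fun h Δ => ⟨Δ + Finsupp.single h 1, by
      simp [Finset.sum_add_distrib, Finsupp.single_apply], (Δ h : K) + 1, fun f => pderiv_hasse _ _ _⟩)
    (fun f g hg h => eq_smul_of_mul_pderiv_eq f g hg h) k φ hφ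

theorem Polynomial.exists_coeff_taylor_ne_zero_and_pow_le (F : Polynomial ℤ) (hF : F ≠ 0) (p q : ℤ)
    (hq : 0 < q) (hpq : IsCoprime p q) :
    ∃ l, (Polynomial.taylor ((p : ℚ) / q) (F.map (Int.castRingHom ℚ))).coeff l ≠ 0 ∧
      (q : ℝ) ^ l ≤ |(F.leadingCoeff : ℝ)| := by
  set G := F.map (Int.castRingHom ℚ) with hG
  have hG0 : G ≠ 0 := (Polynomial.map_ne_zero_iff (Int.cast_injective)).mpr hF
  set a : ℚ := (p : ℚ) / q with ha
  have hq0 : (q : ℚ) ≠ 0 := by exact_mod_cast hq.ne'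
  refine ⟨G.rootMultiplicity a, ?_, ?_⟩
  · rw [Polynomial.rootMultiplicity_eq_natTrailingDegree, ← Polynomial.taylor_apply]
    refine Polynomial.coeff_natTrailingDegree_ne_zero.mpr ?_
    rwa [Ne, Polynomial.taylor_eq_zero]
  · set l := G.rootMultiplicity a
    have h1 : (Polynomial.X - Polynomial.C a) ^ l ∣ G := Polynomial.pow_rootMultiplicity_dvd G a
    set L : Polynomial ℤ := Polynomial.C q * Polynomial.X - Polynomial.C p with hL
    have hLp : L.IsPrimitive := by
      intro r hr
      rw [Polynomial.C_dvd_iff_dvd_coeff] at hr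
      have e0 := hr 0
      have e1 := hr 1
      simp only [hL, Polynomial.coeff_sub, Polynomial.coeff_C_mul, Polynomial.coeff_X_zero,
        Polynomial.coeff_X_one, Polynomial.coeff_C_zero, Polynomial.coeff_C_succ, mul_zero, mul_one,
        zero_sub, sub_zero, dvd_neg] at e0 e1
      exact hpq.isUnit_of_dvd' e0 e1
    have hLpow : ∀ n : ℕ, (L ^ n).IsPrimitive := by
      intro n
      induction n with
      | zero => simp
      | succ n ih => rw [pow_succ]; exact ih.mul hLp
    have h2 : (L ^ l).map (Int.castRingHom ℚ) ∣ G := by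
      refine dvd_trans ?_ h1
      rw [Polynomial.map_pow]
      refine pow_dvd_pow_of_dvd ⟨Polynomial.C (1 / (q : ℚ)), ?_⟩ l
      rw [hL, Polynomial.map_sub, Polynomial.map_mul, Polynomial.map_C, Polynomial.map_C,
        Polynomial.map_X, sub_mul, mul_right_comm, ← Polynomial.C_mul, ← Polynomial.C_mul, eq_intCast,
        eq_intCast, mul_one_div_cancel hq0, mul_one_div, Polynomial.C_1, one_mul]
    have h3 : L ^ l ∣ F :=
      (Polynomial.IsPrimitive.Int.dvd_iff_map_cast_dvd_map_cast _ _ (hLpow l)).mpr h2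
    obtain ⟨H, hH⟩ := h3
    have hlead : F.leadingCoeff = q ^ l * H.leadingCoeff := by
      rw [hH, Polynomial.leadingCoeff_mul, Polynomial.leadingCoeff_pow]
      congr 2
      have : L.natDegree = 1 := by
        rw [hL, sub_eq_add_neg, ← Polynomial.C_neg]
        exact Polynomial.natDegree_linear hq.ne'
      rw [Polynomial.leadingCoeff, this, hL, Polynomial.coeff_sub, Polynomial.coeff_C_succ,
        Polynomial.coeff_C_mul, Polynomial.coeff_X_one, mul_one, sub_zero]
    have hH0 : H.leadingCoeff ≠ 0 := by
      intro h
      rw [h, mul_zero, Polynomial.leadingCoeff_eq_zero] at hlead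
      exact hF hlead
    rw [hlead]
    push_cast
    rw [abs_mul, abs_of_pos (by positivity : (0 : ℝ) < (q : ℝ) ^ l)]
    have : (1 : ℝ) ≤ |(H.leadingCoeff : ℝ)| := by exact_mod_cast Int.one_le_abs hH0
    nlinarith [show (0 : ℝ) < (q : ℝ) ^ l by positivity]

namespace MvPolynomial

section Weight

variable {σ R : Type*} [Fintype σ] [CommRing R]

/-- Every monomial of `f` has `w`-weight at least `β`. -/
def WeightGE (w : σ → ℝ) (β : ℝ) (f : MvPolynomial σ R) : Prop :=
  ∀ t, coeff t f ≠ 0 → β ≤ ∑ h, w h * (t h : ℝ)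

theorem WeightGE.mul {w : σ → ℝ} {β γ : ℝ} {f g : MvPolynomial σ R} (hf : WeightGE w β f)
    (hg : WeightGE w γ g) : WeightGE w (β + γ) (f * g) := by
  classical
  intro t ht
  rw [coeff_mul] at ht
  obtain ⟨⟨a, b⟩, hab, h⟩ := Finset.exists_ne_zero_of_sum_ne_zero ht
  rw [Finset.HasAntidiagonal.mem_antidiagonal] at hab
  have h1 := hf a (left_ne_zero_of_mul h)
  have h2 := hg b (right_ne_zero_of_mul h)
  have h3 : ∑ h, w h * (t h : ℝ) = ∑ h, w h * (a h : ℝ) + ∑ h, w h * (b h : ℝ) := by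
    rw [← Finset.sum_add_distrib, ← hab]
    exact Finset.sum_congr rfl fun i _ => by simp [mul_add]
  linarith

theorem WeightGE.prod {ι : Type*} {w : σ → ℝ} (S : Finset ι) {β : ι → ℝ}
    {f : ι → MvPolynomial σ R} (hf : ∀ i, WeightGE w (β i) (f i)) :
    WeightGE w (∑ i ∈ S, β i) (∏ i ∈ S, f i) := by
  classical
  induction S using Finset.induction_on with
  | empty =>
    intro t ht
    rw [Finset.prod_empty, coeff_one] at ht
    have h0 : (0 : σ →₀ ℕ) = t := by
      by_contra h
      exact ht (if_neg h)
    subst h0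
    simp
  | insert a S ha ih =>
    rw [Finset.sum_insert ha, Finset.prod_insert ha]
    exact (hf a).mul ih

theorem WeightGE.det {w : σ → ℝ} {k : ℕ} {β : Fin k → ℝ}
    {M : Matrix (Fin k) (Fin k) (MvPolynomial σ R)} (hM : ∀ i j, WeightGE w (β j) (M i j)) :
    WeightGE w (∑ j, β j) M.det := by
  intro t ht
  rw [Matrix.det_apply, coeff_sum] at ht
  obtain ⟨τ, -, h⟩ := Finset.exists_ne_zero_of_sum_ne_zero ht
  refine WeightGE.prod Finset.univ (fun i => hM (τ i) i) t fun h0 => h ?_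
  rw [coeff_smul, h0, smul_zero]

end Weight

theorem len_det_le {σ : Type*} {k : ℕ} (M : Matrix (Fin k) (Fin k) (MvPolynomial σ ℤ)) (L : ℝ)
    (hM : ∀ i j, len (M i j) ≤ L) : len M.det ≤ k.factorial * L ^ k := by
  rw [Matrix.det_apply]
  refine (len_sum_le _ _).trans ?_
  have : ∀ τ : Equiv.Perm (Fin k), len (Equiv.Perm.sign τ • ∏ i, M (τ i) i) ≤ L ^ k := by
    intro τ
    have h1 : len (∏ i, M (τ i) i) ≤ L ^ k := by
      refine (len_prod_le _ _).trans ?_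
      refine (Finset.prod_le_prod (fun _ _ => len_nonneg _) fun i _ => hM _ _).trans_eq ?_
      simp
    have hneg : ∀ f : MvPolynomial σ ℤ, len (-f) = len f := fun f => by simp [len, support_neg]
    rcases Int.units_eq_one_or (Equiv.Perm.sign τ) with h | h
    · rw [h, one_smul]; exact h1
    · rw [h, Units.neg_smul, one_smul, hneg]; exact h1
  refine (Finset.sum_le_sum fun τ _ => this τ).trans_eq ?_
  simp [Fintype.card_perm]

theorem degreeOf_det_le {σ R : Type*} [CommRing R] {k : ℕ}
    (M : Matrix (Fin k) (Fin k) (MvPolynomial σ R)) (i : σ) (r : ℕ)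
    (hM : ∀ a b, degreeOf i (M a b) ≤ r) : degreeOf i M.det ≤ k * r := by
  rw [Matrix.det_apply]
  refine (degreeOf_sum_le _ _ _).trans (Finset.sup_le fun τ _ => ?_)
  have h1 : degreeOf i (∏ a, M (τ a) a) ≤ k * r := by
    refine (degreeOf_prod_le _ _ _).trans ((Finset.sum_le_sum fun a _ => hM _ _).trans_eq ?_)
    simp
  have hneg : ∀ f : MvPolynomial σ R, degreeOf i (-f) = degreeOf i f := fun f => by
    classical
    simp [degreeOf_eq_sup, support_neg]
  rcases Int.units_eq_one_or (Equiv.Perm.sign τ) with h | h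
  · rw [h, one_smul]; exact h1
  · rw [h, Units.neg_smul, one_smul, hneg]; exact h1

theorem degreeOf_hasse_le {σ R : Type*} [Fintype σ] [CommRing R] (I : σ →₀ ℕ) (i : σ)
    (f : MvPolynomial σ R) : degreeOf i (hasse I f) ≤ degreeOf i f := by
  classical
  rw [degreeOf_le_iff]
  intro t ht
  rw [mem_support_iff, coeff_hasse] at ht
  have := monomial_le_degreeOf i (mem_support_iff.mpr (left_ne_zero_of_mul ht))
  simp only [Finsupp.coe_add, Pi.add_apply] at this
  omega

end MvPolynomial

theorem sum_max_sub_div_ge {k r : ℕ} (hr : 0 < r) (hk : k ≤ r + 1) {δ : ℝ} (hδ : 0 < δ)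
    (hδ1 : δ ≤ 1) (o : Fin k → ℕ) (ho : Function.Injective o) (hok : ∀ j, o j < k) :
    δ ^ 2 * k / 8 ≤ ∑ j, max 0 (δ - o j / r) := by
  have hrR : (0 : ℝ) < r := by exact_mod_cast hr
  have h1 : ∑ j, max 0 (δ - (o j : ℝ) / r) = ∑ j ∈ Finset.range k, max 0 (δ - (j : ℝ) / r) := by
    have hinj : Function.Bijective (fun j : Fin k => (⟨o j, hok j⟩ : Fin k)) := by
      rw [← Finite.injective_iff_bijective]
      intro a b hab
      exact ho (by simpa using hab)
    rw [← Fin.sum_univ_eq_sum_range (fun j => max 0 (δ - (j : ℝ) / r)) k]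
    exact hinj.sum_comp (fun j : Fin k => max 0 (δ - ((j : ℕ) : ℝ) / r))
  rw [h1]
  rcases Nat.eq_zero_or_pos k with rfl | hkpos
  · simp
  set J := min k (⌊δ * r / 2⌋₊ + 1) with hJ
  have hJk : J ≤ k := min_le_left _ _
  have h2 : ∑ j ∈ Finset.range J, δ / 2 ≤ ∑ j ∈ Finset.range k, max 0 (δ - (j : ℝ) / r) := by
    refine (Finset.sum_le_sum fun j hj => ?_).trans
      (Finset.sum_le_sum_of_subset_of_nonneg (Finset.range_mono hJk) fun j _ _ => le_max_left _ _)
    refine le_trans ?_ (le_max_right _ _)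
    have hj' : j ≤ ⌊δ * r / 2⌋₊ := by
      have := Finset.mem_range.mp hj
      have := min_le_right k (⌊δ * r / 2⌋₊ + 1)
      omega
    have : (j : ℝ) ≤ δ * r / 2 := (Nat.cast_le.mpr hj').trans (Nat.floor_le (by positivity))
    have h3 : (j : ℝ) / r ≤ δ / 2 := by
      rw [div_le_iff₀ hrR]; linarith
    linarith
  refine le_trans ?_ h2
  rw [Finset.sum_const, Finset.card_range, nsmul_eq_mul]
  have hJge : δ * k / 4 ≤ J := by
    rw [hJ, Nat.cast_min, le_min_iff]
    have hk0 : (0 : ℝ) ≤ k := Nat.cast_nonneg k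
    refine ⟨by nlinarith, ?_⟩
    have hfl := Nat.lt_floor_add_one (δ * r / 2)
    have hk' : (k : ℝ) ≤ r + 1 := by exact_mod_cast hk
    push_cast
    have hr1 : (1 : ℝ) ≤ r := by exact_mod_cast hr
    have : δ * k / 4 ≤ δ * r / 2 := by nlinarith
    linarith
  nlinarith

open MvPolynomial in
/-- Roth's lemma. -/
theorem roth_lemma (n : ℕ) : ∀ ε : ℝ, 0 < ε → ∃ ω : ℝ, 0 < ω ∧
    ∀ (r : Fin n → ℕ) (p q : Fin n → ℤ) (B : ℝ) (P : MvPolynomial (Fin n) ℤ),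
      (∀ h, 0 < r h) → (∀ h, 0 < q h) → (∀ h, IsCoprime (p h) (q h)) → 0 < B → P ≠ 0 →
      (∀ h, P.degreeOf h ≤ r h) → (∀ h h', h < h' → (r h : ℝ) ≤ ω * r h') →
      (∀ h, (r h : ℝ) ≤ ω * B) → len P ≤ Real.exp (ω * B) →
      (∀ h, B ≤ r h * Real.log (q h)) →
      ∃ i : Fin n →₀ ℕ, ∑ h, (i h : ℝ) / r h ≤ ε ∧
        coeff i (MvPolynomial.translate (fun h => (p h : ℚ) / q h) (map (Int.castRingHom ℚ) P)) ≠ 0 := by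
  induction n with
  | zero =>
    intro ε hε
    refine ⟨1, one_pos, fun r p q B P _ _ _ _ hP _ _ _ _ _ => ⟨0, by simpa using hε.le, ?_⟩⟩
    obtain ⟨c, rfl⟩ := C_surjective (R := ℤ) (Fin 0) P
    have : c ≠ 0 := by rintro rfl; simp at hP
    rw [map_C, algHom_C, algebraMap_eq, coeff_zero_C]
    rw [eq_intCast]
    exact_mod_cast this
  | succ n ih =>
    intro ε₀ hε₀
    obtain ⟨ε, hε, hε1, hεε⟩ : ∃ ε : ℝ, 0 < ε ∧ ε ≤ 1 ∧ ε ≤ ε₀ :=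
      ⟨min ε₀ 1, by positivity, min_le_right _ _, min_le_left _ _⟩
    set δ := ε / 2 with hδ
    have hδ0 : 0 < δ := by positivity
    obtain ⟨ω', hω', IH⟩ := ih (δ ^ 2 / 32) (by positivity)
    set ω := min δ (min (ω' / (n + 4)) (δ ^ 2 / (32 * (n + 4)))) with hω
    have hω0 : 0 < ω := by positivity
    have hωδ : ω ≤ δ := min_le_left _ _
    have hωω' : ω * (n + 4) ≤ ω' := by
      rw [← le_div_iff₀ (by positivity)]
      exact (min_le_right _ _).trans (min_le_left _ _)
    have hωδ2 : ω * (n + 4) ≤ δ ^ 2 / 32 := by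
      rw [← le_div_iff₀ (by positivity), div_div]
      exact (min_le_right _ _).trans (min_le_right _ _)
    have hωω'1 : ω ≤ ω' := by nlinarith [Nat.cast_nonneg (α := ℝ) n]
    refine ⟨ω, hω0, fun r p q B P hr hq hpq hB hP hdeg hrr hrB hlen hBr => ?_⟩
    by_contra! hcon
    set ζ : Fin (n + 1) → ℚ := fun h => (p h : ℚ) / q h with hζ
    set P' := map (Int.castRingHom ℚ) P with hP'
    have hP'0 : P' ≠ 0 := by
      rw [hP', Ne, map_eq_zero_iff _ (map_injective _ Int.cast_injective)]
      exact hP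
    have hdeg' : ∀ h, P'.degreeOf h ≤ r h := fun h =>
      (degreeOf_le_iff.mpr fun t ht =>
        monomial_le_degreeOf h (support_map_subset _ _ ht)).trans (hdeg h)
    obtain ⟨k, hk, hkr, φ, ψ, hφ, hψ, hsum⟩ := exists_eq_sum_headTail P' hP'0
    replace hkr : k ≤ r 0 + 1 := hkr.trans (Nat.succ_le_succ (hdeg' 0))
    obtain ⟨o, hoinj, hok, hV0⟩ := Polynomial.exists_wronskian_ne_zero ψ hψ
    obtain ⟨Δ, hΔk, hU0⟩ := MvPolynomial.exists_wronskian_ne_zero φ hφ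
    set V := (Matrix.of fun i j => Polynomial.hasseDeriv (o i) (ψ j)).det with hV
    set U := (Matrix.of fun i j => hasse (Δ i) (φ j)).det with hU
    set W : MvPolynomial (Fin (n + 1)) ℤ :=
      (Matrix.of fun i j => hasse (Finsupp.cons (o j) (Δ i)) P).det with hW
    have hWmap : map (Int.castRingHom ℚ) W = headTail V U := by
      rw [hV, hU, ← det_hasse_sum_headTail, ← hsum, hW, RingHom.map_det]
      congr 1
      ext1 i j
      simp only [RingHom.mapMatrix_apply, Matrix.map_apply, Matrix.of_apply, map_hasse, hP']
    have hWc : ∀ e s, ((coeff (Finsupp.cons e s) W : ℤ) : ℚ) = V.coeff e * coeff s U := by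
      intro e s
      rw [← coeff_headTail, ← hWmap, coeff_map]
      simp
    -- size of `W`
    have hk0 : (0 : ℝ) < k := by exact_mod_cast hk
    have hlenW : len W ≤ Real.exp (k * (ω * B * (n + 4))) := by
      have h1 : ∀ i j, len ((Matrix.of fun i j => hasse (Finsupp.cons (o j) (Δ i)) P) i j)
          ≤ Real.exp (ω * B * (n + 3)) := by
        intro i j
        rw [Matrix.of_apply]
        refine (len_hasse_le _ _ r hdeg).trans ?_
        have h2 : (2 : ℝ) ^ (∑ h, r h) ≤ Real.exp (ω * B * (n + 1)) := by
          have : ((∑ h, r h : ℕ) : ℝ) ≤ ω * B * (n + 1) := by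
            push_cast
            refine (Finset.sum_le_sum fun h _ => hrB h).trans_eq ?_
            simp
            ring
          refine le_trans ?_ (Real.exp_le_exp.mpr this)
          rw [← mul_one ((∑ h, r h : ℕ) : ℝ), Real.exp_nat_mul]
          refine pow_le_pow_left₀ (by norm_num) ?_ _
          have := Real.add_one_le_exp (1 : ℝ)
          linarith
        calc (2 : ℝ) ^ (∑ h, r h) * len P ≤ Real.exp (ω * B * (n + 1)) * Real.exp (ω * B) :=
              mul_le_mul h2 hlen (len_nonneg _) (Real.exp_pos _).le
          _ = Real.exp (ω * B * (n + 2)) := by rw [← Real.exp_add]; ring_nf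
          _ ≤ _ := Real.exp_le_exp.mpr (by nlinarith [mul_pos hω0 hB])
      refine (len_det_le _ _ h1).trans ?_
      have h3 : (k.factorial : ℝ) ≤ Real.exp (k * (ω * B)) := by
        have : (k.factorial : ℝ) ≤ (k : ℝ) ^ k := by exact_mod_cast Nat.factorial_le_pow k
        refine this.trans ?_
        rw [Real.exp_nat_mul]
        refine pow_le_pow_left₀ hk0.le ?_ _
        have h4 : (k : ℝ) ≤ r 0 + 1 := by exact_mod_cast hkr
        exact h4.trans ((Real.add_one_le_exp _).trans (Real.exp_le_exp.mpr (hrB 0)))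
      calc (k.factorial : ℝ) * Real.exp (ω * B * (n + 3)) ^ k
          ≤ Real.exp (k * (ω * B)) * Real.exp (k * (ω * B * (n + 3))) := by
            rw [Real.exp_nat_mul (ω * B * (n + 3)) k]
            exact mul_le_mul_of_nonneg_right h3 (by positivity)
        _ = _ := by rw [← Real.exp_add]; ring_nf
    have hWabs : ∀ t, |((coeff t W : ℤ) : ℝ)| ≤ Real.exp (k * (ω * B * (n + 4))) := by
      intro t
      rw [← Int.norm_eq_abs]
      exact (norm_coeff_le_len t W).trans hlenW
    -- the head factor
    obtain ⟨s₀, hs₀⟩ := ne_zero_iff.mp hU0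
    obtain ⟨e₀, he₀⟩ : ∃ e, V.coeff e ≠ 0 := ⟨_, Polynomial.leadingCoeff_ne_zero.mpr hV0⟩
    obtain ⟨l, hl, hlr⟩ : ∃ l, (Polynomial.taylor (ζ 0) V).coeff l ≠ 0 ∧
        (l : ℝ) / r 0 ≤ k * (δ ^ 2 / 32) := by
      set F : Polynomial ℤ := ∑ e ∈ Finset.range (V.natDegree + 1),
        Polynomial.monomial e (coeff (Finsupp.cons e s₀) W) with hF
      have hFc : ∀ e, F.coeff e = coeff (Finsupp.cons e s₀) W := by
        intro e
        simp only [hF, Polynomial.finsetSum_coeff, Polynomial.coeff_monomial, Finset.sum_ite_eq',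
          Finset.mem_range]
        split_ifs with h
        · rfl
        · have := hWc e s₀
          rw [Polynomial.coeff_eq_zero_of_natDegree_lt (by omega), zero_mul] at this
          exact_mod_cast this.symm
      have hFmap : F.map (Int.castRingHom ℚ) = coeff s₀ U • V := by
        ext e
        rw [Polynomial.coeff_map, hFc, eq_intCast, hWc, Polynomial.coeff_smul, smul_eq_mul, mul_comm]
      have hF0 : F ≠ 0 := by
        rw [← Polynomial.map_ne_zero_iff (f := Int.castRingHom ℚ) Int.cast_injective, hFmap]
        exact smul_ne_zero hs₀ hV0
      obtain ⟨l, hl, hle⟩ := F.exists_coeff_taylor_ne_zero_and_pow_le hF0 (p 0) (q 0) (hq 0) (hpq 0)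
      refine ⟨l, ?_, ?_⟩
      · rw [hFmap, map_smul, Polynomial.coeff_smul, smul_eq_mul] at hl
        exact right_ne_zero_of_mul hl
      · rw [Polynomial.leadingCoeff, hFc] at hle
        have h1 := hle.trans (hWabs _)
        have hq0 : (0 : ℝ) < q 0 := by exact_mod_cast hq 0
        rw [← Real.log_le_iff_le_exp (by positivity), Real.log_pow] at h1
        have hr0 : (0 : ℝ) < r 0 := by exact_mod_cast hr 0
        rw [div_le_iff₀ hr0]
        have h2 : (l : ℝ) * B ≤ (k * (δ ^ 2 / 32) * r 0) * B := by
          calc (l : ℝ) * B ≤ l * (r 0 * Real.log (q 0)) := by gcongr; exact hBr 0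
            _ = (l * Real.log (q 0)) * r 0 := by ring
            _ ≤ (k * (ω * B * (n + 4))) * r 0 := by gcongr
            _ = (k * (ω * (n + 4)) * r 0) * B := by ring
            _ ≤ _ := by gcongr
        exact le_of_mul_le_mul_right h2 hB
    -- the tail factor
    obtain ⟨s, hs, hsr⟩ : ∃ s, coeff s (MvPolynomial.translate (fun i => ζ i.succ) U) ≠ 0 ∧
        ∑ h, (s h : ℝ) / r h.succ ≤ k * (δ ^ 2 / 32) := by
      set G : MvPolynomial (Fin n) ℤ := (finSuccEquiv ℤ n W).coeff e₀ with hG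
      have hGc : ∀ s, coeff s G = coeff (Finsupp.cons e₀ s) W := fun s =>
        finSuccEquiv_coeff_coeff _ _ _
      have hGmap : map (Int.castRingHom ℚ) G = V.coeff e₀ • U := by
        ext s
        rw [coeff_map, hGc, eq_intCast, hWc, coeff_smul, smul_eq_mul]
      have hG0 : G ≠ 0 := by
        intro h
        rw [h, map_zero] at hGmap
        exact smul_ne_zero he₀ hU0 hGmap.symm
      have hGlen : len G ≤ len W := by
        have hinj : Function.Injective (fun s : Fin n →₀ ℕ => (Finsupp.cons e₀ s : Fin (n + 1) →₀ ℕ)) :=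
          Finsupp.cons_right_injective e₀
        rw [len]
        simp_rw [hGc]
        rw [← Finset.sum_image (g := fun s : Fin n →₀ ℕ => (Finsupp.cons e₀ s : Fin (n + 1) →₀ ℕ))
          (f := fun t => ‖coeff t W‖) (fun a _ b _ h => hinj h)]
        refine Finset.sum_le_sum_of_subset_of_nonneg ?_ fun _ _ _ => norm_nonneg _
        intro t ht
        obtain ⟨s, hs, rfl⟩ := Finset.mem_image.mp ht
        rw [mem_support_iff] at hs ⊢
        rwa [← hGc]
      obtain ⟨s, hs1, hs2⟩ := IH (fun h => k * r h.succ) (fun h => p h.succ) (fun h => q h.succ)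
        (k * B) G (fun h => Nat.mul_pos hk (hr _)) (fun h => hq _) (fun h => hpq _) (by positivity) hG0
        (fun h => (degreeOf_coeff_finSuccEquiv W h e₀).trans
          (degreeOf_det_le _ _ _ fun a b => (degreeOf_hasse_le _ _ _).trans (hdeg _)))
        (fun h h' hh => by
          have := hrr h.succ h'.succ (Fin.succ_lt_succ_iff.mpr hh)
          push_cast
          have h2 : ω * (r h'.succ : ℝ) ≤ ω' * r h'.succ := by gcongr
          nlinarith)
        (fun h => by
          have := hrB h.succ
          push_cast
          have h2 : ω * B ≤ ω' * B := by gcongr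
          nlinarith)
        (hGlen.trans (hlenW.trans (Real.exp_le_exp.mpr (by
          have : k * B * (ω * (n + 4)) ≤ k * B * ω' := by gcongr
          linarith))))
        (fun h => by
          have := hBr h.succ
          push_cast
          nlinarith)
      refine ⟨s, ?_, ?_⟩
      · rw [hGmap, map_smul, coeff_smul, smul_eq_mul] at hs2
        exact right_ne_zero_of_mul hs2
      · push_cast at hs1
        have : ∑ h, (s h : ℝ) / r h.succ = k * ∑ h, (s h : ℝ) / (k * r h.succ) := by
          rw [Finset.mul_sum]
          refine Finset.sum_congr rfl fun h _ => ?_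
          have : (0 : ℝ) < r h.succ := by exact_mod_cast hr _
          field_simp
        rw [this]
        gcongr
    -- lower bound for the weight
    have hwt : WeightGE (fun h => 1 / (r h : ℝ)) (∑ j, max 0 (δ - (o j : ℝ) / r 0))
        (MvPolynomial.translate ζ (map (Int.castRingHom ℚ) W)) := by
      have : translate ζ (map (Int.castRingHom ℚ) W)
          = (Matrix.of fun i j => hasse (Finsupp.cons (o j) (Δ i)) (MvPolynomial.translate ζ P')).det := by
        rw [hW, RingHom.map_det, AlgHom.map_det]
        congr 1
        ext1 i j
        simp only [RingHom.mapMatrix_apply, AlgHom.mapMatrix_apply, Matrix.map_apply,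
          Matrix.of_apply, map_hasse, hP', translate_hasse]
      rw [this]
      refine WeightGE.det fun i j t ht => ?_
      rw [Matrix.of_apply, coeff_hasse] at ht
      have h1 := mt (hcon (t + Finsupp.cons (o j) (Δ i))) (left_ne_zero_of_mul ht)
      rw [not_le] at h1
      refine max_le (Finset.sum_nonneg fun h _ => by positivity) ?_
      have h2 : ∑ h, (((t + Finsupp.cons (o j) (Δ i)) h : ℕ) : ℝ) / r h
          = ∑ h, 1 / (r h : ℝ) * t h + ((o j : ℝ) / r 0 + ∑ h, (Δ i h : ℝ) / r h.succ) := by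
        have h2' := Fin.sum_univ_succ
          (fun h : Fin (n + 1) => ((Finsupp.cons (o j) (Δ i) : Fin (n + 1) →₀ ℕ) h : ℝ) / r h)
        simp only [Finsupp.cons_zero, Finsupp.cons_succ] at h2'
        rw [← h2', ← Finset.sum_add_distrib]
        refine Finset.sum_congr rfl fun h _ => ?_
        simp only [Finsupp.coe_add, Pi.add_apply]
        push_cast
        ring
      have h3 : ∑ h, (Δ i h : ℝ) / r h.succ ≤ ω := by
        have hr0 : (0 : ℝ) < r 0 := by exact_mod_cast hr 0
        have h4 : ∀ h : Fin n, (Δ i h : ℝ) / r h.succ ≤ Δ i h * (ω / r 0) := by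
          intro h
          have h5 := hrr 0 h.succ (Fin.succ_pos h)
          have h6 : (0 : ℝ) < r h.succ := by exact_mod_cast hr _
          rw [div_eq_mul_inv]
          gcongr
          rw [inv_le_iff_one_le_mul₀ h6, div_mul_eq_mul_div, le_div_iff₀ hr0, one_mul]
          exact h5
        refine (Finset.sum_le_sum fun h _ => h4 h).trans ?_
        rw [← Finset.sum_mul]
        have h7 : ∑ h, (Δ i h : ℝ) ≤ r 0 := by
          have := hΔk i
          exact_mod_cast (by omega : ∑ h, Δ i h ≤ r 0)
        calc (∑ h, (Δ i h : ℝ)) * (ω / r 0) ≤ r 0 * (ω / r 0) := by gcongr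
          _ = ω := by field_simp
      rw [h2] at h1
      linarith
    have hfin := hwt (Finsupp.cons l s) (by
      rw [hWmap, translate_headTail, coeff_headTail]
      exact mul_ne_zero hl hs)
    have hlow := sum_max_sub_div_ge (hr 0) hkr hδ0 (by linarith) o hoinj hok
    rw [Fin.sum_univ_succ] at hfin
    simp only [Finsupp.cons_zero, Finsupp.cons_succ] at hfin
    simp_rw [one_div_mul_eq_div] at hfin
    nlinarith [mul_pos hk0 (pow_pos hδ0 2)]

theorem exists_pow_eq_sum_range (α : ℝ) (hα : IsAlgebraic ℚ α) :
    ∃ (d D : ℕ) (C : ℝ), 0 < d ∧ 0 < D ∧ 1 ≤ C ∧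
      (∀ z : ℕ → ℤ, ∑ i ∈ Finset.range d, (z i : ℝ) * α ^ i = 0 → ∀ i < d, z i = 0) ∧
      ∀ n, ∃ c : ℕ → ℤ, (D : ℝ) ^ n * α ^ n = ∑ i ∈ Finset.range d, (c i : ℝ) * α ^ i ∧
        ∀ i, |(c i : ℝ)| ≤ C ^ n := by
  classical
  have hex : ∃ d, ∃ f : ℕ → ℤ, f d ≠ 0 ∧ ∑ i ∈ Finset.range (d + 1), (f i : ℝ) * α ^ i = 0 := by
    obtain ⟨P, hP, hPα⟩ := (IsFractionRing.isAlgebraic_iff ℤ ℚ ℝ).mpr hα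
    refine ⟨P.natDegree, P.coeff, Polynomial.leadingCoeff_ne_zero.mpr hP, ?_⟩
    rw [Polynomial.aeval_eq_sum_range] at hPα
    simpa [zsmul_eq_mul] using hPα
  obtain ⟨f, hfd, hf⟩ := Nat.find_spec hex
  set d := Nat.find hex with hd
  have hindep : ∀ z : ℕ → ℤ, ∑ i ∈ Finset.range d, (z i : ℝ) * α ^ i = 0 → ∀ i < d, z i = 0 := by
    intro z hz
    by_contra! hcon
    let e := Nat.findGreatest (fun i => z i ≠ 0) (d - 1)
    obtain ⟨i, hi, hzi⟩ := hcon
    have he : z e ≠ 0 := Nat.findGreatest_spec (P := fun i => z i ≠ 0) (by omega : i ≤ d - 1) hzi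
    have hed : e < d := by
      have : e ≤ d - 1 := Nat.findGreatest_le _
      omega
    refine Nat.find_min hex hed ⟨z, he, ?_⟩
    rw [← hz]
    refine Finset.sum_subset (Finset.range_mono (by omega)) fun j hj hj' => ?_
    have h1 : e < j := by simpa using hj'
    have h2 : j < d := by simpa using hj
    have : z j = 0 := by
      by_contra h
      exact Nat.findGreatest_is_greatest (P := fun i => z i ≠ 0) h1 (by omega) h
    simp [this]
  have hd0 : 0 < d := by
    by_contra h
    have h0 : d = 0 := by omega
    rw [h0] at hf hfd
    simp only [zero_add, Finset.range_one, Finset.sum_singleton, pow_zero, mul_one] at hf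
    exact hfd (by exact_mod_cast hf)
  obtain ⟨g, hgd, hg⟩ : ∃ g : ℕ → ℤ, 0 < g d ∧
      ∑ i ∈ Finset.range (d + 1), (g i : ℝ) * α ^ i = 0 := by
    rcases lt_or_gt_of_ne hfd with h | h
    · refine ⟨fun i => -f i, neg_pos.mpr h, ?_⟩
      rw [← neg_eq_zero, ← hf, ← Finset.sum_neg_distrib]
      exact Finset.sum_congr rfl fun i _ => by push_cast; ring
    · exact ⟨f, h, hf⟩
  obtain ⟨D, hD⟩ := Int.eq_ofNat_of_zero_le hgd.le
  have hD0 : 0 < D := by omega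
  set H : ℝ := ∑ i ∈ Finset.range d, |(g i : ℝ)| with hH
  have hH0 : 0 ≤ H := Finset.sum_nonneg fun _ _ => abs_nonneg _
  have hDR : (1 : ℝ) ≤ D := by exact_mod_cast hD0
  refine ⟨d, D, D + H, hd0, hD0, by linarith, hindep, fun n => ?_⟩
  induction n with
  | zero =>
    refine ⟨fun i => if i = 0 then 1 else 0, ?_, fun i => ?_⟩
    · rw [Finset.sum_eq_single_of_mem 0 (Finset.mem_range.mpr hd0)]
      · simp
      · intro i _ hi; simp [hi]
    · dsimp only
      split_ifs <;> simp
  | succ n ih =>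
    obtain ⟨c, hc, hcC⟩ := ih
    refine ⟨fun i => if i < d then D * (if i = 0 then 0 else c (i - 1)) - c (d - 1) * g i else 0,
      ?_, fun i => ?_⟩
    · obtain ⟨d', hd'⟩ : ∃ d', d = d' + 1 := ⟨d - 1, by omega⟩
      have e1 : (D : ℝ) ^ (n + 1) * α ^ (n + 1) = D * α * ∑ i ∈ Finset.range d, (c i : ℝ) * α ^ i := by
        rw [← hc]; ring
      have e2 : ∑ i ∈ Finset.range d, ((if i < d then D * (if i = 0 then 0 else c (i - 1)) - c (d - 1) * g i else 0 : ℤ) : ℝ) * α ^ i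
          = D * ∑ i ∈ Finset.range d, ((if i = 0 then 0 else c (i - 1) : ℤ) : ℝ) * α ^ i
            - c (d - 1) * ∑ i ∈ Finset.range d, (g i : ℝ) * α ^ i := by
        rw [Finset.mul_sum, Finset.mul_sum, ← Finset.sum_sub_distrib]
        refine Finset.sum_congr rfl fun i hi => ?_
        rw [if_pos (Finset.mem_range.mp hi)]
        push_cast
        ring
      rw [e1, e2]
      rw [Finset.sum_range_succ, hD] at hg
      have e3 : ∑ i ∈ Finset.range d, (g i : ℝ) * α ^ i = -(D * α ^ d) := by
        push_cast at hg
        linarith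
      rw [e3, hd', Finset.sum_range_succ, Finset.sum_range_succ']
      simp only [Nat.add_one_ne_zero, if_false, Nat.add_sub_cancel, if_true, Int.cast_zero, zero_mul,
        add_zero]
      rw [mul_add, Finset.mul_sum, Finset.mul_sum, mul_neg, sub_neg_eq_add]
      congr 1
      · exact Finset.sum_congr rfl fun i _ => by ring
      · ring
    · have hC0 : (0 : ℝ) ≤ (D + H) ^ n := by positivity
      dsimp only
      split_ifs with h1 h2
      · have hgi : |(g i : ℝ)| ≤ H := Finset.single_le_sum (f := fun i => |(g i : ℝ)|)
          (fun _ _ => abs_nonneg _) (Finset.mem_range.mpr h1)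
        push_cast
        rw [mul_zero, zero_sub, abs_neg, abs_mul]
        calc |(c (d - 1) : ℝ)| * |(g i : ℝ)| ≤ (D + H) ^ n * H := by
              gcongr; exact hcC _
          _ ≤ _ := by rw [pow_succ]; nlinarith
      · have hgi : |(g i : ℝ)| ≤ H := Finset.single_le_sum (f := fun i => |(g i : ℝ)|)
          (fun _ _ => abs_nonneg _) (Finset.mem_range.mpr h1)
        push_cast
        calc |(D : ℝ) * c (i - 1) - c (d - 1) * g i|
            ≤ |(D : ℝ) * c (i - 1)| + |(c (d - 1) : ℝ) * g i| := abs_sub _ _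
          _ = D * |(c (i - 1) : ℝ)| + |(c (d - 1) : ℝ)| * |(g i : ℝ)| := by
              rw [abs_mul, abs_mul, Nat.abs_cast]
          _ ≤ D * (D + H) ^ n + (D + H) ^ n * H := by
              gcongr <;> exact hcC _
          _ = _ := by rw [pow_succ]; ring
      · simp only [Int.cast_zero, abs_zero]; positivity

theorem exists_le_abs_quadratic_form_mul_pow (α : ℝ) (hα : IsAlgebraic ℚ α)
    (hnq : ∀ a b c : ℤ, (a : ℝ) + b * α + c * α ^ 2 = 0 → a = 0 ∧ b = 0 ∧ c = 0) :
    ∃ (d : ℕ) (κ : ℝ), 0 < κ ∧ ∀ (y : ℕ → ℤ) (Y : ℝ), (∃ k < 3, y k ≠ 0) → 1 ≤ Y →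
      (∀ k, |(y k : ℝ)| ≤ Y) → κ ≤ |∑ k ∈ Finset.range 3, (y k : ℝ) * α ^ k| * Y ^ d := by
  classical
  obtain ⟨d, D, C, hd, hD, hC, hind, hpow⟩ := exists_pow_eq_sum_range α hα
  choose c hc hcC using hpow
  have hDR : (1 : ℝ) ≤ D := by exact_mod_cast hD
  set K : ℝ := (D : ℝ) ^ (d + 1) * C ^ (d + 1) with hK
  have hK1 : 1 ≤ K := one_le_mul_of_one_le_of_one_le (one_le_pow₀ hDR) (one_le_pow₀ hC)
  set T : ℝ := ∑ j : Fin d, |α ^ (j : ℕ)| with hT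
  have hT1 : 1 ≤ T := by
    have : |α ^ ((⟨0, hd⟩ : Fin d) : ℕ)| ≤ T :=
      Finset.single_le_sum (f := fun j : Fin d => |α ^ (j : ℕ)|) (fun _ _ => abs_nonneg _)
        (Finset.mem_univ _)
    simpa using this
  set B : ℝ := (D : ℝ) ^ (d + 1) * (Nat.factorial d * (3 * K) ^ d) * T with hB
  have hB0 : 0 < B := by positivity
  refine ⟨d, B⁻¹, by positivity, fun y Y hy hY hyY => ?_⟩
  set g : ℝ := ∑ k ∈ Finset.range 3, (y k : ℝ) * α ^ k with hg
  have hg0 : g ≠ 0 := by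
    intro h0
    have h1 := hnq (y 0) (y 1) (y 2) (by rw [← h0, hg]; simp [Finset.sum_range_succ])
    obtain ⟨k, hk, hk0⟩ := hy
    interval_cases k <;> tauto
  let M : Matrix (Fin d) (Fin d) ℤ := fun i j =>
    ∑ k ∈ Finset.range 3, y k * (D : ℤ) ^ (d + 1 - (i + k)) * c (i + k) j
  have hMv : ∀ i : Fin d, ∑ j : Fin d, (M i j : ℝ) * α ^ (j : ℕ) =
      (D : ℝ) ^ (d + 1) * g * α ^ (i : ℕ) := by
    intro i
    have e1 : ∀ k ∈ Finset.range 3, ∑ j : Fin d, ((y k * (D : ℤ) ^ (d + 1 - (i + k)) * c (i + k) j : ℤ) : ℝ)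
        * α ^ (j : ℕ) = (D : ℝ) ^ (d + 1) * (y k * α ^ k) * α ^ (i : ℕ) := by
      intro k hk
      have hk3 : i + k ≤ d + 1 := by
        have := Finset.mem_range.mp hk
        have := i.2
        omega
      have e2 := hc (i + k)
      rw [← Fin.sum_univ_eq_sum_range (fun j => (c (i + k) j : ℝ) * α ^ j)] at e2
      have e3 : (D : ℝ) ^ (d + 1) = D ^ (d + 1 - (i + k)) * D ^ ((i : ℕ) + k) := by
        rw [← pow_add]; congr 1; omega
      calc _ = (y k * (D : ℝ) ^ (d + 1 - (i + k))) * ∑ j : Fin d, (c (i + k) j : ℝ) * α ^ (j : ℕ) := by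
            rw [Finset.mul_sum]
            exact Finset.sum_congr rfl fun j _ => by push_cast; ring
        _ = _ := by rw [← e2, e3]; ring
    calc _ = ∑ j : Fin d, ∑ k ∈ Finset.range 3,
          ((y k * (D : ℤ) ^ (d + 1 - (i + k)) * c (i + k) j : ℤ) : ℝ) * α ^ (j : ℕ) := by
          refine Finset.sum_congr rfl fun j _ => ?_
          rw [← Finset.sum_mul]
          simp only [M, Int.cast_sum]
      _ = _ := by
          rw [Finset.sum_comm, Finset.sum_congr rfl e1, hg, Finset.mul_sum, Finset.sum_mul]
  clear_value g
  have hMle : ∀ i j, |(M i j : ℝ)| ≤ 3 * K * Y := by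
    intro i j
    simp only [M, Int.cast_sum]
    refine (Finset.abs_sum_le_sum_abs _ _).trans ?_
    have : ∀ k ∈ Finset.range 3,
        |((y k * (D : ℤ) ^ (d + 1 - (i + k)) * c (i + k) j : ℤ) : ℝ)| ≤ K * Y := by
      intro k hk
      have hk3 : i + k ≤ d + 1 := by
        have := Finset.mem_range.mp hk
        have := i.2
        omega
      push_cast
      rw [abs_mul, abs_mul, abs_pow, Nat.abs_cast]
      calc |(y k : ℝ)| * (D : ℝ) ^ (d + 1 - (i + k)) * |(c (i + k) j : ℝ)|
          ≤ Y * (D : ℝ) ^ (d + 1) * C ^ (d + 1) := by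
            gcongr
            · exact hyY k
            · exact Nat.sub_le _ _
            · exact (hcC _ _).trans (pow_le_pow_right₀ hC hk3)
        _ = _ := by rw [hK]; ring
    refine (Finset.sum_le_sum this).trans (le_of_eq ?_)
    simp; ring
  have hdet : M.det ≠ 0 := by
    intro h0
    obtain ⟨w, hw, hwM⟩ := Matrix.exists_vecMul_eq_zero_iff.mpr h0
    have h1 : ∑ i : Fin d, (w i : ℝ) * α ^ (i : ℕ) = 0 := by
      have h2 : ∑ i : Fin d, (w i : ℝ) * ∑ j : Fin d, (M i j : ℝ) * α ^ (j : ℕ) = 0 := by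
        simp_rw [Finset.mul_sum]
        rw [Finset.sum_comm]
        refine Finset.sum_eq_zero fun j _ => ?_
        have h3 := congrFun hwM j
        simp only [Matrix.vecMul, dotProduct, Pi.zero_apply] at h3
        have h4 : ∑ i : Fin d, (w i : ℝ) * M i j = 0 := by exact_mod_cast h3
        simp_rw [← mul_assoc]
        rw [← Finset.sum_mul, h4, zero_mul]
      simp_rw [hMv] at h2
      have h5 : ((D : ℝ) ^ (d + 1) * g) * ∑ i : Fin d, (w i : ℝ) * α ^ (i : ℕ) = 0 := by
        rw [← h2, Finset.mul_sum]
        exact Finset.sum_congr rfl fun i _ => by ring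
      refine (mul_eq_zero.mp h5).resolve_left (mul_ne_zero (by positivity) hg0)
    apply hw
    have h6 := hind (fun i => if h : i < d then w ⟨i, h⟩ else 0) (by
      rw [← Fin.sum_univ_eq_sum_range
        (fun i => ((if h : i < d then w ⟨i, h⟩ else 0 : ℤ) : ℝ) * α ^ i), ← h1]
      exact Finset.sum_congr rfl fun i _ => by simp)
    funext i
    simpa using h6 i i.2
  have hadj : ∀ i j, |(M.adjugate i j : ℝ)| ≤ Nat.factorial d * (3 * K * Y) ^ d := by
    intro i j
    rw [Matrix.adjugate_apply]
    have h1 : ∀ k l, (IsAbsoluteValue.toAbsoluteValue (abs : ℝ → ℝ)).comp (f := Int.castRingHom ℝ)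
        (RingHom.injective_int _)
        ((M.updateRow j (Pi.single i 1)) k l) ≤ 3 * K * Y := by
      intro k l
      show |(((M.updateRow j (Pi.single i 1)) k l : ℤ) : ℝ)| ≤ _
      have h1 : (1 : ℝ) ≤ 3 * K * Y := by nlinarith
      rw [Matrix.updateRow_apply]
      split_ifs
      · rw [Pi.single_apply]
        split_ifs
        · simpa using h1
        · simpa using by linarith
      · exact hMle k l
    have h2 : |(((M.updateRow j (Pi.single i 1)).det : ℤ) : ℝ)| ≤ _ := Matrix.det_le h1
    simpa using h2
  have key : (M.det : ℝ) = (D : ℝ) ^ (d + 1) * g *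
      ∑ j : Fin d, (M.adjugate ⟨0, hd⟩ j : ℝ) * α ^ (j : ℕ) := by
    have h1 : ∀ j : Fin d, ∑ i, (M.adjugate ⟨0, hd⟩ i : ℝ) * M i j =
        if (⟨0, hd⟩ : Fin d) = j then (M.det : ℝ) else 0 := by
      intro j
      have h2 := congrFun (congrFun (Matrix.adjugate_mul M) ⟨0, hd⟩) j
      rw [Matrix.mul_apply, Matrix.smul_apply, Matrix.one_apply] at h2
      have h3 := congrArg (fun z : ℤ => (z : ℝ)) h2
      simpa using h3
    calc (M.det : ℝ) = ∑ j : Fin d, (if (⟨0, hd⟩ : Fin d) = j then (M.det : ℝ) else 0) * α ^ (j : ℕ) := by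
          simp
      _ = ∑ i : Fin d, (M.adjugate ⟨0, hd⟩ i : ℝ) * ∑ j : Fin d, (M i j : ℝ) * α ^ (j : ℕ) := by
          simp_rw [← h1, Finset.sum_mul, Finset.mul_sum]
          rw [Finset.sum_comm]
          exact Finset.sum_congr rfl fun i _ => Finset.sum_congr rfl fun j _ => by ring
      _ = _ := by
          simp_rw [hMv]
          rw [Finset.mul_sum]
          exact Finset.sum_congr rfl fun i _ => by ring
  have hdet1 : (1 : ℝ) ≤ |(M.det : ℝ)| := by
    have := Int.one_le_abs hdet
    exact_mod_cast this
  have hsum : |∑ j : Fin d, (M.adjugate ⟨0, hd⟩ j : ℝ) * α ^ (j : ℕ)| ≤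
      Nat.factorial d * (3 * K * Y) ^ d * T := by
    refine (Finset.abs_sum_le_sum_abs _ _).trans ?_
    rw [hT, Finset.mul_sum]
    refine Finset.sum_le_sum fun j _ => ?_
    rw [abs_mul]
    gcongr
    exact hadj _ _
  rw [key, abs_mul, abs_mul, abs_of_nonneg (by positivity : (0 : ℝ) ≤ (D : ℝ) ^ (d + 1))] at hdet1
  rw [inv_le_iff_one_le_mul₀ hB0]
  calc (1 : ℝ) ≤ _ := hdet1
    _ ≤ (D : ℝ) ^ (d + 1) * |g| * (Nat.factorial d * (3 * K * Y) ^ d * T) := by gcongr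
    _ = _ := by rw [hB, mul_pow (3 * K) Y]; ring

theorem exists_small_mem_congruence_lattice (q : ℤ) (hq : 0 < q) (x y : ℤ) (A B : ℕ)
    (hAB : q < (A + 1) * (B + 1)) :
    ∃ u v : ℤ, (u ≠ 0 ∨ v ≠ 0) ∧ |u| ≤ A ∧ |v| ≤ B ∧ q ∣ x * u + y * v := by
  have hcard : (Finset.Ico (0 : ℤ) q).card <
      (Finset.Icc (0 : ℤ) A ×ˢ Finset.Icc (0 : ℤ) B).card := by
    rw [Finset.card_product, Int.card_Ico, Int.card_Icc, Int.card_Icc]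
    zify
    rw [Int.toNat_of_nonneg (by omega), Int.toNat_of_nonneg (by omega),
      Int.toNat_of_nonneg (by omega)]
    simpa using hAB
  obtain ⟨s, hs, t, ht, hst, h⟩ := Finset.exists_ne_map_eq_of_card_lt_of_maps_to
    (f := fun s : ℤ × ℤ => (x * s.1 + y * s.2) % q) hcard (fun s _ => by
      simp only [Finset.coe_Ico, Set.mem_Ico]
      exact ⟨Int.emod_nonneg _ hq.ne', Int.emod_lt_of_pos _ hq⟩)
  simp only [Finset.mem_product, Finset.mem_Icc] at hs ht
  refine ⟨s.1 - t.1, s.2 - t.2, ?_, ?_, ?_, ?_⟩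
  · by_contra! hcon
    exact hst (Prod.ext (by omega) (by omega))
  · rw [abs_le]; omega
  · rw [abs_le]; omega
  · have := Int.ModEq.dvd (show x * t.1 + y * t.2 ≡ x * s.1 + y * s.2 [ZMOD q] from h.symm)
    convert this using 1
    ring

theorem exists_independent_pair_congruence_lattice (q : ℤ) (hq : 0 < q) (x y : ℤ) :
    ∃ (E : ℕ) (u v u' v' : ℤ), 0 < E ∧ (E : ℤ) * E ≤ q ∧ q ∣ x * u + y * v ∧
      q ∣ x * u' + y * v' ∧ u * v' - v * u' ≠ 0 ∧ |u| ≤ E ∧ |v| ≤ E ∧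
      ((|u'| ≤ E ∧ |v'| * E ≤ q) ∨ (|u'| * E ≤ q ∧ |v'| ≤ E)) := by
  classical
  have hex : ∃ E : ℕ, ∃ u v : ℤ, (u ≠ 0 ∨ v ≠ 0) ∧ |u| ≤ E ∧ |v| ≤ E ∧ q ∣ x * u + y * v := by
    refine ⟨q.toNat, exists_small_mem_congruence_lattice q hq x y _ _ ?_⟩
    rw [Int.toNat_of_nonneg hq.le]
    nlinarith
  have hmin := fun {E} => Nat.find_min hex (m := E)
  obtain ⟨u, v, huv, hu, hv, hd⟩ := Nat.find_spec hex
  have hle : Nat.find hex ≤ Nat.sqrt q.toNat :=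
    Nat.find_min' hex (exists_small_mem_congruence_lattice q hq x y _ _ (by
      have := Nat.lt_succ_sqrt q.toNat
      zify at this
      rw [Int.toNat_of_nonneg hq.le] at this
      simpa using this))
  set E := Nat.find hex with hE
  have hE0 : 0 < E := by
    rcases Nat.eq_zero_or_pos E with h | h
    · rw [h] at hu hv
      simp only [Nat.cast_zero, abs_nonpos_iff] at hu hv
      simp [hu, hv] at huv
    · exact h
  have hEq : (E : ℤ) * E ≤ q := by
    have h1 : E * E ≤ q.toNat := (Nat.mul_le_mul hle hle).trans (Nat.sqrt_le _)
    zify at h1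
    rwa [Int.toNat_of_nonneg hq.le] at h1
  have hcases : |u| = E ∨ |v| = E := by
    by_contra! hcon
    have h1 : |u| < E := lt_of_le_of_ne hu hcon.1
    have h2 : |v| < E := lt_of_le_of_ne hv hcon.2
    exact hmin (E := E - 1) (by omega) ⟨u, v, huv, by omega, by omega, hd⟩
  have hEz : (0 : ℤ) < E := by exact_mod_cast hE0
  set t := (q / E).toNat with ht
  have htq : (t : ℤ) = q / E := Int.toNat_of_nonneg (Int.ediv_nonneg hq.le hEz.le)
  have htE : (t : ℤ) * E ≤ q := htq ▸ Int.ediv_mul_le _ hEz.ne'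
  have htE' : q < E * (t + 1) := by
    rw [htq]
    have := Int.lt_ediv_add_one_mul_self q hEz
    linarith
  have hpred : ((E - 1 : ℕ) : ℤ) = E - 1 := by push_cast [hE0]; ring
  have hind : ∀ u v u' v' : ℤ, |u| = E → |v| ≤ E → |u'| ≤ E - 1 → u * v' = v * u' →
      |v'| ≤ E - 1 := by
    intro u v u' v' h1 h2 h3 h4
    have h5 : (E : ℤ) * |v'| = |v| * |u'| := by rw [← h1, ← abs_mul, h4, abs_mul]
    by_contra! h6
    have h7 : |v| * |u'| ≤ E * (E - 1) := mul_le_mul h2 h3 (abs_nonneg _) hEz.le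
    have : (E : ℤ) * (E - 1) < E * |v'| := mul_lt_mul_of_pos_left h6 hEz
    omega
  rcases hcases with h | h
  · obtain ⟨u', v', huv', hu', hv', hd'⟩ := exists_small_mem_congruence_lattice q hq x y (E - 1) t
      (by rw [hpred]; linarith)
    rw [hpred] at hu'
    refine ⟨E, u, v, u', v', hE0, hEq, hd, hd', fun h0 => ?_, hu, hv, Or.inl ⟨by omega, ?_⟩⟩
    · exact hmin (E := E - 1) (by omega) ⟨u', v', huv', by omega,
        by rw [hpred]; exact hind u v u' v' h hv hu' (by linarith), hd'⟩
    · nlinarith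
  · obtain ⟨u', v', huv', hu', hv', hd'⟩ := exists_small_mem_congruence_lattice q hq x y t (E - 1)
      (by rw [hpred]; linarith)
    rw [hpred] at hv'
    refine ⟨E, u, v, u', v', hE0, hEq, hd, hd', fun h0 => ?_, hu, hv, Or.inr ⟨?_, by omega⟩⟩
    · exact hmin (E := E - 1) (by omega) ⟨u', v', huv',
        by rw [hpred]; exact hind v u v' u' h hu hv' (by linarith), by omega, hd'⟩
    · nlinarith

noncomputable def twistedCoord (α : ℝ) (e : Fin 3 → ℤ) : Fin 3 → ℝ :=
  ![e 0 + e 1 * α + e 2 * α ^ 2, e 1, e 2]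

set_option maxHeartbeats 1000000 in
theorem exists_dual_pair_with_weights (α : ℝ) (hα : IsAlgebraic ℚ α)
    (hnq : ∀ a b c : ℤ, (a : ℝ) + b * α + c * α ^ 2 = 0 → a = 0 ∧ b = 0 ∧ c = 0)
    (C : ℝ) (hC : 1 ≤ C) :
    ∃ a : ℝ, 0 < a ∧ a ≤ 1 ∧ ∃ Q : ℝ, ∀ x₀ x₁ x₂ : ℤ, 0 < x₀ → Q ≤ Real.log x₀ →
      |x₀ * α - x₁| ≤ C / x₀ → |x₀ * α ^ 2 - x₂| ≤ C / x₀ →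
      ∃ (e e' : Fin 3 → ℤ) (w : Fin 3 → ℝ),
        x₀ * e 0 + x₁ * e 1 + x₂ * e 2 = 0 ∧ x₀ * e' 0 + x₁ * e' 1 + x₂ * e' 2 = 0 ∧
        e 1 * e' 2 - e 2 * e' 1 ≠ 0 ∧
        (∀ i, |twistedCoord α e i| ≤ Real.exp (w i * Real.log x₀)) ∧
        (∀ i, |twistedCoord α e' i| ≤ Real.exp (w i * Real.log x₀)) ∧
        (∀ i, |w i| ≤ 3) ∧ ∑ i, w i ≤ -a := by
  obtain ⟨d, κ, hκ, hL⟩ := exists_le_abs_quadratic_form_mul_pow α hα hnq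
  set C' : ℝ := 2 * C + |α| + α ^ 2 with hC'
  have hC'1 : 1 ≤ C' := by have := abs_nonneg α; nlinarith [sq_nonneg α]
  set B : ℝ := 2 * C * C' ^ d / κ with hB
  have hB0 : 0 < B := by positivity
  have hd1 : (0 : ℝ) < d + 1 := by positivity
  have hC2 : 0 < Real.log (2 * C) := Real.log_pos (by linarith)
  refine ⟨1 / (d + 1), by positivity, by
    rw [div_le_one hd1]; linarith [(Nat.cast_nonneg d : (0 : ℝ) ≤ d)],
    |Real.log B| + (d + 1) * Real.log (2 * C) , fun x₀ x₁ x₂ hx0 hQ h1 h2 => ?_⟩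
  have hxR : (0 : ℝ) < x₀ := by exact_mod_cast hx0
  have hxR1 : (1 : ℝ) ≤ x₀ := by exact_mod_cast hx0
  set ℓ := Real.log x₀ with hℓ
  have hℓC : Real.log (2 * C) ≤ ℓ := by
    have := abs_nonneg (Real.log B)
    have := mul_nonneg (Nat.cast_nonneg d : (0 : ℝ) ≤ d) hC2.le
    linarith
  have hℓ0 : 0 < ℓ := hC2.trans_le hℓC
  obtain ⟨E, u, v, u', v', hE, hEq, ⟨z, hz⟩, ⟨z', hz'⟩, hdet, hu, hv, huv'⟩ :=
    exists_independent_pair_congruence_lattice x₀ hx0 x₁ x₂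
  have hER : (1 : ℝ) ≤ E := by exact_mod_cast hE
  have hE0 : (0 : ℝ) < E := by linarith
  have hEqR : (E : ℝ) * E ≤ x₀ := by exact_mod_cast hEq
  have hEE : (E : ℝ) ≤ x₀ / E := by rw [le_div_iff₀ hE0]; exact hEqR
  have huR : |(u : ℝ)| ≤ E := by exact_mod_cast hu
  have hvR : |(v : ℝ)| ≤ E := by exact_mod_cast hv
  obtain ⟨W₁, W₂, hW1, hW2, hW, hsum, g1, g2, g3, g4⟩ : ∃ W₁ W₂ : ℝ, 1 ≤ W₁ ∧ 1 ≤ W₂ ∧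
      W₁ * W₂ = x₀ ∧ W₁ + W₂ ≤ 2 * (x₀ / E) ∧ |(u : ℝ)| ≤ W₁ ∧ |(v : ℝ)| ≤ W₂ ∧
      |(u' : ℝ)| ≤ W₁ ∧ |(v' : ℝ)| ≤ W₂ := by
    rcases huv' with ⟨k1, k2⟩ | ⟨k1, k2⟩
    · refine ⟨E, x₀ / E, hER, hER.trans hEE, by field_simp, by linarith, huR, hvR.trans hEE,
        by exact_mod_cast k1, ?_⟩
      rw [le_div_iff₀ hE0]
      exact_mod_cast k2
    · refine ⟨x₀ / E, E, hER.trans hEE, hER, by field_simp, by linarith, huR.trans hEE, hvR,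
        ?_, by exact_mod_cast k2⟩
      rw [le_div_iff₀ hE0]
      exact_mod_cast k1
  have hform : ∀ z u v : ℤ, x₁ * u + x₂ * v = x₀ * z → ∀ T : ℝ, |(u : ℝ)| + |(v : ℝ)| ≤ 2 * T →
      |(-z : ℝ) + u * α + v * α ^ 2| ≤ 2 * C * T / x₀ ^ 2 := by
    intro z u v hz T hT
    have hzR : (x₁ : ℝ) * u + x₂ * v = x₀ * z := by exact_mod_cast hz
    have e1 : x₀ * ((-z : ℝ) + u * α + v * α ^ 2) = u * (x₀ * α - x₁) + v * (x₀ * α ^ 2 - x₂) := by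
      linear_combination hzR
    have e2 : |x₀ * ((-z : ℝ) + u * α + v * α ^ 2)| ≤ |(u : ℝ)| * (C / x₀) + |(v : ℝ)| * (C / x₀) := by
      rw [e1]
      refine (abs_add_le _ _).trans ?_
      rw [abs_mul, abs_mul]
      gcongr
    rw [abs_mul, abs_of_pos hxR, ← add_mul] at e2
    have e3 : (|(u : ℝ)| + |(v : ℝ)|) * (C / x₀) ≤ 2 * T * (C / x₀) := by gcongr
    rw [le_div_iff₀ (by positivity)]
    have e4 : x₀ * |(-z : ℝ) + u * α + v * α ^ 2| ≤ 2 * T * (C / x₀) := e2.trans e3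
    have e5 : 2 * T * (C / x₀) * x₀ = 2 * C * T := by field_simp
    nlinarith
  have hEbound : (x₀ : ℝ) ^ 2 ≤ B * E ^ (d + 1) := by
    have f1 := hform z u v hz E (by linarith)
    have hne : u ≠ 0 ∨ v ≠ 0 := by
      by_contra! h
      apply hdet
      rw [h.1, h.2]; ring
    have hsmall : 2 * C * E / (x₀ : ℝ) ^ 2 ≤ 2 * C := by
      rw [div_le_iff₀ (by positivity)]
      have : (E : ℝ) ≤ x₀ ^ 2 := by nlinarith
      nlinarith
    have hzle : |(-z : ℝ)| ≤ C' * E := by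
      have e1 : (-z : ℝ) = (-z + u * α + v * α ^ 2) - u * α - v * α ^ 2 := by ring
      rw [e1]
      calc _ ≤ |(-z : ℝ) + u * α + v * α ^ 2| + |u * α| + |v * α ^ 2| := by
            refine (abs_sub _ _).trans ?_
            gcongr
            exact abs_sub _ _
        _ ≤ 2 * C * E + E * |α| + E * α ^ 2 := by
            rw [abs_mul, abs_mul, abs_of_nonneg (sq_nonneg α)]
            gcongr
            exact f1.trans (hsmall.trans (le_mul_of_one_le_right (by linarith) hER))
        _ = _ := by rw [hC']; ring
    have hEC : (E : ℝ) ≤ C' * E := le_mul_of_one_le_left hE0.le hC'1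
    have f2 := hL (fun k => if k = 0 then -z else if k = 1 then u else v) (C' * E) (by
      rcases hne with h | h
      · exact ⟨1, by norm_num, by simpa using h⟩
      · exact ⟨2, by norm_num, by simpa using h⟩) (one_le_mul_of_one_le_of_one_le hC'1 hER) (by
      intro k
      split_ifs
      · push_cast; exact hzle
      · exact huR.trans hEC
      · exact hvR.trans hEC)
    simp only [Finset.sum_range_succ, Finset.range_zero, Finset.sum_empty] at f2
    norm_num at f2
    have f3 : κ ≤ 2 * C * E / x₀ ^ 2 * (C' * E) ^ d := f2.trans (by gcongr)
    have f4 : κ * x₀ ^ 2 ≤ 2 * C * E * (C' * E) ^ d := by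
      calc κ * x₀ ^ 2 ≤ (2 * C * E / x₀ ^ 2 * (C' * E) ^ d) * x₀ ^ 2 := by gcongr
        _ = _ := by field_simp
    rw [hB, div_mul_eq_mul_div, le_div_iff₀ hκ]
    calc (x₀ : ℝ) ^ 2 * κ = κ * x₀ ^ 2 := by ring
      _ ≤ _ := f4
      _ = _ := by rw [mul_pow]; ring
  have hlogE : 2 * ℓ ≤ Real.log B + (d + 1) * Real.log E := by
    have := Real.log_le_log (by positivity) hEbound
    rw [Real.log_mul hB0.ne' (by positivity), Real.log_pow, Real.log_pow] at this
    push_cast at this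
    exact this
  set W : Fin 3 → ℝ := ![2 * C / (x₀ * E), W₁, W₂] with hWdef
  have hWpos : ∀ i, 0 < W i := by
    intro i
    fin_cases i
    · show 0 < 2 * C / (x₀ * E); positivity
    · show 0 < W₁; linarith
    · show 0 < W₂; linarith
  have hexp : ∀ i, Real.exp (Real.log (W i) / ℓ * ℓ) = W i := fun i => by
    rw [div_mul_cancel₀ _ hℓ0.ne', Real.exp_log (hWpos i)]
  have hL0 : 2 * C * (x₀ / E) / (x₀ : ℝ) ^ 2 = 2 * C / (x₀ * E) := by field_simp
  have hlogW0 : Real.log (2 * C / (x₀ * E)) = Real.log (2 * C) - ℓ - Real.log E := by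
    rw [Real.log_div (by positivity) (by positivity), Real.log_mul hxR.ne' hE0.ne', ← sub_sub]
  have hlogEq : Real.log E ≤ ℓ := Real.log_le_log hE0 (by nlinarith)
  have hlogE0 : 0 ≤ Real.log E := Real.log_nonneg hER
  have hlogW : Real.log W₁ + Real.log W₂ = ℓ := by
    rw [← Real.log_mul (by positivity) (by positivity), hW]
  have hlog1 : 0 ≤ Real.log W₁ := Real.log_nonneg hW1
  have hlog2 : 0 ≤ Real.log W₂ := Real.log_nonneg hW2
  refine ⟨![-z, u, v], ![-z', u', v'], fun i => Real.log (W i) / ℓ, ?_, ?_, ?_, ?_, ?_, ?_, ?_⟩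
  · show x₀ * -z + x₁ * u + x₂ * v = 0
    linarith
  · show x₀ * -z' + x₁ * u' + x₂ * v' = 0
    linarith
  · exact hdet
  · intro i
    rw [hexp]
    fin_cases i
    · show |((-z : ℤ) : ℝ) + u * α + v * α ^ 2| ≤ 2 * C / (x₀ * E)
      rw [← hL0]
      push_cast
      exact hform z u v hz _ (by linarith)
    · exact g1
    · exact g2
  · intro i
    rw [hexp]
    fin_cases i
    · show |((-z' : ℤ) : ℝ) + u' * α + v' * α ^ 2| ≤ 2 * C / (x₀ * E)
      rw [← hL0]
      push_cast
      exact hform z' u' v' hz' _ (by linarith)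
    · exact g3
    · exact g4
  · intro i
    rw [abs_div, abs_of_pos hℓ0, div_le_iff₀ hℓ0, abs_le]
    fin_cases i
    · show -(3 * ℓ) ≤ Real.log (2 * C / (x₀ * E)) ∧ Real.log (2 * C / (x₀ * E)) ≤ 3 * ℓ
      rw [hlogW0]; constructor <;> linarith
    · show -(3 * ℓ) ≤ Real.log W₁ ∧ Real.log W₁ ≤ 3 * ℓ
      constructor <;> linarith
    · show -(3 * ℓ) ≤ Real.log W₂ ∧ Real.log W₂ ≤ 3 * ℓ
      constructor <;> linarith
  · rw [Fin.sum_univ_three]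
    show Real.log (2 * C / (x₀ * E)) / ℓ + Real.log W₁ / ℓ + Real.log W₂ / ℓ ≤ _
    rw [← add_div, ← add_div, hlogW0, ← neg_div, div_le_div_iff₀ hℓ0 hd1]
    have h3 : Real.log (2 * C) - ℓ - Real.log E + Real.log W₁ + Real.log W₂ =
        Real.log (2 * C) - Real.log E := by linarith
    have := le_abs_self (Real.log B)
    rw [h3]
    linarith

def substCoeff (k j : Fin 3 → ℕ) : ℤ :=
  if k 1 ≤ j 1 ∧ k 2 ≤ j 2 then
    (-1) ^ (j 1 - k 1 + (j 2 - k 2)) *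
      (Nat.multinomial Finset.univ (![j 0, j 1 - k 1, j 2 - k 2] : Fin 3 → ℕ) : ℤ)
  else 0

def substExp (k j : Fin 3 → ℕ) : ℕ := (j 1 - k 1) + 2 * (j 2 - k 2)

theorem substExp_le {r : ℕ} (k : Fin 3 → ℕ) {j : Fin 3 → ℕ}
    (hj : j ∈ Finset.piAntidiag Finset.univ r) : substExp k j ≤ 2 * r := by
  rw [Finset.mem_piAntidiag, Fin.sum_univ_three] at hj
  unfold substExp
  omega

theorem abs_substCoeff_le {r : ℕ} (k : Fin 3 → ℕ) {j : Fin 3 → ℕ}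
    (hj : j ∈ Finset.piAntidiag Finset.univ r) : |substCoeff k j| ≤ 3 ^ r := by
  rw [Finset.mem_piAntidiag, Fin.sum_univ_three] at hj
  unfold substCoeff
  split_ifs with h
  · rw [abs_mul, abs_pow, abs_neg, abs_one, one_pow, one_mul, Nat.abs_cast]
    set t : Fin 3 → ℕ := ![j 0, j 1 - k 1, j 2 - k 2] with ht
    set s := ∑ i, t i with hs
    have h1 : Nat.multinomial Finset.univ t ≤ 3 ^ s := by
      have h2 := Finset.sum_pow_eq_sum_piAntidiag (Finset.univ : Finset (Fin 3)) (fun _ => (1 : ℕ)) s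
      simp only [Finset.sum_const, Finset.card_univ, Fintype.card_fin, one_pow,
        Finset.prod_const_one, mul_one, smul_eq_mul] at h2
      rw [h2]
      exact Finset.single_le_sum (f := fun t => Nat.multinomial Finset.univ t)
        (fun _ _ => Nat.zero_le _) (Finset.mem_piAntidiag.mpr ⟨rfl, by simp⟩)
    have h3 : s ≤ r := by
      rw [hs, Fin.sum_univ_three]
      show j 0 + (j 1 - k 1) + (j 2 - k 2) ≤ r
      omega
    exact_mod_cast h1.trans (Nat.pow_le_pow_right (by norm_num) h3)
  · simp

theorem pow_mul_pow_mul_pow_eq_sum_substCoeff {R : Type*} [CommRing R] (α L Y₁ Y₂ : R) {r : ℕ}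
    {k : Fin 3 → ℕ} (hk : k ∈ Finset.piAntidiag Finset.univ r) :
    (L - α * Y₁ - α ^ 2 * Y₂) ^ k 0 * (Y₁ ^ k 1 * Y₂ ^ k 2) =
      ∑ j ∈ Finset.piAntidiag Finset.univ r,
        (substCoeff k j : R) * α ^ substExp k j * (L ^ j 0 * (Y₁ ^ j 1 * Y₂ ^ j 2)) := by
  rw [Finset.mem_piAntidiag, Fin.sum_univ_three] at hk
  have h1 := Finset.sum_pow_eq_sum_piAntidiag (Finset.univ : Finset (Fin 3))
    (![L, -(α * Y₁), -(α ^ 2 * Y₂)]) (k 0)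
  rw [Fin.sum_univ_three] at h1
  simp only [Fin.prod_univ_three] at h1
  have e1 : L - α * Y₁ - α ^ 2 * Y₂ = ![L, -(α * Y₁), -(α ^ 2 * Y₂)] 0 +
    ![L, -(α * Y₁), -(α ^ 2 * Y₂)] 1 + ![L, -(α * Y₁), -(α ^ 2 * Y₂)] 2 := by
    show _ = L + -(α * Y₁) + -(α ^ 2 * Y₂)
    ring
  rw [e1, h1, Finset.sum_mul]
  rw [← Finset.sum_filter_add_sum_filter_not (Finset.piAntidiag Finset.univ r)
    (fun j : Fin 3 → ℕ => k 1 ≤ j 1 ∧ k 2 ≤ j 2)]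
  rw [Finset.sum_eq_zero (s := Finset.filter (fun j => ¬_) _) (fun j hj => by
    rw [substCoeff, if_neg (Finset.mem_filter.mp hj).2]; simp), add_zero]
  refine Finset.sum_nbij' (fun t => ![t 0, t 1 + k 1, t 2 + k 2])
    (fun j => ![j 0, j 1 - k 1, j 2 - k 2]) ?_ ?_ ?_ ?_ ?_
  · intro t ht
    rw [Finset.mem_piAntidiag, Fin.sum_univ_three] at ht
    rw [Finset.mem_filter, Finset.mem_piAntidiag, Fin.sum_univ_three]
    refine ⟨⟨?_, by simp⟩, ?_, ?_⟩
    · show t 0 + (t 1 + k 1) + (t 2 + k 2) = r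
      omega
    · show k 1 ≤ t 1 + k 1
      omega
    · show k 2 ≤ t 2 + k 2
      omega
  · intro j hj
    rw [Finset.mem_filter, Finset.mem_piAntidiag, Fin.sum_univ_three] at hj
    rw [Finset.mem_piAntidiag, Fin.sum_univ_three]
    refine ⟨?_, by simp⟩
    show j 0 + (j 1 - k 1) + (j 2 - k 2) = k 0
    omega
  · intro t _
    funext i
    fin_cases i <;> simp
  · intro j hj
    rw [Finset.mem_filter] at hj
    funext i
    fin_cases i <;> simp [hj.2.1, hj.2.2]
  · intro t ht
    have e2 : substCoeff k ![t 0, t 1 + k 1, t 2 + k 2] =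
        (-1) ^ (t 1 + t 2) * (Nat.multinomial Finset.univ t : ℤ) := by
      have e3 : (![t 0, t 1, t 2] : Fin 3 → ℕ) = t := by
        funext i; fin_cases i <;> rfl
      unfold substCoeff
      simp [e3]
    have e4 : substExp k ![t 0, t 1 + k 1, t 2 + k 2] = t 1 + 2 * t 2 := by
      unfold substExp; simp
    rw [e2, e4]
    simp only [Matrix.cons_val_zero, Matrix.cons_val_one, Matrix.cons_val]
    push_cast
    rw [neg_pow (α * Y₁), neg_pow (α ^ 2 * Y₂)]
    ring

theorem choose_mul_pow_eq_sum_substCoeff {R : Type*} [CommRing R] (α L Y₁ Y₂ : R) {r : ℕ}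
    {k : Fin 3 → ℕ} (hk : k ∈ Finset.piAntidiag Finset.univ r) (i : ℕ) :
    ((k 0).choose i : R) * (L - α * Y₁ - α ^ 2 * Y₂) ^ (k 0 - i) * (Y₁ ^ k 1 * Y₂ ^ k 2) =
      ∑ j ∈ Finset.piAntidiag Finset.univ r, (substCoeff k j : R) * α ^ substExp k j *
        (((j 0).choose i : R) * L ^ (j 0 - i) * (Y₁ ^ j 1 * Y₂ ^ j 2)) := by
  have h := congrArg (fun P => Polynomial.coeff P i) (pow_mul_pow_mul_pow_eq_sum_substCoeff
    (Polynomial.C α) (Polynomial.X + Polynomial.C L) (Polynomial.C Y₁) (Polynomial.C Y₂) hk)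
  have e1 : (Polynomial.X + Polynomial.C L - Polynomial.C α * Polynomial.C Y₁ -
      Polynomial.C α ^ 2 * Polynomial.C Y₂) =
      Polynomial.X + Polynomial.C (L - α * Y₁ - α ^ 2 * Y₂) := by
    simp only [map_sub, map_mul, map_pow]; ring
  have e2 : ∀ j : Fin 3 → ℕ, (Polynomial.C Y₁ ^ j 1 * Polynomial.C Y₂ ^ j 2) =
      Polynomial.C (Y₁ ^ j 1 * Y₂ ^ j 2) := fun j => by simp
  have e3 : ∀ j : Fin 3 → ℕ, (substCoeff k j : Polynomial R) * Polynomial.C α ^ substExp k j =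
      Polynomial.C ((substCoeff k j : R) * α ^ substExp k j) := fun j => by simp
  simp only [e1, e2, e3, Polynomial.finsetSum_coeff, Polynomial.coeff_mul_C,
    Polynomial.coeff_C_mul, Polynomial.coeff_X_add_C_pow] at h
  rw [mul_comm ((k 0).choose i : R), h]
  exact Finset.sum_congr rfl fun j _ => by ring

theorem sum_piAntidiag_apply (r : ℕ) (i : Fin 3) :
    ∑ j ∈ Finset.piAntidiag (Finset.univ : Finset (Fin 3)) r, (j i : ℝ) =
      r / 3 * (Finset.piAntidiag (Finset.univ : Finset (Fin 3)) r).card := by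
  have hsymm : ∀ i' : Fin 3,
      ∑ j ∈ Finset.piAntidiag (Finset.univ : Finset (Fin 3)) r, (j i' : ℝ) =
      ∑ j ∈ Finset.piAntidiag (Finset.univ : Finset (Fin 3)) r, (j i : ℝ) := by
    intro i'
    have hmem : ∀ j ∈ Finset.piAntidiag (Finset.univ : Finset (Fin 3)) r,
        j ∘ Equiv.swap i i' ∈ Finset.piAntidiag (Finset.univ : Finset (Fin 3)) r := by
      intro j hj
      rw [Finset.mem_piAntidiag] at hj ⊢
      refine ⟨?_, by simp⟩
      rw [← hj.1]
      exact Equiv.sum_comp (Equiv.swap i i') j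
    refine Finset.sum_nbij' (fun j => j ∘ Equiv.swap i i') (fun j => j ∘ Equiv.swap i i')
      hmem hmem ?_ ?_ ?_
    · intro j _; funext x; simp
    · intro j _; funext x; simp
    · intro j _; simp
  have htot : ∑ i' : Fin 3, ∑ j ∈ Finset.piAntidiag (Finset.univ : Finset (Fin 3)) r, (j i' : ℝ) =
      r * (Finset.piAntidiag (Finset.univ : Finset (Fin 3)) r).card := by
    rw [Finset.sum_comm, Finset.sum_congr rfl (g := fun _ => (r : ℝ)), Finset.sum_const,
      nsmul_eq_mul, mul_comm]
    intro j hj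
    rw [Finset.mem_piAntidiag] at hj
    exact_mod_cast hj.1
  rw [Finset.sum_congr rfl fun i' _ => hsymm i', Finset.sum_const, Finset.card_univ,
    Fintype.card_fin, nsmul_eq_mul] at htot
  push_cast at htot
  linarith

theorem sum_exp_piAntidiag_le {a ℓ Y : ℝ} (ha : 0 < a) (ha1 : a ≤ 1) (hY : 0 < Y) (hℓ : 0 < ℓ)
    {r : ℕ} (h1 : Y ≤ r * ℓ) (h2 : r * ℓ ≤ 2 * Y) (w : Fin 3 → ℝ) (hw : ∀ i, |w i| ≤ 3)
    (hsum : ∑ i, w i ≤ -a) :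
    ∑ j ∈ Finset.piAntidiag (Finset.univ : Finset (Fin 3)) r,
      Real.exp (a / 432 * (ℓ / Y * ∑ i, w i * j i)) ≤
      (Finset.piAntidiag (Finset.univ : Finset (Fin 3)) r).card *
        Real.exp (-(a / 432) * a / 3 + 36 * (a / 432) ^ 2) := by
  set S := Finset.piAntidiag (Finset.univ : Finset (Fin 3)) r with hS
  set s : ℝ := a / 432 with hs
  have hs0 : 0 < s := by positivity
  have hpt : ∀ j ∈ S, Real.exp (s * (ℓ / Y * ∑ i, w i * j i)) ≤
      1 + s * (ℓ / Y * ∑ i, w i * j i) + 36 * s ^ 2 := by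
    intro j hj
    rw [hS, Finset.mem_piAntidiag] at hj
    have hjr : ∑ i, (j i : ℝ) = r := by exact_mod_cast hj.1
    have hX : |ℓ / Y * ∑ i, w i * j i| ≤ 6 := by
      have h3 : |∑ i, w i * j i| ≤ 3 * r := by
        refine (Finset.abs_sum_le_sum_abs _ _).trans ?_
        rw [← hjr, Finset.mul_sum]
        refine Finset.sum_le_sum fun i _ => ?_
        rw [abs_mul, Nat.abs_cast]
        exact mul_le_mul_of_nonneg_right (hw i) (Nat.cast_nonneg _)
      rw [abs_mul, abs_of_pos (by positivity)]
      calc ℓ / Y * |∑ i, w i * j i| ≤ ℓ / Y * (3 * r) := by gcongr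
        _ = 3 * (r * ℓ) / Y := by ring
        _ ≤ 6 := by rw [div_le_iff₀ hY]; linarith
    set X := ℓ / Y * ∑ i, w i * j i with hXdef
    have hsX : |s * X| ≤ 1 := by
      rw [abs_mul, abs_of_pos hs0]
      nlinarith
    have h4 := Real.abs_exp_sub_one_sub_id_le hsX
    have h5 := (abs_le.mp h4).2
    have h6 : X ^ 2 ≤ 36 := by
      rw [← sq_abs]
      have := abs_nonneg X
      nlinarith
    have h7 : (s * X) ^ 2 ≤ 36 * s ^ 2 := by
      rw [mul_pow]; nlinarith [sq_nonneg s]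
    linarith
  refine (Finset.sum_le_sum hpt).trans ?_
  rw [Finset.sum_add_distrib, Finset.sum_add_distrib, ← Finset.mul_sum, ← Finset.mul_sum,
    Finset.sum_comm]
  simp_rw [← Finset.mul_sum, hS, sum_piAntidiag_apply, ← Finset.sum_mul, ← hS]
  simp only [Finset.sum_const, nsmul_eq_mul]
  have h8 : (∑ i, w i) * (ℓ / Y * r) ≤ -a := by
    have h9 : 1 ≤ ℓ / Y * r := by
      rw [div_mul_eq_mul_div, one_le_div hY]; linarith
    nlinarith
  have h10 := Real.add_one_le_exp (-s * a / 3 + 36 * s ^ 2)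
  calc _ = (S.card : ℝ) * (1 + s * ((∑ i, w i) * (ℓ / Y * r)) / 3 + 36 * s ^ 2) := by ring
    _ ≤ _ := by
      gcongr
      nlinarith

theorem card_filter_piFinset_le {m : ℕ} {a Y : ℝ} (ha : 0 < a) (ha1 : a ≤ 1) (hY : 0 < Y)
    (ℓ : Fin m → ℝ) (hℓ : ∀ h, 0 < ℓ h) (r : Fin m → ℕ) (h1 : ∀ h, Y ≤ r h * ℓ h)
    (h2 : ∀ h, r h * ℓ h ≤ 2 * Y) (w : Fin m → Fin 3 → ℝ) (hw : ∀ h i, |w h i| ≤ 3)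
    (hsum : ∀ h, ∑ i, w h i ≤ -a) (bad : Finset (Fin m → Fin 3 → ℕ))
    (hbad : ∀ j ∈ bad, j ∈ Fintype.piFinset
        (fun h => Finset.piAntidiag (Finset.univ : Finset (Fin 3)) (r h)) ∧
      -(m * a * Y / 6) < ∑ h, ℓ h * ∑ i, w h i * j h i) :
    (bad.card : ℝ) ≤ (Fintype.piFinset
      (fun h => Finset.piAntidiag (Finset.univ : Finset (Fin 3)) (r h))).card *
        Real.exp (-(m * a ^ 2 / 5184)) := by
  set J := Fintype.piFinset
      (fun h => Finset.piAntidiag (Finset.univ : Finset (Fin 3)) (r h)) with hJ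
  set s : ℝ := a / 432 with hs
  have hs0 : 0 < s := by positivity
  have hprod : ∑ j ∈ J, ∏ h, Real.exp (s * (ℓ h / Y * ∑ i, w h i * j h i)) ≤
      J.card * Real.exp (m * (-s * a / 3 + 36 * s ^ 2)) := by
    rw [hJ, ← Finset.prod_univ_sum (fun h => Finset.piAntidiag (Finset.univ : Finset (Fin 3)) (r h))
      (fun h j => Real.exp (s * (ℓ h / Y * ∑ i, w h i * j i)))]
    refine (Finset.prod_le_prod (fun _ _ => Finset.sum_nonneg fun _ _ => (Real.exp_pos _).le)
      (fun h _ => sum_exp_piAntidiag_le ha ha1 hY (hℓ h) (h1 h) (h2 h) (w h) (hw h)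
        (hsum h))).trans (le_of_eq ?_)
    rw [Finset.prod_mul_distrib, Fintype.card_piFinset, Finset.prod_const, Finset.card_univ,
      Fintype.card_fin, ← Real.exp_nat_mul]
    push_cast
    rfl
  have hlow : (bad.card : ℝ) * Real.exp (-(s * (m * a / 6))) ≤
      ∑ j ∈ J, ∏ h, Real.exp (s * (ℓ h / Y * ∑ i, w h i * j h i)) := by
    rw [← nsmul_eq_mul]
    refine (Finset.card_nsmul_le_sum bad _ _ fun j hj => ?_).trans
      (Finset.sum_le_sum_of_subset_of_nonneg (fun j hj => (hbad j hj).1)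
        fun _ _ _ => Finset.prod_nonneg fun _ _ => (Real.exp_pos _).le)
    rw [← Real.exp_sum, Real.exp_le_exp, ← Finset.mul_sum, ← mul_neg]
    refine mul_le_mul_of_nonneg_left ?_ hs0.le
    have h3 := (hbad j hj).2.le
    have h4 : ∑ h, ℓ h / Y * ∑ i, w h i * j h i = (∑ h, ℓ h * ∑ i, w h i * j h i) / Y := by
      rw [Finset.sum_div]
      exact Finset.sum_congr rfl fun h _ => by ring
    rw [h4, le_div_iff₀ hY]
    linarith
  have h5 := hlow.trans hprod
  have h6 : -(m * a ^ 2 / 5184) = m * (-s * a / 3 + 36 * s ^ 2) - -(s * (m * a / 6)) := by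
    rw [hs]; ring
  rw [h6, Real.exp_sub, mul_div_assoc', le_div_iff₀ (Real.exp_pos _)]
  exact h5

theorem card_piAntidiag_fin_three_le (r : ℕ) :
    (Finset.piAntidiag (Finset.univ : Finset (Fin 3)) r).card ≤ 3 ^ r := by
  have h2 := Finset.sum_pow_eq_sum_piAntidiag (Finset.univ : Finset (Fin 3)) (fun _ => (1 : ℕ)) r
  simp only [Finset.sum_const, Finset.card_univ, Fintype.card_fin, one_pow,
    Finset.prod_const_one, mul_one, smul_eq_mul] at h2
  rw [h2, Finset.card_eq_sum_ones]
  exact Finset.sum_le_sum fun j _ => Nat.multinomial_pos _ _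

theorem card_piFinset_piAntidiag_le {m : ℕ} (r : Fin m → ℕ) :
    (Fintype.piFinset
      (fun h => Finset.piAntidiag (Finset.univ : Finset (Fin 3)) (r h))).card ≤ 3 ^ ∑ h, r h := by
  rw [Fintype.card_piFinset, ← Finset.prod_pow_eq_pow_sum]
  exact Finset.prod_le_prod (fun _ _ => Nat.zero_le _) fun h _ => card_piAntidiag_fin_three_le _

open Matrix in
theorem exists_small_integer_kernel {β γ : Type*} [Fintype β] [Fintype γ] [DecidableEq β]
    [DecidableEq γ] (A : β → γ → ℤ) (K : ℝ) (hK : 1 ≤ K) (hA : ∀ b c, |(A b c : ℝ)| ≤ K)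
    (hγ : 0 < Fintype.card γ) (hcard : 2 * Fintype.card β ≤ Fintype.card γ) :
    ∃ t : γ → ℤ, t ≠ 0 ∧ (∀ b, ∑ c, A b c * t c = 0) ∧
      ∀ c, |(t c : ℝ)| ≤ Fintype.card γ * K := by
  have hγR : (1 : ℝ) ≤ Fintype.card γ := by exact_mod_cast hγ
  rcases Nat.eq_zero_or_pos (Fintype.card β) with h0 | h0
  · have : IsEmpty β := Fintype.card_eq_zero_iff.mp h0
    have : Nonempty γ := Fintype.card_pos_iff.mp hγ
    refine ⟨fun _ => 1, fun h => ?_, fun b => isEmptyElim b, fun c => ?_⟩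
    · simpa using congrFun h (Classical.arbitrary γ)
    · simpa using one_le_mul_of_one_le_of_one_le hγR hK
  · let _ := Matrix.seminormedAddCommGroup (m := β) (n := γ) (α := ℤ)
    obtain ⟨t, ht, htA, hnorm⟩ := Int.Matrix.exists_ne_zero_int_vec_norm_le
      (Matrix.of A) (by omega) h0
    refine ⟨t, ht, fun b => ?_, fun c => ?_⟩
    · exact congrFun htA b
    · have h1 : ‖Matrix.of A‖ ≤ K := by
        rw [Matrix.norm_le_iff (by linarith)]
        intro b c
        rw [Int.norm_eq_abs]
        exact hA b c
      have h2 : |(t c : ℝ)| ≤ ‖t‖ := by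
        rw [← Int.norm_eq_abs]
        exact norm_le_pi_norm t c
      refine h2.trans (hnorm.trans ?_)
      have h3 : (1 : ℝ) ≤ Fintype.card γ * max 1 ‖Matrix.of A‖ :=
        one_le_mul_of_one_le_of_one_le hγR (le_max_left _ _)
      have h4 : (2 : ℝ) * Fintype.card β ≤ Fintype.card γ := by exact_mod_cast hcard
      have h5 : (0 : ℝ) < Fintype.card β := by exact_mod_cast h0
      calc _ ≤ ((Fintype.card γ : ℝ) * max 1 ‖Matrix.of A‖) ^ (1 : ℝ) := by
            refine Real.rpow_le_rpow_of_exponent_le h3 ?_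
            rw [div_le_one (by linarith)]
            linarith
        _ = (Fintype.card γ : ℝ) * max 1 ‖Matrix.of A‖ := Real.rpow_one _
        _ ≤ _ := by
            gcongr
            exact max_le hK h1

theorem exists_auxiliary_coefficients (α : ℝ) (hα : IsAlgebraic ℚ α) :
    ∃ (d : ℕ) (K : ℝ), 0 < d ∧ 1 ≤ K ∧ ∀ (m : ℕ) (r : Fin m → ℕ)
      (bad : Finset (Fin m → Fin 3 → ℕ)),
      bad ⊆ Fintype.piFinset
        (fun h => Finset.piAntidiag (Finset.univ : Finset (Fin 3)) (r h)) →
      2 * (bad.card * d) ≤ (Fintype.piFinset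
        (fun h => Finset.piAntidiag (Finset.univ : Finset (Fin 3)) (r h))).card →
      ∃ p : (Fin m → Fin 3 → ℕ) → ℤ,
        (∃ k ∈ Fintype.piFinset
          (fun h => Finset.piAntidiag (Finset.univ : Finset (Fin 3)) (r h)), p k ≠ 0) ∧
        (∀ k, |(p k : ℝ)| ≤ K ^ ∑ h, r h) ∧
        ∀ j ∈ bad, ∑ k ∈ Fintype.piFinset
          (fun h => Finset.piAntidiag (Finset.univ : Finset (Fin 3)) (r h)),
          (p k : ℝ) * ∏ h, ((substCoeff (k h) (j h) : ℝ) * α ^ substExp (k h) (j h)) = 0 := by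
  classical
  obtain ⟨d, D, C, hd, hD, hC, -, hpow⟩ := exists_pow_eq_sum_range α hα
  choose c hc hcC using hpow
  have hDR : (1 : ℝ) ≤ D := by exact_mod_cast hD
  set K₀ : ℝ := 3 * (D ^ 2 * C ^ 2) with hK₀
  have hK₀1 : 1 ≤ K₀ := by
    have := one_le_mul_of_one_le_of_one_le (one_le_pow₀ hDR (n := 2)) (one_le_pow₀ hC (n := 2))
    linarith
  refine ⟨d, 3 * K₀, hd, by linarith, fun m r bad hbadJ hcard => ?_⟩
  set J := Fintype.piFinset
    (fun h => Finset.piAntidiag (Finset.univ : Finset (Fin 3)) (r h)) with hJ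
  set R := ∑ h, r h with hR
  let ν : (Fin m → Fin 3 → ℕ) → (Fin m → Fin 3 → ℕ) → ℕ := fun k j => ∑ h, substExp (k h) (j h)
  let μ : (Fin m → Fin 3 → ℕ) → (Fin m → Fin 3 → ℕ) → ℤ :=
    fun k j => ∏ h, substCoeff (k h) (j h)
  have hν : ∀ k, ∀ j ∈ J, ν k j ≤ 2 * R := by
    intro k j hj
    rw [hR, Finset.mul_sum]
    exact Finset.sum_le_sum fun h _ => substExp_le _ (Fintype.mem_piFinset.mp hj h)
  have hμ : ∀ k, ∀ j ∈ J, |(μ k j : ℝ)| ≤ 3 ^ R := by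
    intro k j hj
    have : |μ k j| ≤ 3 ^ R := by
      rw [hR, ← Finset.prod_pow_eq_pow_sum, Finset.abs_prod]
      exact Finset.prod_le_prod (fun _ _ => abs_nonneg _)
        fun h _ => abs_substCoeff_le _ (Fintype.mem_piFinset.mp hj h)
    exact_mod_cast this
  let A : bad × Fin d → J → ℤ := fun b k =>
    μ k b.1 * D ^ (2 * R - ν k b.1) * c (ν k b.1) b.2
  have hA : ∀ b k, |(A b k : ℝ)| ≤ K₀ ^ R := by
    intro b k
    have hb := hbadJ b.1.2
    simp only [A]
    push_cast
    rw [abs_mul, abs_mul, abs_pow, Nat.abs_cast]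
    calc |(μ k b.1 : ℝ)| * (D : ℝ) ^ (2 * R - ν k b.1) * |(c (ν k b.1) b.2 : ℝ)|
        ≤ 3 ^ R * (D : ℝ) ^ (2 * R) * C ^ (2 * R) := by
          gcongr
          · exact hμ _ _ hb
          · exact Nat.sub_le _ _
          · exact (hcC _ _).trans (pow_le_pow_right₀ hC (hν _ _ hb))
      _ = K₀ ^ R := by rw [hK₀, mul_pow, mul_pow, ← pow_mul, ← pow_mul]; ring
  have hJpos : 0 < Fintype.card J := by
    rw [Fintype.card_coe, hJ, Fintype.card_piFinset]
    refine Finset.prod_pos fun h _ => Finset.card_pos.mpr ⟨![r h, 0, 0], ?_⟩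
    rw [Finset.mem_piAntidiag, Fin.sum_univ_three]
    simp
  obtain ⟨t, ht, htA, htle⟩ := exists_small_integer_kernel A (K₀ ^ R) (one_le_pow₀ hK₀1) hA hJpos
    (by rw [Fintype.card_prod, Fintype.card_coe, Fintype.card_coe, Fintype.card_fin]; exact hcard)
  refine ⟨fun k => if hk : k ∈ J then t ⟨k, hk⟩ else 0, ?_, fun k => ?_, fun j hj => ?_⟩
  · obtain ⟨k, hk⟩ := Function.ne_iff.mp ht
    exact ⟨k, k.2, by simpa using hk⟩
  · have hJle : (Fintype.card J : ℝ) ≤ 3 ^ R := by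
      rw [Fintype.card_coe]
      exact_mod_cast card_piFinset_piAntidiag_le r
    dsimp only
    split_ifs with hk
    · refine (htle _).trans ?_
      rw [mul_pow 3 K₀]
      exact mul_le_mul_of_nonneg_right hJle (by positivity)
    · simp only [Int.cast_zero, abs_zero]
      positivity
  · have hjJ := hbadJ hj
    have hD0 : (D : ℝ) ^ (2 * R) ≠ 0 := by positivity
    refine (mul_eq_zero.mp (?_ : (D : ℝ) ^ (2 * R) * _ = 0)).resolve_left hD0
    have e1 : ∀ k, (D : ℝ) ^ (2 * R) *
        ∏ h, ((substCoeff (k h) (j h) : ℝ) * α ^ substExp (k h) (j h)) =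
        ∑ i ∈ Finset.range d, ((μ k j * D ^ (2 * R - ν k j) * c (ν k j) i : ℤ) : ℝ) * α ^ i := by
      intro k
      have e2 : (D : ℝ) ^ (2 * R) = D ^ (2 * R - ν k j) * D ^ ν k j := by
        rw [← pow_add, Nat.sub_add_cancel (hν k j hjJ)]
      have e3 : ∏ h, ((substCoeff (k h) (j h) : ℝ) * α ^ substExp (k h) (j h)) =
          μ k j * α ^ ν k j := by
        simp only [μ, ν]
        rw [Finset.prod_mul_distrib, Finset.prod_pow_eq_pow_sum]
        push_cast
        rfl
      rw [e2, e3]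
      calc _ = (μ k j * (D : ℝ) ^ (2 * R - ν k j)) * ((D : ℝ) ^ ν k j * α ^ ν k j) := by ring
        _ = _ := by
          rw [hc, Finset.mul_sum]
          exact Finset.sum_congr rfl fun i _ => by push_cast; ring
    rw [Finset.mul_sum, ← Finset.sum_coe_sort J]
    have e4 : ∀ k : J, (D : ℝ) ^ (2 * R) * (((if hk : (k : Fin m → Fin 3 → ℕ) ∈ J then t ⟨k, hk⟩ else 0 : ℤ) : ℝ) *
        ∏ h, ((substCoeff ((k : Fin m → Fin 3 → ℕ) h) (j h) : ℝ) *
          α ^ substExp ((k : Fin m → Fin 3 → ℕ) h) (j h))) =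
        ∑ i ∈ Finset.range d, ((μ k j * D ^ (2 * R - ν k j) * c (ν k j) i * t k : ℤ) : ℝ) * α ^ i := by
      intro k
      rw [dif_pos k.2, mul_left_comm, e1, Finset.mul_sum]
      exact Finset.sum_congr rfl fun i _ => by push_cast; ring
    rw [Finset.sum_congr rfl fun k _ => e4 k, Finset.sum_comm]
    refine Finset.sum_eq_zero fun i hi => ?_
    have e5 := htA (⟨j, hj⟩, ⟨i, Finset.mem_range.mp hi⟩)
    rw [← Finset.sum_mul, ← Int.cast_sum]
    simp only [A] at e5
    rw [e5]
    simp

def directionalTaylor {m : ℕ} {R : Type*} [CommRing R] (J : Finset (Fin m → Fin 3 → ℕ))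
    (p : (Fin m → Fin 3 → ℕ) → ℤ) (i : Fin m → ℕ) (y : Fin m → Fin 3 → R) : R :=
  ∑ k ∈ J, (p k : R) * ∏ h, (((k h 0).choose (i h) : R) * y h 0 ^ (k h 0 - i h) *
    (y h 1 ^ k h 1 * y h 2 ^ k h 2))

theorem map_directionalTaylor {m : ℕ} {R S : Type*} [CommRing R] [CommRing S] (f : R →+* S)
    (J : Finset (Fin m → Fin 3 → ℕ)) (p : (Fin m → Fin 3 → ℕ) → ℤ) (i : Fin m → ℕ)
    (y : Fin m → Fin 3 → R) :
    f (directionalTaylor J p i y) = directionalTaylor J p i (fun h c => f (y h c)) := by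
  simp [directionalTaylor, map_sum, map_prod]

theorem directionalTaylor_eq_sum {m : ℕ} {R : Type*} [CommRing R] (r : Fin m → ℕ)
    (p : (Fin m → Fin 3 → ℕ) → ℤ) (i : Fin m → ℕ) (y z : Fin m → Fin 3 → R) (α : R)
    (h0 : ∀ h, z h 0 = y h 0 + α * y h 1 + α ^ 2 * y h 2) (h1 : ∀ h, z h 1 = y h 1)
    (h2 : ∀ h, z h 2 = y h 2) :
    directionalTaylor (Fintype.piFinset
        (fun h => Finset.piAntidiag (Finset.univ : Finset (Fin 3)) (r h))) p i y =
      ∑ j ∈ Fintype.piFinset (fun h => Finset.piAntidiag (Finset.univ : Finset (Fin 3)) (r h)),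
        (∑ k ∈ Fintype.piFinset
            (fun h => Finset.piAntidiag (Finset.univ : Finset (Fin 3)) (r h)),
          (p k : R) * ∏ h, ((substCoeff (k h) (j h) : R) * α ^ substExp (k h) (j h))) *
        ∏ h, (((j h 0).choose (i h) : R) * z h 0 ^ (j h 0 - i h) *
          (z h 1 ^ j h 1 * z h 2 ^ j h 2)) := by
  unfold directionalTaylor
  simp_rw [Finset.sum_mul]
  rw [Finset.sum_comm]
  refine Finset.sum_congr rfl fun k hk => ?_
  simp_rw [mul_assoc (p k : R), ← Finset.prod_mul_distrib]
  rw [← Finset.mul_sum, ← Finset.prod_univ_sum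
    (fun h => Finset.piAntidiag (Finset.univ : Finset (Fin 3)) (r h))
    (fun h j => (substCoeff (k h) j : R) * α ^ substExp (k h) j *
      (((j 0).choose (i h) : R) * z h 0 ^ (j 0 - i h) * (z h 1 ^ j 1 * z h 2 ^ j 2)))]
  congr 1
  refine Finset.prod_congr rfl fun h _ => ?_
  have e := choose_mul_pow_eq_sum_substCoeff α (z h 0) (z h 1) (z h 2)
    (Fintype.mem_piFinset.mp hk h) (i h)
  rw [← e, h0, h1, h2]
  congr 2
  ring

open MvPolynomial in
theorem len_block_le {σ : Type*} {r i : ℕ} {j : Fin 3 → ℕ}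
    (hj : j ∈ Finset.piAntidiag (Finset.univ : Finset (Fin 3)) r) {ℓ : ℝ} (hℓ : 0 ≤ ℓ)
    {w : Fin 3 → ℝ} (hw : ∀ c, |w c| ≤ 3) (z : Fin 3 → MvPolynomial σ ℝ)
    (hz : ∀ c, len (z c) ≤ 2 * Real.exp (w c * ℓ)) :
    len (((j 0).choose i : MvPolynomial σ ℝ) * z 0 ^ (j 0 - i) * (z 1 ^ j 1 * z 2 ^ j 2)) ≤
      4 ^ r * Real.exp (ℓ * (∑ c, w c * j c) + 3 * (i * ℓ)) := by
  rw [Finset.mem_piAntidiag, Fin.sum_univ_three] at hj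
  rcases lt_or_ge (j 0) i with hi | hi
  · rw [Nat.choose_eq_zero_of_lt hi]
    simp only [Nat.cast_zero, zero_mul, len_zero]
    positivity
  · have hpow : ∀ (c : Fin 3) (n : ℕ), len (z c ^ n) ≤ 2 ^ n * Real.exp (n * (w c * ℓ)) := by
      intro c n
      refine (len_pow_le _ _).trans ?_
      rw [Real.exp_nat_mul, ← mul_pow]
      exact pow_le_pow_left₀ (len_nonneg _) (hz c) n
    have hch : len ((j 0).choose i : MvPolynomial σ ℝ) ≤ 2 ^ j 0 := by
      have : ((j 0).choose i : MvPolynomial σ ℝ) = C ((j 0).choose i : ℝ) := by simp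
      rw [this, len_C, Real.norm_natCast]
      exact_mod_cast Nat.choose_le_two_pow _ _
    calc _ ≤ len ((j 0).choose i : MvPolynomial σ ℝ) * len (z 0 ^ (j 0 - i)) *
          (len (z 1 ^ j 1) * len (z 2 ^ j 2)) := by
          refine (len_mul_le _ _).trans ?_
          exact mul_le_mul (len_mul_le _ _) (len_mul_le _ _) (len_nonneg _)
            (mul_nonneg (len_nonneg _) (len_nonneg _))
      _ ≤ 2 ^ j 0 * (2 ^ (j 0 - i) * Real.exp ((j 0 - i : ℕ) * (w 0 * ℓ))) *
          ((2 ^ j 1 * Real.exp (j 1 * (w 1 * ℓ))) * (2 ^ j 2 * Real.exp (j 2 * (w 2 * ℓ)))) := by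
          have := fun n => len_nonneg (z 0 ^ n)
          have := fun n => len_nonneg (z 1 ^ n)
          have := fun n => len_nonneg (z 2 ^ n)
          have := len_nonneg ((j 0).choose i : MvPolynomial σ ℝ)
          exact mul_le_mul (mul_le_mul hch (hpow _ _) (len_nonneg _) (by positivity))
            (mul_le_mul (hpow _ _) (hpow _ _) (len_nonneg _) (by positivity))
            (mul_nonneg (len_nonneg _) (len_nonneg _)) (by positivity)
      _ = 2 ^ (j 0 + (j 0 - i) + j 1 + j 2) * (Real.exp ((j 0 - i : ℕ) * (w 0 * ℓ)) *
          Real.exp (j 1 * (w 1 * ℓ)) * Real.exp (j 2 * (w 2 * ℓ))) := by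
          rw [pow_add, pow_add, pow_add]; ring
      _ ≤ 4 ^ r * Real.exp (ℓ * (∑ c, w c * j c) + 3 * (i * ℓ)) := by
          rw [← Real.exp_add, ← Real.exp_add]
          have h4 : (4 : ℝ) ^ r = 2 ^ (2 * r) := by rw [pow_mul]; norm_num
          rw [h4]
          refine mul_le_mul (pow_le_pow_right₀ (by norm_num) (by omega)) ?_ (Real.exp_pos _).le
            (by positivity)
          rw [Real.exp_le_exp, Fin.sum_univ_three, Nat.cast_sub hi]
          have hw0 := (abs_le.mp (hw 0)).1
          have hiℓ : 0 ≤ (i : ℝ) * ℓ := by positivity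
          nlinarith

open MvPolynomial in
theorem directionalTaylor_eq_zero {m : ℕ} (α : ℝ) (r : Fin m → ℕ)
    (p : (Fin m → Fin 3 → ℕ) → ℤ) (K : ℝ) (hK : 1 ≤ K) (hp : ∀ k, |(p k : ℝ)| ≤ K ^ ∑ h, r h)
    (i : Fin m → ℕ) (e e' : Fin m → Fin 3 → ℤ) (w : Fin m → Fin 3 → ℝ) (ℓ : Fin m → ℝ)
    (hℓ : ∀ h, 0 ≤ ℓ h) (hw : ∀ h c, |w h c| ≤ 3)
    (he : ∀ h c, |twistedCoord α (e h) c| ≤ Real.exp (w h c * ℓ h))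
    (he' : ∀ h c, |twistedCoord α (e' h) c| ≤ Real.exp (w h c * ℓ h)) (τ T : ℝ)
    (hbad : ∀ j ∈ Fintype.piFinset
        (fun h => Finset.piAntidiag (Finset.univ : Finset (Fin 3)) (r h)),
      -τ < ∑ h, ℓ h * ∑ c, w h c * j h c → ∑ k ∈ Fintype.piFinset
          (fun h => Finset.piAntidiag (Finset.univ : Finset (Fin 3)) (r h)),
          (p k : ℝ) * ∏ h, ((substCoeff (k h) (j h) : ℝ) * α ^ substExp (k h) (j h)) = 0)
    (hi : 3 * ∑ h, i h * ℓ h ≤ T)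
    (hfin : (108 * K * (1 + |α|) ^ 2) ^ (∑ h, r h) * Real.exp (T - τ) < 1)
    (S : Type*) [CommRing S] (u u' : Fin m → S) :
    directionalTaylor (Fintype.piFinset
        (fun h => Finset.piAntidiag (Finset.univ : Finset (Fin 3)) (r h))) p i
      (fun h c => (e h c : S) * u h + (e' h c : S) * u' h) = 0 := by
  set J := Fintype.piFinset
    (fun h => Finset.piAntidiag (Finset.univ : Finset (Fin 3)) (r h)) with hJ
  set R := ∑ h, r h with hR
  set F : MvPolynomial (Fin m × Fin 2) ℤ := directionalTaylor J p i
    (fun h c => (e h c : MvPolynomial (Fin m × Fin 2) ℤ) * X (h, 0) +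
      (e' h c : MvPolynomial (Fin m × Fin 2) ℤ) * X (h, 1)) with hF
  suffices hF0 : F = 0 by
    have h1 := congrArg (MvPolynomial.eval₂Hom (Int.castRingHom S)
      (fun x : Fin m × Fin 2 => if x.2 = 0 then u x.1 else u' x.1)) hF0
    rw [map_zero, hF, map_directionalTaylor] at h1
    rw [← h1]
    congr 1
    funext h c
    rw [map_add, map_mul, map_mul, map_intCast, map_intCast]
    simp
  set y : Fin m → Fin 3 → MvPolynomial (Fin m × Fin 2) ℝ := fun h c =>
    (e h c : MvPolynomial (Fin m × Fin 2) ℝ) * X (h, 0) +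
      (e' h c : MvPolynomial (Fin m × Fin 2) ℝ) * X (h, 1) with hy
  set z : Fin m → Fin 3 → MvPolynomial (Fin m × Fin 2) ℝ := fun h c =>
    C (twistedCoord α (e h) c) * X (h, 0) + C (twistedCoord α (e' h) c) * X (h, 1) with hz
  have hFmap : MvPolynomial.map (Int.castRingHom ℝ) F = directionalTaylor J p i y := by
    rw [hF, map_directionalTaylor]
    congr 1
    funext h c
    simp [hy]
  have hzlen : ∀ h c, len (z h c) ≤ 2 * Real.exp (w h c * ℓ h) := by
    intro h c
    have hX : ∀ x : Fin m × Fin 2, len (X x : MvPolynomial (Fin m × Fin 2) ℝ) = 1 := by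
      intro x
      rw [X, len_monomial, norm_one]
    have h1 := len_mul_le (C (twistedCoord α (e h) c)) (X (h, 0) : MvPolynomial (Fin m × Fin 2) ℝ)
    have h2 := len_mul_le (C (twistedCoord α (e' h) c)) (X (h, 1) : MvPolynomial (Fin m × Fin 2) ℝ)
    rw [len_C, hX, Real.norm_eq_abs, mul_one] at h1 h2
    have h3 := len_add_le (C (twistedCoord α (e h) c) * X (h, 0))
      (C (twistedCoord α (e' h) c) * X (h, 1) : MvPolynomial (Fin m × Fin 2) ℝ)
    linarith [he h c, he' h c]
  have hFz := directionalTaylor_eq_sum r p i y z (C α)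
    (fun h => by simp [hz, hy, twistedCoord]; ring) (fun h => by simp [hz, hy, twistedCoord])
    (fun h => by simp [hz, hy, twistedCoord])
  rw [← hJ] at hFz
  set δ : (Fin m → Fin 3 → ℕ) → ℝ := fun j => ∑ k ∈ J,
    (p k : ℝ) * ∏ h, ((substCoeff (k h) (j h) : ℝ) * α ^ substExp (k h) (j h)) with hδ
  have hδC : ∀ j, ∑ k ∈ J, (p k : MvPolynomial (Fin m × Fin 2) ℝ) *
      ∏ h, ((substCoeff (k h) (j h) : MvPolynomial (Fin m × Fin 2) ℝ) *
        C α ^ substExp (k h) (j h)) = C (δ j) := by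
    intro j
    simp [hδ, map_sum, map_prod]
  have hJcard : (J.card : ℝ) ≤ 3 ^ R := by exact_mod_cast card_piFinset_piAntidiag_le r
  have hα1 : 1 ≤ 1 + |α| := by linarith [abs_nonneg α]
  have hδle : ∀ j ∈ J, |δ j| ≤ (9 * K * (1 + |α|) ^ 2) ^ R := by
    intro j hj
    refine (Finset.abs_sum_le_sum_abs _ _).trans ?_
    have h1 : ∀ k ∈ J, |(p k : ℝ) * ∏ h, ((substCoeff (k h) (j h) : ℝ) * α ^ substExp (k h) (j h))|
        ≤ K ^ R * (3 * (1 + |α|) ^ 2) ^ R := by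
      intro k _
      rw [abs_mul, Finset.abs_prod]
      refine mul_le_mul (hp k) ?_ (Finset.prod_nonneg fun _ _ => abs_nonneg _) (by positivity)
      rw [hR, ← Finset.prod_pow_eq_pow_sum]
      refine Finset.prod_le_prod (fun _ _ => abs_nonneg _) fun h _ => ?_
      have hjh := Fintype.mem_piFinset.mp hj h
      rw [abs_mul, abs_pow, mul_pow, ← pow_mul]
      have h2 : |(substCoeff (k h) (j h) : ℝ)| ≤ 3 ^ r h := by
        exact_mod_cast abs_substCoeff_le (k h) hjh
      refine mul_le_mul h2 ?_ (by positivity) (by positivity)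
      exact (pow_le_pow_left₀ (abs_nonneg _) (by linarith) _).trans
        (pow_le_pow_right₀ hα1 (substExp_le (k h) hjh))
    refine (Finset.sum_le_sum h1).trans ?_
    rw [Finset.sum_const, nsmul_eq_mul]
    calc (J.card : ℝ) * (K ^ R * (3 * (1 + |α|) ^ 2) ^ R)
        ≤ 3 ^ R * (K ^ R * (3 * (1 + |α|) ^ 2) ^ R) := by gcongr
      _ = _ := by rw [← mul_pow, ← mul_pow]; congr 1; ring
  have hterm : ∀ j ∈ J, len (C (δ j) * ∏ h, (((j h 0).choose (i h) :
        MvPolynomial (Fin m × Fin 2) ℝ) * z h 0 ^ (j h 0 - i h) *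
          (z h 1 ^ j h 1 * z h 2 ^ j h 2))) ≤
      (36 * K * (1 + |α|) ^ 2) ^ R * Real.exp (T - τ) := by
    intro j hj
    by_cases hjb : -τ < ∑ h, ℓ h * ∑ c, w h c * j h c
    · have h1 : δ j = 0 := hbad j hj hjb
      rw [h1, C_0, zero_mul, len_zero]
      positivity
    · refine (len_mul_le _ _).trans ?_
      rw [len_C, Real.norm_eq_abs]
      have h2 : len (∏ h, (((j h 0).choose (i h) :
          MvPolynomial (Fin m × Fin 2) ℝ) * z h 0 ^ (j h 0 - i h) *
            (z h 1 ^ j h 1 * z h 2 ^ j h 2))) ≤ 4 ^ R * Real.exp (T - τ) := by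
        refine (len_prod_le _ _).trans ((Finset.prod_le_prod (fun _ _ => len_nonneg _)
          fun h _ => len_block_le (Fintype.mem_piFinset.mp hj h) (hℓ h) (hw h) (z h)
            (hzlen h)).trans ?_)
        rw [Finset.prod_mul_distrib, Finset.prod_pow_eq_pow_sum, ← Real.exp_sum,
          Finset.sum_add_distrib, ← Finset.mul_sum]
        gcongr
        linarith
      calc |δ j| * _ ≤ (9 * K * (1 + |α|) ^ 2) ^ R * (4 ^ R * Real.exp (T - τ)) :=
            mul_le_mul (hδle j hj) h2 (len_nonneg _) (by positivity)
        _ = _ := by rw [← mul_assoc, ← mul_pow]; congr 2; ring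
  have hlen : len (MvPolynomial.map (Int.castRingHom ℝ) F) < 1 := by
    rw [hFmap, hFz]
    refine ((len_sum_le _ _).trans (Finset.sum_le_sum fun j hj => ?_)).trans_lt
      (b := ∑ j ∈ J, (36 * K * (1 + |α|) ^ 2) ^ R * Real.exp (T - τ)) ?_
    · rw [hδC]
      exact hterm j hj
    · rw [Finset.sum_const, nsmul_eq_mul]
      refine lt_of_le_of_lt ?_ hfin
      calc (J.card : ℝ) * ((36 * K * (1 + |α|) ^ 2) ^ R * Real.exp (T - τ))
          ≤ 3 ^ R * ((36 * K * (1 + |α|) ^ 2) ^ R * Real.exp (T - τ)) := by gcongr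
        _ = _ := by rw [← mul_assoc, ← mul_pow]; congr 2; ring
  ext s
  have h1 := (norm_coeff_le_len s (MvPolynomial.map (Int.castRingHom ℝ) F)).trans_lt hlen
  rw [coeff_map, eq_intCast, Real.norm_eq_abs] at h1
  rw [coeff_zero]
  have h2 : |coeff s F| < 1 := by exact_mod_cast h1
  exact Int.abs_lt_one_iff.mp h2

open MvPolynomial in
theorem eval_hasse_monomial {σ R : Type*} [Fintype σ] [CommRing R] (ζ : σ → R) (I s : σ →₀ ℕ)
    (a : R) : eval ζ (hasse I (monomial s a)) =
      a * ∏ h, (((s h).choose (I h) : R) * ζ h ^ (s h - I h)) := by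
  classical
  rw [eval_hasse_eq_sum, support_monomial]
  split_ifs with h
  · simp [h]
  · rw [Finset.sum_singleton, coeff_monomial, if_pos rfl]

open MvPolynomial in
theorem exists_polynomial_of_directionalTaylor_eq_zero {m : ℕ} (r : Fin m → ℕ)
    (p : (Fin m → Fin 3 → ℕ) → ℤ)
    (hp : ∃ k ∈ Fintype.piFinset
      (fun h => Finset.piAntidiag (Finset.univ : Finset (Fin 3)) (r h)), p k ≠ 0)
    (K : ℝ) (hK : 1 ≤ K) (hpK : ∀ k, |(p k : ℝ)| ≤ K ^ ∑ h, r h) (x e e' : Fin m → Fin 3 → ℤ)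
    (hx : ∀ h, x h 0 ≠ 0) (hxe : ∀ h, x h 0 * e h 0 + x h 1 * e h 1 + x h 2 * e h 2 = 0)
    (hxe' : ∀ h, x h 0 * e' h 0 + x h 1 * e' h 1 + x h 2 * e' h 2 = 0)
    (hdet : ∀ h, e h 1 * e' h 2 - e h 2 * e' h 1 ≠ 0) (I : Set (Fin m → ℕ))
    (hvan : ∀ i ∈ I, ∀ u u' : Fin m → MvPolynomial (Fin m) ℚ,
      directionalTaylor (Fintype.piFinset
        (fun h => Finset.piAntidiag (Finset.univ : Finset (Fin 3)) (r h))) p i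
        (fun h c => (e h c : MvPolynomial (Fin m) ℚ) * u h + (e' h c : MvPolynomial (Fin m) ℚ) * u' h)
        = 0) :
    ∃ P : MvPolynomial (Fin m) ℤ, P ≠ 0 ∧ (∀ h, P.degreeOf h ≤ r h) ∧
      len P ≤ (3 * K) ^ ∑ h, r h ∧ ∀ i : Fin m →₀ ℕ, ⇑i ∈ I →
        coeff i (MvPolynomial.translate (fun h => ((-x h 1 : ℤ) : ℚ) / (x h 0 : ℤ))
          (MvPolynomial.map (Int.castRingHom ℚ) P)) = 0 := by
  classical
  set J := Fintype.piFinset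
    (fun h => Finset.piAntidiag (Finset.univ : Finset (Fin 3)) (r h)) with hJ
  have hJsum : ∀ k ∈ J, ∀ h, k h 0 + k h 1 + k h 2 = r h := by
    intro k hk h
    have := Fintype.mem_piFinset.mp hk h
    rw [Finset.mem_piAntidiag, Fin.sum_univ_three] at this
    exact this.1
  let col : Fin 3 → (Fin m → Fin 3 → ℕ) → (Fin m →₀ ℕ) :=
    fun c k => Finsupp.equivFunOnFinite.symm fun h => k h c
  have hcol : ∀ c k h, col c k h = k h c := fun _ _ _ => rfl
  set J₁ := J.filter (fun k => p k ≠ 0) with hJ₁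
  obtain ⟨k₁, hk₁, hpk₁⟩ := hp
  obtain ⟨l, hl⟩ := (J₁.image (col 2)).exists_minimal
    ⟨col 2 k₁, Finset.mem_image_of_mem _ (Finset.mem_filter.mpr ⟨hk₁, hpk₁⟩)⟩
  obtain ⟨k₀, hk₀, hk₀l⟩ := Finset.mem_image.mp hl.1
  obtain ⟨hk₀J, hpk₀⟩ := Finset.mem_filter.mp hk₀
  set J₂ := J₁.filter (fun k => col 2 k = l) with hJ₂
  have hJ₂J : ∀ k ∈ J₂, k ∈ J := fun k hk =>
    (Finset.mem_filter.mp (Finset.mem_filter.mp hk).1).1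
  set P : MvPolynomial (Fin m) ℤ := ∑ k ∈ J₂, monomial (col 0 k) (p k) with hP
  have hk₀J₂ : k₀ ∈ J₂ := Finset.mem_filter.mpr ⟨hk₀, hk₀l⟩
  have hcoeff : coeff (col 0 k₀) P = p k₀ := by
    rw [hP, coeff_sum, Finset.sum_eq_single_of_mem k₀ hk₀J₂]
    · rw [coeff_monomial, if_pos rfl]
    · intro k hk hne
      rw [coeff_monomial, if_neg]
      intro h0
      apply hne
      have h2 : col 2 k = col 2 k₀ := (Finset.mem_filter.mp hk).2.trans hk₀l.symm
      funext h c
      have g0 : k h 0 = k₀ h 0 := DFunLike.congr_fun h0 h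
      have g2 : k h 2 = k₀ h 2 := DFunLike.congr_fun h2 h
      have g3 := hJsum k (hJ₂J k hk) h
      have g4 := hJsum k₀ hk₀J h
      fin_cases c
      · exact g0
      · show k h 1 = k₀ h 1
        omega
      · exact g2
  refine ⟨P, fun h0 => ?_, fun h => ?_, ?_, fun i hi => ?_⟩
  · rw [h0, coeff_zero] at hcoeff
    exact hpk₀ hcoeff.symm
  · rw [degreeOf_le_iff]
    intro s hs
    obtain ⟨k, hk, hsk⟩ := Finset.mem_biUnion.mp (support_sum hs)
    have := Finset.mem_singleton.mp (support_monomial_subset hsk)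
    rw [this, hcol]
    have := hJsum k (hJ₂J k hk) h
    omega
  · refine (len_sum_le _ _).trans ?_
    calc ∑ k ∈ J₂, len (monomial (col 0 k) (p k)) ≤ ∑ k ∈ J₂, K ^ ∑ h, r h := by
          refine Finset.sum_le_sum fun k _ => ?_
          rw [len_monomial, Int.norm_eq_abs]
          exact hpK k
      _ = (J₂.card : ℝ) * K ^ ∑ h, r h := by rw [Finset.sum_const, nsmul_eq_mul]
      _ ≤ 3 ^ (∑ h, r h) * K ^ ∑ h, r h := by
          gcongr
          have h1 : J₂.card ≤ J.card := Finset.card_le_card fun k hk => hJ₂J k hk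
          exact_mod_cast h1.trans (card_piFinset_piAntidiag_le r)
      _ = _ := (mul_pow _ _ _).symm
  · set ζ : Fin m → ℚ := fun h => ((-x h 1 : ℤ) : ℚ) / (x h 0 : ℤ) with hζ
    rw [← eval_hasse, hP, map_sum, map_sum, map_sum]
    let Δ : Fin m → ℚ := fun h => e h 1 * e' h 2 - e h 2 * e' h 1
    have hΔ : ∀ h, Δ h ≠ 0 := fun h => by
      have := hdet h
      simp only [Δ]
      exact_mod_cast this
    let ξ : Fin m → MvPolynomial (Fin m) ℚ := fun h => C (ζ h) + C (-(x h 2 : ℚ) / x h 0) * X h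
    have h1 := hvan i hi (fun h => C (Δ h)⁻¹ * (C (e' h 2 : ℚ) - C (e' h 1 : ℚ) * X h))
      (fun h => C (Δ h)⁻¹ * (-C (e h 2 : ℚ) + C (e h 1 : ℚ) * X h))
    have hCi : ∀ n : ℤ, (n : MvPolynomial (Fin m) ℚ) = C (n : ℚ) := fun n => by simp
    have hcomb : ∀ h c, (e h c : MvPolynomial (Fin m) ℚ) *
        (C (Δ h)⁻¹ * (C (e' h 2 : ℚ) - C (e' h 1 : ℚ) * X h)) + (e' h c : MvPolynomial (Fin m) ℚ) *
        (C (Δ h)⁻¹ * (-C (e h 2 : ℚ) + C (e h 1 : ℚ) * X h)) =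
        C ((Δ h)⁻¹ * (e h c * e' h 2 - e' h c * e h 2)) +
          C ((Δ h)⁻¹ * (e' h c * e h 1 - e h c * e' h 1)) * X h := by
      intro h c
      rw [hCi, hCi]
      simp only [map_mul, map_sub]
      ring
    have hy1 : ∀ h, C ((Δ h)⁻¹ * (e h 1 * e' h 2 - e' h 1 * e h 2)) +
          C ((Δ h)⁻¹ * (e' h 1 * e h 1 - e h 1 * e' h 1)) * X h =
          (1 : MvPolynomial (Fin m) ℚ) := by
      intro h
      have g1 : (Δ h)⁻¹ * ((e h 1 : ℚ) * e' h 2 - e' h 1 * e h 2) = 1 := by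
        rw [inv_mul_eq_one₀ (hΔ h)]; simp only [Δ]; ring
      have g2 : (Δ h)⁻¹ * ((e' h 1 : ℚ) * e h 1 - e h 1 * e' h 1) = 0 := by ring
      rw [g1, g2]; simp
    have hy2 : ∀ h, C ((Δ h)⁻¹ * (e h 2 * e' h 2 - e' h 2 * e h 2)) +
          C ((Δ h)⁻¹ * (e' h 2 * e h 1 - e h 2 * e' h 1)) * X h =
          (X h : MvPolynomial (Fin m) ℚ) := by
      intro h
      have g1 : (Δ h)⁻¹ * ((e' h 2 : ℚ) * e h 1 - e h 2 * e' h 1) = 1 := by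
        rw [inv_mul_eq_one₀ (hΔ h)]; simp only [Δ]; ring
      have g2 : (Δ h)⁻¹ * ((e h 2 : ℚ) * e' h 2 - e' h 2 * e h 2) = 0 := by ring
      rw [g1, g2]; simp
    have hy0 : ∀ h, C ((Δ h)⁻¹ * (e h 0 * e' h 2 - e' h 0 * e h 2)) +
          C ((Δ h)⁻¹ * (e' h 0 * e h 1 - e h 0 * e' h 1)) * X h = ξ h := by
      intro h
      have q0 : (x h 0 : ℚ) ≠ 0 := by exact_mod_cast hx h
      have q1 : (x h 0 : ℚ) * e h 0 + x h 1 * e h 1 + x h 2 * e h 2 = 0 := by exact_mod_cast hxe h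
      have q2 : (x h 0 : ℚ) * e' h 0 + x h 1 * e' h 1 + x h 2 * e' h 2 = 0 := by
        exact_mod_cast hxe' h
      have g1 : (Δ h)⁻¹ * ((e h 0 : ℚ) * e' h 2 - e' h 0 * e h 2) = ζ h := by
        rw [inv_mul_eq_iff_eq_mul₀ (hΔ h), hζ]
        push_cast
        rw [mul_div_assoc', eq_div_iff q0]
        simp only [Δ]
        linear_combination (e' h 2 : ℚ) * q1 - (e h 2 : ℚ) * q2
      have g2 : (Δ h)⁻¹ * ((e' h 0 : ℚ) * e h 1 - e h 0 * e' h 1) = -(x h 2 : ℚ) / x h 0 := by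
        rw [inv_mul_eq_iff_eq_mul₀ (hΔ h), mul_div_assoc', eq_div_iff q0]
        simp only [Δ]
        linear_combination (e h 1 : ℚ) * q2 - (e' h 1 : ℚ) * q1
      rw [g1, g2]
    unfold directionalTaylor at h1
    simp_rw [hcomb, hy0, hy1, hy2, one_pow, one_mul] at h1
    have h2 := congrArg (coeff l) h1
    rw [coeff_sum, coeff_zero] at h2
    have hXl : ∀ k : Fin m → Fin 3 → ℕ, ∏ h, (X h : MvPolynomial (Fin m) ℚ) ^ k h 2 =
        monomial (col 2 k) 1 := by
      intro k
      rw [monomial_eq, C_1, one_mul, Finsupp.prod_fintype _ _ (fun _ => pow_zero _)]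
      rfl
    have hterm : ∀ k ∈ J, coeff l ((p k : MvPolynomial (Fin m) ℚ) *
        ∏ h, (((k h 0).choose (i h) : MvPolynomial (Fin m) ℚ) * ξ h ^ (k h 0 - i h) * X h ^ k h 2)) =
        if k ∈ J₂ then eval ζ (hasse i (MvPolynomial.map (Int.castRingHom ℚ)
          (monomial (col 0 k) (p k)))) else 0 := by
      intro k hk
      rw [Finset.prod_mul_distrib, hXl, ← mul_assoc, coeff_mul_monomial', mul_one]
      by_cases hkJ : k ∈ J₂
      · have hkl : col 2 k = l := (Finset.mem_filter.mp hkJ).2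
        rw [if_pos hkl.le, if_pos hkJ, hkl, tsub_self, map_monomial, eval_hasse_monomial,
          ← constantCoeff_eq, map_mul, map_prod]
        congr 1
        · simp
        · refine Finset.prod_congr rfl fun h _ => ?_
          rw [map_mul, map_pow, map_natCast]
          simp [ξ, hcol]
      · rw [if_neg hkJ]
        split_ifs with hle
        · have hpk : p k = 0 := by
            by_contra hpk
            have hkJ₁ : k ∈ J₁ := Finset.mem_filter.mpr ⟨hk, hpk⟩
            have := hl.2 (Finset.mem_image_of_mem (col 2) hkJ₁) hle
            exact hkJ (Finset.mem_filter.mpr ⟨hkJ₁, le_antisymm hle this⟩)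
          simp [hpk]
        · rfl
    rw [Finset.sum_congr rfl hterm, ← Finset.sum_filter] at h2
    rw [← h2]
    refine Finset.sum_congr ?_ fun _ _ => rfl
    ext k
    exact ⟨fun hk => Finset.mem_filter.mpr ⟨hJ₂J k hk, hk⟩, fun hk => (Finset.mem_filter.mp hk).2⟩

theorem exists_seq_rapidly_growing {T : Type*} (f : T → ℝ) (P : T → Prop)
    (h : ∀ N : ℝ, ∃ t, P t ∧ N ≤ f t) {L c : ℝ} (hL : 0 ≤ L) (hc : 1 ≤ c) :
    ∃ x : ℕ → T, (∀ n, P (x n)) ∧ (∀ n, L ≤ f (x n)) ∧ ∀ n n', n < n' → c * f (x n) ≤ f (x n') := by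
  choose g hgP hgf using h
  let x : ℕ → T := fun n => Nat.rec (g L) (fun _ t => g (max L (c * f t))) n
  have hx : ∀ n, x (n + 1) = g (max L (c * f (x n))) := fun n => rfl
  have hxL : ∀ n, L ≤ f (x n) := by
    rintro (_ | n)
    · exact hgf L
    · rw [hx]; exact (le_max_left _ _).trans (hgf _)
  have hstep : ∀ n, c * f (x n) ≤ f (x (n + 1)) := fun n => by
    rw [hx]; exact (le_max_right _ _).trans (hgf _)
  have hmono : Monotone fun n => f (x n) := monotone_nat_of_le_succ fun n => by
    nlinarith [hstep n, hxL n]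
  refine ⟨x, ?_, hxL, fun n n' hn => (hstep n).trans (hmono hn)⟩
  rintro (_ | n)
  · exact hgP L
  · rw [hx]; exact hgP _

set_option maxHeartbeats 1000000 in
theorem not_forall_exists_simultaneous_approximation (α : ℝ) (hα : IsAlgebraic ℚ α)
    (hnq : ∀ a b c : ℤ, (a : ℝ) + b * α + c * α ^ 2 = 0 → a = 0 ∧ b = 0 ∧ c = 0)
    (C : ℝ) (hC : 1 ≤ C) :
    ¬ ∀ N : ℝ, ∃ x : Fin 3 → ℤ, (0 < x 0 ∧ IsCoprime (x 0) (x 1) ∧ |x 0 * α - x 1| ≤ C / x 0 ∧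
      |x 0 * α ^ 2 - x 2| ≤ C / x 0) ∧ N ≤ Real.log (x 0) := by
  classical
  intro hx
  obtain ⟨a, ha0, ha1, Q, hdual⟩ := exists_dual_pair_with_weights α hα hnq C hC
  obtain ⟨d, K, hd, hK, haux⟩ := exists_auxiliary_coefficients α hα
  obtain ⟨m, hm⟩ := exists_nat_ge (1 + 5184 * Real.log (2 * d) / a ^ 2)
  have hd1 : (1 : ℝ) ≤ d := by exact_mod_cast hd
  have hlogd : 0 ≤ Real.log (2 * d) := Real.log_nonneg (by linarith)
  have hm1 : (1 : ℝ) ≤ m := le_trans (by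
    have : 0 ≤ 5184 * Real.log (2 * d) / a ^ 2 := by positivity
    linarith) hm
  have hmexp : Real.exp (-(m * a ^ 2 / 5184)) ≤ 1 / (2 * d) := by
    have h1 : 5184 * Real.log (2 * d) / a ^ 2 ≤ m := by linarith
    rw [div_le_iff₀ (by positivity)] at h1
    rw [one_div, ← Real.exp_log (show (0 : ℝ) < 2 * d by positivity), ← Real.exp_neg]
    exact Real.exp_le_exp.mpr (by linarith)
  obtain ⟨ω, hω, hroth⟩ := roth_lemma m (a / 72) (by positivity)
  set K₂ : ℝ := 108 * K * (1 + |α|) ^ 2 with hK₂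
  have hK₂1 : 1 ≤ K₂ := by
    have : 1 ≤ (1 + |α|) ^ 2 := by nlinarith [abs_nonneg α]
    nlinarith
  have hκ : 0 ≤ Real.log K₂ := Real.log_nonneg hK₂1
  have hK3 : 0 ≤ Real.log (3 * K) := Real.log_nonneg (by linarith)
  set L : ℝ := 1 + |Q| + 2 / ω + 24 * Real.log K₂ / a + 2 * m * Real.log (3 * K) / ω with hL
  have hL1 : 0 ≤ |Q| := abs_nonneg Q
  have hL2 : 0 ≤ 2 / ω := by positivity
  have hL3 : 0 ≤ 24 * Real.log K₂ / a := by positivity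
  have hL4 : 0 ≤ 2 * m * Real.log (3 * K) / ω := by positivity
  obtain ⟨s, hsP, hsL, hsg⟩ := exists_seq_rapidly_growing (fun x : Fin 3 → ℤ => Real.log (x 0)) _ hx
    (L := L) (c := 1 + 2 / ω) (by linarith) (by linarith)
  have hL0 : 0 < L := by linarith
  set Y : ℝ := Real.log (s m 0) with hY
  let x : Fin m → Fin 3 → ℤ := fun h => s (m - 1 - h)
  let ℓ : Fin m → ℝ := fun h => Real.log (x h 0)
  have hℓL : ∀ h, L ≤ ℓ h := fun h => hsL _
  have hℓ0 : ∀ h, 0 < ℓ h := fun h => hL0.trans_le (hℓL h)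
  have hY0 : 0 < Y := hL0.trans_le (hsL m)
  have hℓY : ∀ h, ℓ h ≤ Y := fun h => by
    have := hsg (m - 1 - h) m (by have := h.2; omega)
    have h0 := hℓ0 h
    change (1 + 2 / ω) * ℓ h ≤ Y at this
    nlinarith
  have hℓg : ∀ h h', h < h' → 2 / ω * ℓ h' ≤ ℓ h := fun h h' hh => by
    have := hsg (m - 1 - h') (m - 1 - h) (by have := h'.2; have : (h : ℕ) < h' := hh; omega)
    have h0 := hℓ0 h'
    change (1 + 2 / ω) * ℓ h' ≤ ℓ h at this
    nlinarith
  let r : Fin m → ℕ := fun h => ⌈Y / ℓ h⌉₊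
  have hr0 : ∀ h, 0 < r h := fun h => Nat.ceil_pos.mpr (div_pos hY0 (hℓ0 h))
  have hr1 : ∀ h, Y ≤ r h * ℓ h := fun h => (div_le_iff₀ (hℓ0 h)).mp (Nat.le_ceil _)
  have hr2 : ∀ h, r h * ℓ h ≤ 2 * Y := fun h => by
    have h1 : (r h : ℝ) < Y / ℓ h + 1 := Nat.ceil_lt_add_one (div_pos hY0 (hℓ0 h)).le
    have h2 := mul_le_mul_of_nonneg_right h1.le (hℓ0 h).le
    rw [add_mul, div_mul_cancel₀ _ (hℓ0 h).ne'] at h2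
    linarith [hℓY h]
  have hrL : ∀ h, r h * L ≤ 2 * Y := fun h =>
    (mul_le_mul_of_nonneg_left (hℓL h) (Nat.cast_nonneg _)).trans (hr2 h)
  set R := ∑ h, r h with hR
  have hRL : R * L ≤ 2 * m * Y := by
    rw [hR, Nat.cast_sum, Finset.sum_mul]
    refine (Finset.sum_le_sum fun h _ => hrL h).trans ?_
    rw [Finset.sum_const, Finset.card_univ, Fintype.card_fin, nsmul_eq_mul]
    linarith
  choose e e' w hxe hxe' hdet he he' hw hsum using fun h : Fin m =>
    hdual (x h 0) (x h 1) (x h 2) (hsP _).1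
      ((le_abs_self Q).trans ((by linarith : |Q| ≤ L).trans (hℓL h))) (hsP _).2.2.1 (hsP _).2.2.2
  set J := Fintype.piFinset
    (fun h => Finset.piAntidiag (Finset.univ : Finset (Fin 3)) (r h)) with hJ
  set bad := J.filter fun j => -(m * a * Y / 6) < ∑ h, ℓ h * ∑ i, w h i * j h i with hbad
  have hcard := card_filter_piFinset_le ha0 ha1 hY0 ℓ hℓ0 r hr1 hr2 w hw hsum bad
    fun j hj => Finset.mem_filter.mp hj
  have hcard' : 2 * (bad.card * d) ≤ J.card := by
    have h1 : (bad.card : ℝ) ≤ J.card * (1 / (2 * d)) :=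
      hcard.trans (mul_le_mul_of_nonneg_left hmexp (Nat.cast_nonneg _))
    rw [mul_one_div, le_div_iff₀ (by positivity)] at h1
    have : (2 * (bad.card * d) : ℝ) ≤ J.card := by linarith
    exact_mod_cast this
  obtain ⟨p, hp, hpK, hpbad⟩ := haux m r bad (Finset.filter_subset _ _) hcard'
  obtain ⟨P, hP0, hPdeg, hPlen, hPvan⟩ := exists_polynomial_of_directionalTaylor_eq_zero r p hp K hK
    hpK x e e' (fun h => (hsP _).1.ne') hxe hxe' hdet
    {i | ∑ h, (i h : ℝ) / r h ≤ a / 72} (by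
      intro i hi u u'
      refine directionalTaylor_eq_zero α r p K hK hpK i e e' w ℓ (fun h => (hℓ0 h).le) hw he he'
        (m * a * Y / 6) (m * a * Y / 12) (fun j hj hj' => hpbad j (Finset.mem_filter.mpr ⟨hj, hj'⟩))
        ?_ ?_ _ u u'
      · have h1 : ∑ h, i h * ℓ h ≤ ∑ h, (i h : ℝ) / r h * (2 * Y) := by
          refine Finset.sum_le_sum fun h _ => ?_
          have hr : (0 : ℝ) < r h := by exact_mod_cast hr0 h
          calc i h * ℓ h = (i h : ℝ) / r h * (r h * ℓ h) := by field_simp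
            _ ≤ _ := mul_le_mul_of_nonneg_left (hr2 h) (by positivity)
        rw [← Finset.sum_mul] at h1
        have h2 : (∑ h, (i h : ℝ) / r h) * (2 * Y) ≤ a / 72 * (2 * Y) :=
          mul_le_mul_of_nonneg_right hi (by positivity)
        nlinarith [mul_pos ha0 hY0]
      · change K₂ ^ R * _ < 1
        rw [← Real.exp_log (show 0 < K₂ by linarith), ← Real.exp_nat_mul, ← Real.exp_add,
          Real.exp_lt_one_iff]
        have h1 : 24 * Real.log K₂ / a < L := by linarith
        rw [div_lt_iff₀ ha0] at h1
        by_contra! hcon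
        have h2 : m * a * Y / 12 * L ≤ R * Real.log K₂ * L :=
          mul_le_mul_of_nonneg_right (by linarith) hL0.le
        have h3 : R * L * Real.log K₂ ≤ 2 * m * Y * Real.log K₂ :=
          mul_le_mul_of_nonneg_right hRL hκ
        have hmY : 0 < m * Y := by positivity
        have h4 := mul_lt_mul_of_pos_left h1 hmY
        linarith only [h2, h3, h4])
  obtain ⟨i, hi, hne⟩ := hroth r (fun h => -x h 1) (fun h => x h 0) Y P hr0 (fun h => (hsP _).1)
    (fun h => (hsP _).2.1.symm.neg_left) hY0 hP0 hPdeg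
    (fun h h' hh => by
      have h1 := hℓg h h' hh
      have h2 := (hr2 h).trans (mul_le_mul_of_nonneg_left (hr1 h') zero_le_two)
      rw [div_mul_eq_mul_div, div_le_iff₀ hω] at h1
      have h3 : (r h : ℝ) * ℓ h ≤ ω * r h' * ℓ h := by
        nlinarith [mul_le_mul_of_nonneg_left h1 (Nat.cast_nonneg (α := ℝ) (r h'))]
      exact le_of_mul_le_mul_right h3 (hℓ0 h))
    (fun h => by
      have h1 : 2 / ω ≤ L := by linarith
      have h2 := (mul_le_mul_of_nonneg_left h1 (Nat.cast_nonneg (α := ℝ) (r h))).trans (hrL h)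
      rw [mul_div_assoc', div_le_iff₀ hω] at h2
      linarith)
    (by
      refine hPlen.trans ?_
      rw [← Real.exp_log (show 0 < 3 * K by linarith), ← Real.exp_nat_mul, ← hR]
      refine Real.exp_le_exp.mpr ?_
      have h1 : 2 * m * Real.log (3 * K) / ω ≤ L := by linarith
      rw [div_le_iff₀ hω] at h1
      have h2 : R * Real.log (3 * K) * L ≤ ω * Y * L := by
        nlinarith [mul_le_mul_of_nonneg_right hRL hK3, mul_le_mul_of_nonneg_left h1 hY0.le]
      exact le_of_mul_le_mul_right h2 hL0)
    hr1
  exact hne (hPvan i hi)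

theorem cfVal_cons {x : ℕ} {l : List ℕ} (hl : l ≠ []) : cfVal (x :: l) = x + 1 / cfVal l := by
  cases l with
  | nil => exact absurd rfl hl
  | cons b r => rfl

theorem cfVal_append_singleton (l : List ℕ) (c : ℕ) :
    cfVal (l ++ [c]) = l.foldr (fun (x : ℕ) (y : ℝ) => (x : ℝ) + 1 / y) c := by
  induction l with
  | nil => rfl
  | cons x l ih => rw [List.cons_append, cfVal_cons (by simp), ih, List.foldr_cons]

section Continuants

variable (a : ℕ → ℕ)

theorem contP_add_two (n : ℕ) : contP a (n + 2) = a (n + 1) * contP a (n + 1) + contP a n := rfl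

theorem contQ_add_two (n : ℕ) : contQ a (n + 2) = a (n + 1) * contQ a (n + 1) + contQ a n := rfl

theorem contP_mul_contQ_sub (n : ℕ) :
    contP a (n + 1) * contQ a n - contP a n * contQ a (n + 1) = (-1) ^ (n + 1) := by
  induction n with
  | zero => simp [contP, contQ]
  | succ n ih =>
    rw [contP_add_two, contQ_add_two, pow_succ, ← ih]
    ring

variable {a} (ha : ∀ k, 0 < a k)
include ha

theorem contP_pos (n : ℕ) : 0 < contP a n := by
  induction n using Nat.twoStepInduction with
  | zero => simp [contP]
  | one => simpa [contP] using ha 0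
  | more n h1 h2 =>
    rw [contP_add_two]
    positivity

theorem contQ_nonneg_and_pos (n : ℕ) : 0 ≤ contQ a n ∧ 0 < contQ a (n + 1) := by
  induction n with
  | zero => simp [contQ]
  | succ n ih =>
    refine ⟨ih.2.le, ?_⟩
    rw [contQ_add_two]
    have := ha (n + 1)
    have h1 := ih.1
    have h2 := ih.2
    positivity

theorem contQ_pos {n : ℕ} (hn : 0 < n) : 0 < contQ a n := by
  obtain ⟨k, rfl⟩ := Nat.exists_eq_succ_of_ne_zero hn.ne'
  exact (contQ_nonneg_and_pos ha k).2

theorem contQ_add_le (n : ℕ) : contQ a (n + 1) + contQ a n ≤ contQ a (n + 2) := by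
  rw [contQ_add_two]
  have h1 : (1 : ℤ) ≤ a (n + 1) := by exact_mod_cast ha (n + 1)
  nlinarith [(contQ_nonneg_and_pos ha n).2]

theorem contQ_le_succ (n : ℕ) : contQ a n ≤ contQ a (n + 1) := by
  cases n with
  | zero => simp [contQ]
  | succ n => linarith [contQ_add_le ha n, (contQ_nonneg_and_pos ha n).1]

theorem le_contQ_succ (n : ℕ) : (n : ℤ) ≤ contQ a (n + 1) := by
  induction n with
  | zero => simp [contQ]
  | succ n ih =>
    cases n with
    | zero =>
      have := contQ_pos ha (n := 2) (by norm_num)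
      push_cast
      linarith
    | succ n =>
      have h1 := contQ_add_le ha (n + 1)
      have h2 := contQ_pos ha (n := n + 1) (by omega)
      push_cast at ih ⊢
      linarith

theorem foldr_range_succ (n : ℕ) {y : ℝ} (hy : 0 < y) :
    ((List.range (n + 1)).map a).foldr (fun (x : ℕ) (y : ℝ) => (x : ℝ) + 1 / y) y =
      (contP a (n + 1) * y + contP a n) / (contQ a (n + 1) * y + contQ a n) := by
  induction n generalizing y with
  | zero => simp [contP, contQ]; field_simp
  | succ n ih =>
    rw [List.range_succ, List.map_append, List.foldr_append]
    have h0 : (0 : ℝ) < a (n + 1) := by exact_mod_cast ha (n + 1)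
    have h1 : (0 : ℝ) < a (n + 1) + 1 / y := by positivity
    simp only [List.map_cons, List.map_nil, List.foldr_cons, List.foldr_nil]
    rw [ih h1, contP_add_two, contQ_add_two]
    have q0 : (0 : ℝ) ≤ contQ a n := by exact_mod_cast (contQ_nonneg_and_pos ha n).1
    have q1 : (0 : ℝ) < contQ a (n + 1) := by exact_mod_cast (contQ_nonneg_and_pos ha n).2
    push_cast
    rw [div_eq_div_iff (by positivity) (by positivity)]
    field_simp
    ring

theorem cfVal_cfPrefix (n : ℕ) : cfVal (cfPrefix a n) = contP a (n + 1) / contQ a (n + 1) := by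
  cases n with
  | zero => simp [cfPrefix, cfVal, contP, contQ]
  | succ n =>
    rw [cfPrefix, List.range_succ, List.map_append, List.map_singleton, cfVal_append_singleton,
      foldr_range_succ ha n (by exact_mod_cast ha (n + 1)), contP_add_two, contQ_add_two]
    push_cast
    ring

theorem cfVal_reverse_cfPrefix (n : ℕ) :
    cfVal (cfPrefix a n).reverse = contP a (n + 1) / contP a n := by
  induction n with
  | zero => simp [cfPrefix, cfVal, contP]
  | succ n ih =>
    have h : cfPrefix a (n + 1) = cfPrefix a n ++ [a (n + 1)] := by
      rw [cfPrefix, List.range_succ, List.map_append, List.map_singleton, cfPrefix]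
    rw [h, List.reverse_append, List.reverse_singleton, List.singleton_append,
      cfVal_cons (by simp [cfPrefix]), ih, contP_add_two, one_div_div]
    have h1 : (contP a (n + 1) : ℝ) ≠ 0 := by exact_mod_cast (contP_pos ha _).ne'
    push_cast
    field_simp

theorem IsMPal.contP_eq {m n : ℕ} (h : IsMPal m (cfPrefix a n)) :
    contP a n = m * contQ a (n + 1) := by
  rw [IsMPal, cfVal_cfPrefix ha, cfVal_reverse_cfPrefix ha] at h
  have h0 : (contP a n : ℝ) ≠ 0 := by exact_mod_cast (contP_pos ha _).ne'
  have h1 : (contP a (n + 1) : ℝ) ≠ 0 := by exact_mod_cast (contP_pos ha _).ne'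
  have h2 : (contQ a (n + 1) : ℝ) ≠ 0 := by exact_mod_cast (contQ_pos ha n.succ_pos).ne'
  rw [mul_div_assoc', div_eq_div_iff h2 h0] at h
  have h3 : (contP a n : ℝ) = m * contQ a (n + 1) := mul_left_cancel₀ h1 (by linarith)
  exact_mod_cast h3

variable {α : ℝ} (hα : Filter.Tendsto (fun i => cfVal (cfPrefix a i)) Filter.atTop (nhds α))
include hα

theorem neg_one_pow_mul_contP_sub_nonneg (n : ℕ) :
    0 ≤ (-1 : ℝ) ^ n * (contP a n - α * contQ a n) := by
  cases n with
  | zero => simp [contP, contQ]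
  | succ n =>
    have hq : ∀ k, (0 : ℝ) < contQ a (k + 1) := fun k => by
      exact_mod_cast contQ_pos ha k.succ_pos
    let g : ℕ → ℝ := fun k => (-1 : ℝ) ^ (n + 1) * (contP a (n + 2 * k + 1) / contQ a (n + 2 * k + 1))
    have hg : Antitone g := by
      refine antitone_nat_of_succ_le fun k => ?_
      have e1 : n + 2 * (k + 1) + 1 = n + 2 * k + 1 + 2 := by ring
      simp only [g]
      rw [e1, ← sub_nonneg, ← mul_sub, div_sub_div _ _ (hq _).ne' (hq _).ne', contP_add_two,
        contQ_add_two, ← mul_div_assoc]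
      refine div_nonneg ?_ (mul_pos (hq _) ?_).le
      · have h1 : ((contP a (n + 2 * k + 1 + 1) : ℝ) * contQ a (n + 2 * k + 1) -
            contP a (n + 2 * k + 1) * contQ a (n + 2 * k + 1 + 1)) = (-1) ^ (n + 2 * k + 1 + 1) := by
          exact_mod_cast contP_mul_contQ_sub a (n + 2 * k + 1)
        have h2 : (-1 : ℝ) ^ (n + 2 * k + 1 + 1) = -(-1 : ℝ) ^ (n + 1) := by
          rw [show n + 2 * k + 1 + 1 = n + 1 + 2 * k + 1 by ring, pow_succ, pow_add, pow_mul]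
          simp
        have h3 : (-1 : ℝ) ^ (n + 1) * (-1 : ℝ) ^ (n + 1) = 1 := by
          rw [← mul_pow]; simp
        rw [h2] at h1
        push_cast
        have h4 : (0 : ℝ) ≤ a (n + 2 * k + 1 + 1) * ((-1 : ℝ) ^ (n + 1) * (-1 : ℝ) ^ (n + 1)) := by
          rw [h3]; simp
        refine h4.trans (le_of_eq ?_)
        linear_combination ((a (n + 2 * k + 1 + 1) : ℝ) * (-1 : ℝ) ^ (n + 1)) * h1
      · rw [← contQ_add_two]
        exact hq (n + 2 * k + 1 + 1)
    have hlim : Filter.Tendsto g Filter.atTop (nhds ((-1 : ℝ) ^ (n + 1) * α)) := by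
      refine Filter.Tendsto.const_mul _ ?_
      have h1 : Filter.Tendsto (fun k : ℕ => n + 2 * k) Filter.atTop Filter.atTop :=
        Filter.tendsto_atTop_mono (fun k => (by omega : k ≤ n + 2 * k)) Filter.tendsto_id
      refine (hα.comp h1).congr fun k => ?_
      exact cfVal_cfPrefix ha _
    have h := hg.le_of_tendsto hlim 0
    have hq0 := hq n
    simp only [g, mul_zero, add_zero] at h
    have h5 := mul_le_mul_of_nonneg_right h hq0.le
    rw [mul_assoc, mul_assoc, div_mul_cancel₀ _ hq0.ne'] at h5
    rw [mul_sub]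
    linarith

variable (hirr : Irrational α)
include hirr

theorem neg_one_pow_mul_contP_sub_pos (n : ℕ) :
    0 < (-1 : ℝ) ^ n * (contP a n - α * contQ a n) := by
  refine lt_of_le_of_ne (neg_one_pow_mul_contP_sub_nonneg ha hα n) fun h => ?_
  cases n with
  | zero => simp [contP, contQ] at h
  | succ n =>
    have h1 : (contP a (n + 1) : ℝ) - α * contQ a (n + 1) = 0 := by
      rcases mul_eq_zero.mp h.symm with h | h
      · exact absurd h (pow_ne_zero _ (by norm_num))
      · exact h
    have hq : contQ a (n + 1) ≠ 0 := (contQ_pos ha n.succ_pos).ne'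
    exact (hirr.mul_intCast hq).ne_int (contP a (n + 1)) (by linarith)

theorem abs_contP_sub (n : ℕ) :
    |contP a n - α * contQ a n| = (-1 : ℝ) ^ n * (contP a n - α * contQ a n) := by
  have h := neg_one_pow_mul_contP_sub_pos ha hα hirr n
  rw [← abs_of_pos h, abs_mul, abs_pow, abs_neg, abs_one, one_pow, one_mul]

theorem abs_contP_sub_le (n : ℕ) : |contP a n - α * contQ a n| ≤ 1 / contQ a (n + 1) := by
  have hq : (0 : ℝ) < contQ a (n + 1) := by exact_mod_cast contQ_pos ha n.succ_pos
  have hq0 : (0 : ℝ) ≤ contQ a n := by exact_mod_cast (contQ_nonneg_and_pos ha n).1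
  rw [le_div_iff₀ hq, abs_contP_sub ha hα hirr]
  have h1 := neg_one_pow_mul_contP_sub_pos ha hα hirr (n + 1)
  have h2 : ((contP a (n + 1) : ℝ) * contQ a n - contP a n * contQ a (n + 1)) = (-1) ^ (n + 1) := by
    exact_mod_cast contP_mul_contQ_sub a n
  have h3 : (-1 : ℝ) ^ (n + 1) * (-1 : ℝ) ^ (n + 1) = 1 := by rw [← mul_pow]; simp
  have h4 : (-1 : ℝ) ^ (n + 1) * (contP a (n + 1) - α * contQ a (n + 1)) * contQ a n +
      (-1 : ℝ) ^ n * (contP a n - α * contQ a n) * contQ a (n + 1) = 1 := by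
    rw [pow_succ] at *
    linear_combination h3 - (-1 : ℝ) ^ n * h2
  nlinarith [mul_nonneg h1.le hq0]

theorem abs_contP_succ_sub_lt (n : ℕ) :
    |contP a (n + 1) - α * contQ a (n + 1)| < |contP a n - α * contQ a n| := by
  have h1 := neg_one_pow_mul_contP_sub_pos ha hα hirr (n + 1)
  have h2 := neg_one_pow_mul_contP_sub_pos ha hα hirr (n + 2)
  have h3 : (1 : ℝ) ≤ a (n + 1) := by exact_mod_cast ha (n + 1)
  rw [abs_contP_sub ha hα hirr, abs_contP_sub ha hα hirr]
  have h4 : (-1 : ℝ) ^ (n + 2) * (contP a (n + 2) - α * contQ a (n + 2)) =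
      (-1 : ℝ) ^ n * (contP a n - α * contQ a n) -
        a (n + 1) * ((-1 : ℝ) ^ (n + 1) * (contP a (n + 1) - α * contQ a (n + 1))) := by
    rw [contP_add_two, contQ_add_two]
    push_cast
    ring
  nlinarith

theorem contP_succ_sub_div_mem_Ioo (n : ℕ) :
    ((contP a (n + 1) : ℝ) - α * contQ a (n + 1)) / (contP a n - α * contQ a n) ∈
      Set.Ioo (-1 : ℝ) 0 := by
  have h0 := neg_one_pow_mul_contP_sub_pos ha hα hirr n
  have h1 := neg_one_pow_mul_contP_sub_pos ha hα hirr (n + 1)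
  have h2 := abs_contP_succ_sub_lt ha hα hirr n
  rw [abs_contP_sub ha hα hirr, abs_contP_sub ha hα hirr] at h2
  have h3 : ((contP a (n + 1) : ℝ) - α * contQ a (n + 1)) / (contP a n - α * contQ a n) =
      -(((-1 : ℝ) ^ (n + 1) * (contP a (n + 1) - α * contQ a (n + 1))) /
        ((-1 : ℝ) ^ n * (contP a n - α * contQ a n))) := by
    have h5 : (-1 : ℝ) ^ n ≠ 0 := pow_ne_zero _ (by norm_num)
    rw [pow_succ, mul_assoc, mul_div_mul_left _ _ h5]
    ring
  rw [h3]
  exact ⟨neg_lt_neg ((div_lt_one h0).mpr h2), neg_neg_of_pos (div_pos h1 h0)⟩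

end Continuants

section Palindromic

variable {a : ℕ → ℕ} (ha : ∀ k, 0 < a k) {α : ℝ}
  (hα : Filter.Tendsto (fun i => cfVal (cfPrefix a i)) Filter.atTop (nhds α)) (hirr : Irrational α)
include ha hα hirr

theorem abs_contP_sub_le_one_div {n : ℕ} (hn : 0 < n) :
    |contP a n - α * contQ a n| ≤ 1 / contQ a n := by
  have hq : (0 : ℝ) < contQ a n := by exact_mod_cast contQ_pos ha hn
  have hle : (contQ a n : ℝ) ≤ contQ a (n + 1) := by exact_mod_cast contQ_le_succ ha n
  exact (abs_contP_sub_le ha hα hirr n).trans (one_div_le_one_div_of_le hq hle)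

theorem IsMPal.abs_contQ_mul_sq_sub_le {m n : ℕ} (hn : 0 < n) (h : IsMPal m (cfPrefix a n)) :
    |contQ a n * α ^ 2 - m * contP a (n + 1)| ≤ (|α| + m) / contQ a n := by
  have hP : (contP a n : ℝ) = m * contQ a (n + 1) := by exact_mod_cast h.contP_eq ha
  have h1 := abs_contP_sub_le_one_div ha hα hirr hn
  have h2 := (abs_contP_succ_sub_lt ha hα hirr n).le.trans h1
  have h3 : contQ a n * α ^ 2 - m * contP a (n + 1) =
      -(α * (contP a n - α * contQ a n)) - m * (contP a (n + 1) - α * contQ a (n + 1)) := by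
    linear_combination (-α) * hP + 2 * α * hP
  rw [h3]
  calc _ ≤ |-(α * (contP a n - α * contQ a n))| + |m * (contP a (n + 1) - α * contQ a (n + 1))| :=
        abs_sub _ _
    _ ≤ |α| * (1 / contQ a n) + m * (1 / contQ a n) := by
        rw [abs_neg, abs_mul, abs_mul, Nat.abs_cast]
        gcongr
    _ = _ := by ring

theorem lt_of_infinite_isMPal {m : ℕ} (hm : 0 < m)
    (hpal : ∀ N : ℕ, ∃ n > N, IsMPal m (cfPrefix a n)) : (m : ℝ) < α := by
  refine lt_of_le_of_ne (le_of_not_gt fun hlt => ?_) fun h => (hirr.ne_nat m) h.symm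
  obtain ⟨N, hN⟩ := exists_nat_gt (1 / (m - α))
  obtain ⟨n, hn, h⟩ := hpal (N + 1)
  obtain ⟨k, rfl⟩ : ∃ k, n = k + 1 := ⟨n - 1, by omega⟩
  have hq : (0 : ℝ) < contQ a (k + 1) := by exact_mod_cast contQ_pos ha k.succ_pos
  have hq1 : (1 : ℝ) ≤ contQ a (k + 1) := by exact_mod_cast contQ_pos ha k.succ_pos
  have hkq : (N : ℝ) ≤ contQ a (k + 1) := by
    have h1 := le_contQ_succ ha k
    have h2 : (N : ℤ) ≤ contQ a (k + 1) := by omega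
    exact_mod_cast h2
  have hle : (contQ a (k + 1) : ℝ) ≤ contQ a (k + 2) := by exact_mod_cast contQ_le_succ ha (k + 1)
  have hP : (contP a (k + 1) : ℝ) = m * contQ a (k + 2) := by exact_mod_cast h.contP_eq ha
  have h1 := (le_abs_self _).trans (abs_contP_sub_le_one_div ha hα hirr k.succ_pos)
  have h2 : (1 : ℝ) / contQ a (k + 1) ≤ 1 := (div_le_one hq).mpr hq1
  rw [hP] at h1
  have hm' : (0 : ℝ) < m := by exact_mod_cast hm
  rw [div_lt_iff₀ (by linarith)] at hN
  have h3 : (m - α) * N ≤ (m - α) * contQ a (k + 1) :=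
    mul_le_mul_of_nonneg_left hkq (by linarith)
  have h4 := mul_le_mul_of_nonneg_left hle hm'.le
  linarith

theorem isReducedQuadIrr_of_infinite_isMPal {m : ℕ} (hm : 0 < m)
    (hpal : ∀ N : ℕ, ∃ n > N, IsMPal m (cfPrefix a n)) {A B C : ℤ} (hA : A ≠ 0)
    (hroot : (A : ℝ) * α ^ 2 + B * α + C = 0) : IsReducedQuadIrr (α / m) := by
  have hm' : (0 : ℝ) < m := by exact_mod_cast hm
  refine ⟨hirr.div_natCast hm.ne', (one_lt_div hm').mpr (lt_of_infinite_isMPal ha hα hirr hm hpal),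
    A * m ^ 2, B * m, C, by positivity, ?_, fun y hy hy0 => ?_⟩
  · push_cast
    rw [← hroot]
    field_simp
  obtain ⟨N, hN⟩ := exists_nat_gt (|(A : ℝ)| * (|α| + m) + |(B : ℝ)|)
  obtain ⟨n, hn, h⟩ := hpal (N + 1)
  have hP : (contP a n : ℝ) = m * contQ a (n + 1) := by exact_mod_cast h.contP_eq ha
  have hq : (0 : ℝ) < contQ a n := by exact_mod_cast contQ_pos ha (by omega)
  have hNq : (N : ℝ) ≤ contQ a n := by
    obtain ⟨k, rfl⟩ : ∃ k, n = k + 1 := ⟨n - 1, by omega⟩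
    have h1 := le_contQ_succ ha k
    have h2 : (N : ℤ) ≤ contQ a (k + 1) := by omega
    exact_mod_cast h2
  have h1 := abs_contP_sub_le_one_div ha hα hirr (n := n) (by omega)
  have h2 := h.abs_contQ_mul_sq_sub_le ha hα hirr (n := n) (by omega)
  have hint : A * (m * contP a (n + 1)) + B * contP a n + C * contQ a n = 0 := by
    rw [← Int.abs_lt_one_iff]
    have h3 : (A : ℝ) * (m * contP a (n + 1)) + B * contP a n + C * contQ a n =
        -(A * (contQ a n * α ^ 2 - m * contP a (n + 1))) + B * (contP a n - α * contQ a n) := by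
      linear_combination contQ a n * hroot
    have h4 : |(A : ℝ) * (m * contP a (n + 1)) + B * contP a n + C * contQ a n| < 1 := by
      rw [h3]
      calc _ ≤ |-(A * (contQ a n * α ^ 2 - m * contP a (n + 1)))| +
            |B * (contP a n - α * contQ a n)| := abs_add_le _ _
        _ ≤ |(A : ℝ)| * ((|α| + m) / contQ a n) + |(B : ℝ)| * (1 / contQ a n) := by
          rw [abs_neg, abs_mul, abs_mul]
          gcongr
        _ = (|(A : ℝ)| * (|α| + m) + |(B : ℝ)|) / contQ a n := by ring
        _ < 1 := (div_lt_one hq).mpr (hN.trans_le hNq)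
    exact_mod_cast h4
  have hint' : (A : ℝ) * (m * contP a (n + 1)) + B * contP a n + C * contQ a n = 0 := by
    exact_mod_cast hint
  have hconj : (A * α + B) * (contP a n - α * contQ a n) =
      -(A * m * (contP a (n + 1) - α * contQ a (n + 1))) := by
    linear_combination hint' - contQ a n * hroot + A * α * hP
  have hA' : (A : ℝ) ≠ 0 := by exact_mod_cast hA
  have hother : A * m * y = -(A * α + B) := by
    have h5 : (m * y - α) * (A * m * y + A * α + B) = 0 := by
      push_cast at hy0
      linear_combination hy0 - hroot
    rcases mul_eq_zero.mp h5 with h6 | h6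
    · exact absurd (by field_simp; linarith) hy
    · linarith
  have hD : (contP a n : ℝ) - α * contQ a n ≠ 0 := fun h0 => by
    have := neg_one_pow_mul_contP_sub_pos ha hα hirr n
    rw [h0, mul_zero] at this
    exact this.false
  have hyD : y = (contP a (n + 1) - α * contQ a (n + 1)) / (contP a n - α * contQ a n) := by
    rw [eq_div_iff hD]
    refine mul_left_cancel₀ (mul_ne_zero hA' hm'.ne') ?_
    linear_combination (contP a n - α * contQ a n) * hother - hconj
  rw [hyD]
  exact contP_succ_sub_div_mem_Ioo ha hα hirr n

theorem exists_quadratic_relation_of_infinite_isMPal {m : ℕ} (hm : 0 < m)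
    (hpal : ∀ N : ℕ, ∃ n > N, IsMPal m (cfPrefix a n)) (halg : IsAlgebraic ℚ α) :
    ∃ A B C : ℤ, A ≠ 0 ∧ (A : ℝ) * α ^ 2 + B * α + C = 0 := by
  by_contra hno
  push Not at hno
  have hnq : ∀ A B C : ℤ, (A : ℝ) + B * α + C * α ^ 2 = 0 → A = 0 ∧ B = 0 ∧ C = 0 := by
    intro A B C h
    have hC : C = 0 := by
      by_contra hC
      exact hno C B A hC (by linarith)
    subst hC
    have hB : B = 0 := by
      by_contra hB
      refine (hirr.intCast_mul hB).ne_int (-A) ?_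
      push_cast
      simp at h
      linarith
    subst hB
    exact ⟨by simpa using h, rfl, rfl⟩
  have hm1 : (1 : ℝ) ≤ m := by exact_mod_cast hm
  refine not_forall_exists_simultaneous_approximation α halg hnq (|α| + m)
    (by linarith [abs_nonneg α]) fun N => ?_
  obtain ⟨M, hM⟩ := exists_nat_ge (Real.exp N)
  obtain ⟨n, hn, h⟩ := hpal (M + 1)
  have hq : (0 : ℝ) < contQ a n := by exact_mod_cast contQ_pos ha (by omega)
  have hMq : (M : ℝ) ≤ contQ a n := by
    obtain ⟨k, rfl⟩ : ∃ k, n = k + 1 := ⟨n - 1, by omega⟩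
    have h1 := le_contQ_succ ha k
    have h2 : (M : ℤ) ≤ contQ a (k + 1) := by omega
    exact_mod_cast h2
  refine ⟨![contQ a n, contP a n, m * contP a (n + 1)], ⟨contQ_pos ha (by omega), ?_, ?_, ?_⟩, ?_⟩
  · refine ⟨(-1) ^ (n + 1) * contP a (n + 1), -(-1) ^ (n + 1) * contQ a (n + 1), ?_⟩
    have h1 := contP_mul_contQ_sub a n
    have h3 : (-1 : ℤ) ^ (n + 1) * (-1 : ℤ) ^ (n + 1) = 1 := by rw [← mul_pow]; simp
    simp only [Matrix.cons_val_zero, Matrix.cons_val_one]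
    linear_combination (-1 : ℤ) ^ (n + 1) * h1 + h3
  · have h1 := abs_contP_sub_le_one_div ha hα hirr (n := n) (by omega)
    rw [abs_sub_comm, mul_comm] at h1
    exact h1.trans (div_le_div_of_nonneg_right (by linarith [abs_nonneg α]) hq.le)
  · simpa using h.abs_contQ_mul_sq_sub_le ha hα hirr (n := n) (by omega)
  · exact (Real.le_log_iff_exp_le hq).mpr (hM.trans hMq)

end Palindromic

theorem m_palindromic_transcendental_or_reduced_quadratic
    (m : ℕ) (hm : 0 < m) (a : ℕ → ℕ) (ha : ∀ k, 0 < a k) (α : ℝ)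
    (hα : Filter.Tendsto (fun i => cfVal (cfPrefix a i)) Filter.atTop (nhds α))
    (hirr : Irrational α)
    (hpal : {i : ℕ | IsMPal m (cfPrefix a i)}.Infinite) :
    Transcendental ℚ α ∨ (IsQuadraticIrrational α ∧ IsReducedQuadIrr (α / m)) := by
  have hpal' : ∀ N : ℕ, ∃ n > N, IsMPal m (cfPrefix a n) := fun N =>
    let ⟨n, hn, hN⟩ := hpal.exists_gt N
    ⟨n, hN, hn⟩
  refine or_iff_not_imp_left.mpr fun halg => ?_
  obtain ⟨A, B, C, hA, hroot⟩ := exists_quadratic_relation_of_infinite_isMPal ha hα hirr hm hpal'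
    (not_not.mp halg)
  exact ⟨⟨hirr, A, B, C, hA, hroot⟩,
    isReducedQuadIrr_of_infinite_isMPal ha hα hirr hm hpal' hA hroot⟩
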